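/- Let k ≥ 3 and let S be a hypergraph with s edges which is an overlapping pair, a loose cycle, a (k,s/2,2)-star with s ≥ 4, a (k,s,a)-link with s ≥ 3 and 1 ≤ a ≤ ⌊k/(s−1)⌋, or a Pasch configuration. Suppose J is a finite connected k-uniform hypergraph that contains no bicycle and contains S, and let e_0,…,e_t be an allowed edge order of the edge set of J that starts with the edges of S (in particular with an overlapping pair or loose cycle P_1 = e_0,…,e_i), in which every edge e_j with s ≤ j ≤ t is good or k-bad, and with the property that for all j with s+1 ≤ j ≤ t, if e_j is k-bad then either e_{j−1} is k-bad or some vertex of e_j is new in e_{j−1}. Suppose at least one of the edges e_s,…,e_t is k-bad. Then exactly one of the following holds: (i) e_0,e_1,e_{j−1},e_j forms a (k,2,2)-star for some j with s+1 ≤ j ≤ t, and moreover either S is an overlapping pair, or S is a (k,s/2,2)-star with s ≥ 4 and e_0,…,e_{s−1},e_{j−1},e_j forms a (k,s/2+1,2)-star; (ii) e_0,e_1,e_s forms a (k,3,a)-link where a = |e_0 ∖ e_1|, and moreover either S is an overlapping pair, or S is a (k,s,a)-link with s ≥ 3 and e_0,…,e_s forms a (k,s+1,a)-link; (iii) S is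 a loose cycle with three edges, k = 3, and e_0,e_1,e_2,e_3 forms a Pasch configuration. -/

import Mathlib

variable {V : Type*} [DecidableEq V]

/-! ### Hypergraphs, edge orders, and configurations.
A (finite) hypergraph is represented by its finite set of edges, each edge being a
finite set of vertices; an edge order is a duplicate-free list of edges. -/

/-- The vertex set of a list of edges. -/
def vset (l : List (Finset V)) : Finset V := l.foldr (· ∪ ·) ∅

/-- The set of old vertices of the `i`-th edge of an edge order: those vertices of the
`i`-th edge appearing in some earlier edge. -/
def oldOf (l : List (Finset V)) (i : ℕ) : Finset V := l.getD i ∅ ∩ vset (l.take i)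

/-- The `i`-th edge is good: it has exactly one old vertex. -/
def GoodAt (l : List (Finset V)) (i : ℕ) : Prop := (oldOf l i).card = 1

/-- The `i`-th edge is bad: it has between `2` and `k-1` old vertices. -/
def BadAt (k : ℕ) (l : List (Finset V)) (i : ℕ) : Prop :=
  2 ≤ (oldOf l i).card ∧ (oldOf l i).card ≤ k - 1

/-- The `i`-th edge is `k`-bad: all of its `k` vertices are old. -/
def KBadAt (k : ℕ) (l : List (Finset V)) (i : ℕ) : Prop := (oldOf l i).card = k

/-- An allowed edge order: every non-initial edge is good, bad or `k`-bad, i.e. has at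
least one old vertex. -/
def Allowed (l : List (Finset V)) : Prop :=
  l.Nodup ∧ ∀ i, 0 < i → i < l.length → 1 ≤ (oldOf l i).card

/-- A valid edge order: every non-initial edge is good or bad. -/
def Valid (k : ℕ) (l : List (Finset V)) : Prop :=
  l.Nodup ∧ ∀ i, 0 < i → i < l.length → 1 ≤ (oldOf l i).card ∧ (oldOf l i).card ≤ k - 1

/-- Consecutive edges of the order intersect. -/
def Chain (l : List (Finset V)) : Prop :=
  ∀ i, i + 1 < l.length → (l.getD i ∅ ∩ l.getD (i + 1) ∅).Nonempty

/-- An overlapping pair: two (distinct) edges sharing between `2` and `k-1` vertices. -/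
def OverlapPair (k : ℕ) (l : List (Finset V)) : Prop :=
  ∃ e f : Finset V, l = [e, f] ∧ e ≠ f ∧ 2 ≤ (e ∩ f).card ∧ (e ∩ f).card ≤ k - 1

/-- A loose cycle: at least three edges; cyclically consecutive edges meet in exactly one
vertex and all other pairs of edges are disjoint. -/
def LooseCycle (l : List (Finset V)) : Prop :=
  3 ≤ l.length ∧ l.Nodup ∧
  ∀ i j, i < j → j < l.length →
    (l.getD i ∅ ∩ l.getD j ∅).card =
      if j = i + 1 ∨ (i = 0 ∧ j = l.length - 1) then 1 else 0

/-- A loose path: consecutive edges meet in exactly one vertex and all other pairs of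
edges are disjoint. -/
def LoosePath (l : List (Finset V)) : Prop :=
  l ≠ [] ∧ l.Nodup ∧
  ∀ i j, i < j → j < l.length →
    (l.getD i ∅ ∩ l.getD j ∅).card = if j = i + 1 then 1 else 0

/-- An overlapping pair or a loose cycle. -/
def OPorLC (k : ℕ) (l : List (Finset V)) : Prop := OverlapPair k l ∨ LooseCycle l

/-- A spoiled cycle. -/
def SpoiledCycle (k : ℕ) (l : List (Finset V)) : Prop :=
  Valid k l ∧ Chain l ∧
  ∃ (e₁ e₂ : Finset V) (P₂ : List (Finset V)),
    l = e₁ :: e₂ :: P₂ ∧ OverlapPair k [e₁, e₂] ∧ LoosePath P₂ ∧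
    ∃ x y : V, x ≠ y ∧
      vset [e₁, e₂] ∩ vset P₂ = {x, y} ∧
      (e₂ \ e₁) ∩ (P₂.getD 0 ∅ \ (if 2 ≤ P₂.length then P₂.getD 1 ∅ else e₁)) = {x} ∧
      (e₁ \ e₂) ∩ (P₂.getD (P₂.length - 1) ∅ \
        (if 2 ≤ P₂.length then P₂.getD (P₂.length - 2) ∅ else e₂)) = {y}

/-- A double loose cycle. -/
def DoubleLooseCycle (k : ℕ) (l : List (Finset V)) : Prop :=
  Valid k l ∧ Chain l ∧
  ∃ P₁ P₂ : List (Finset V),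
    l = P₁ ++ P₂ ∧ LooseCycle P₁ ∧ LoosePath P₂ ∧ 2 ≤ P₂.length ∧
    ∃ x y : V, x ≠ y ∧
      vset P₁ ∩ vset P₂ = {x, y} ∧
      (P₂.getD 0 ∅ \ P₂.getD 1 ∅) ∩ P₁.getD (P₁.length - 1) ∅ = {x} ∧
      ∃ a < P₁.length, (P₂.getD (P₂.length - 1) ∅ \ P₂.getD (P₂.length - 2) ∅) ∩
        P₁.getD a ∅ = {y}

/-- A double overlapping pair. -/
def DoubleOverlapPair (k : ℕ) (l : List (Finset V)) : Prop :=
  Valid k l ∧ Chain l ∧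
  ∃ e₁ e₂ e₃ e₄ : Finset V,
    l = [e₁, e₂, e₃, e₄] ∧ OverlapPair k [e₁, e₂] ∧ OverlapPair k [e₃, e₄] ∧
    (e₃ ∩ e₄).card ≤ k - 2 ∧
    ∃ x y : V, x ≠ y ∧
      vset [e₁, e₂] ∩ vset [e₃, e₄] = {x, y} ∧
      (e₁ \ e₂) ∩ (e₄ \ e₃) = {x} ∧ (e₂ \ e₁) ∩ (e₃ \ e₄) = {y}

/-- An overlapping pair/loose cycle with handle. -/
def WithHandle (k : ℕ) (l : List (Finset V)) : Prop :=
  Valid k l ∧ Chain l ∧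
  ∃ (l' : List (Finset V)) (e : Finset V),
    l = l' ++ [e] ∧ OPorLC k l' ∧ BadAt k l (l.length - 1)

/-- An overlapping pair/loose cycle to overlapping pair/loose cycle. -/
def CycleToCycle (k : ℕ) (l : List (Finset V)) : Prop :=
  Valid k l ∧ Chain l ∧
  ∃ P₁ P₂ P₃ : List (Finset V),
    l = P₁ ++ P₂ ++ P₃ ∧ OPorLC k P₁ ∧ OPorLC k P₃ ∧
    ((P₂ = [] ∧ (vset P₁ ∩ vset P₃).card = 1) ∨
     (P₂ ≠ [] ∧ LoosePath P₂ ∧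
       (vset P₁ ∩ vset P₂).card = 1 ∧ vset P₁ ∩ vset P₃ = ∅ ∧
       (vset P₂ ∩ vset P₃).card = 1 ∧
       (2 ≤ P₂.length →
         P₂.getD 1 ∅ ∩ vset P₁ = ∅ ∧ P₂.getD (P₂.length - 2) ∅ ∩ vset P₃ = ∅)))

/-- A bicycle. -/
def Bicycle (k : ℕ) (l : List (Finset V)) : Prop :=
  SpoiledCycle k l ∨ DoubleOverlapPair k l ∨ DoubleLooseCycle k l ∨
    WithHandle k l ∨ CycleToCycle k l

/-- The hypergraph with edge set `E` contains a bicycle: some of its edges, under some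
edge order, form one. -/
def ContainsBicycle (k : ℕ) (E : Finset (Finset V)) : Prop :=
  ∃ l : List (Finset V), l.toFinset ⊆ E ∧ Bicycle k l

/-- A Pasch configuration (for `k = 3`): four edges spanning six vertices, each vertex
lying in exactly two of the edges, one vertex for each of the six pairs of edges. -/
def Pasch (l : List (Finset V)) : Prop :=
  Allowed l ∧ l.length = 4 ∧ (vset l).card = 6 ∧
  (∀ v ∈ vset l, ((Finset.range 4).filter fun i => v ∈ l.getD i ∅).card = 2) ∧
  ∀ i j, i < j → j < 4 → (l.getD i ∅ ∩ l.getD j ∅).card = 1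

/-- A loose star with centre `c`: edges pairwise disjoint except for the common central
vertex `c`. -/
def LooseStar (l : List (Finset V)) (c : V) : Prop :=
  l ≠ [] ∧ l.Nodup ∧ (∀ e ∈ l, c ∈ e) ∧
  ∀ i j, i < j → j < l.length → l.getD i ∅ ∩ l.getD j ∅ = {c}

/-- A `(k,u,2)`-star: `2u` edges forming two loose `u`-stars whose edges are matched up so
that matched edges share all their vertices except the two centres. -/
def StarKU2 (k u : ℕ) (l : List (Finset V)) : Prop :=
  Allowed l ∧ l.length = 2 * u ∧
  ∃ (c₁ c₂ : V) (l₁ l₂ : List (Finset V)),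
    c₁ ≠ c₂ ∧ l₁.length = u ∧ l₂.length = u ∧
    (l₁ ++ l₂).Perm l ∧ LooseStar l₁ c₁ ∧ LooseStar l₂ c₂ ∧
    ∀ i < u, (l₁.getD i ∅).erase c₁ = (l₂.getD i ∅).erase c₂

/-- A `(k,u,a)`-link: `u` edges spanning `k+a` vertices, any two of which together contain
all `k+a` vertices. -/
def KLink (k u a : ℕ) (l : List (Finset V)) : Prop :=
  Allowed l ∧ l.length = u ∧ (vset l).card = k + a ∧
  ∀ i j, i < j → j < u → (l.getD i ∅ ∪ l.getD j ∅).card = k + a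

/-- The hypergraph with edge set `E` is connected. -/
def HyperConnected (E : Finset (Finset V)) : Prop :=
  ∀ F ⊆ E, F.Nonempty → (E \ F).Nonempty → ∃ e ∈ F, ∃ f ∈ E \ F, (e ∩ f).Nonempty

/-- The hypergraph with edge set `E` is `k`-uniform. -/
def Uniform (k : ℕ) (E : Finset (Finset V)) : Prop := ∀ e ∈ E, e.card = k

/-- The possible configurations `S` appearing in Claims 3.7 and 3.8 of the paper: an
overlapping pair, a loose cycle, a `(k,s/2,2)`-star with `s ≥ 4`, a `(k,s,a)`-link with
`s ≥ 3` and `1 ≤ a ≤ ⌊k/(s-1)⌋`, or a Pasch configuration. -/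
def SConfig {V : Type*} [DecidableEq V] (k s : ℕ) (σ : List (Finset V)) : Prop :=
  σ.length = s ∧
  (OverlapPair k σ ∨ LooseCycle σ ∨
   (4 ≤ s ∧ ∃ u, s = 2 * u ∧ StarKU2 k u σ) ∨
   (3 ≤ s ∧ ∃ a, 1 ≤ a ∧ a ≤ k / (s - 1) ∧ KLink k s a σ) ∨
   (k = 3 ∧ Pasch σ))

set_option linter.unusedSectionVars false

set_option linter.unusedSimpArgs false
set_option linter.unusedVariables false

/-! ### Basic lemmas -/

theorem vset_nil' : vset ([] : List (Finset V)) = ∅ := rfl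

theorem vset_cons' (e : Finset V) (l : List (Finset V)) : vset (e :: l) = e ∪ vset l := rfl

theorem mem_vset {l : List (Finset V)} {v : V} : v ∈ vset l ↔ ∃ e ∈ l, v ∈ e := by
  induction l with
  | nil => simp [vset_nil']
  | cons a l ih => simp [vset_cons', ih]

theorem vset_append' (l l' : List (Finset V)) : vset (l ++ l') = vset l ∪ vset l' := by
  ext v; simp only [Finset.mem_union, mem_vset, List.mem_append]; grind

theorem vset_congr {l l' : List (Finset V)} (h : ∀ e, e ∈ l ↔ e ∈ l') : vset l = vset l' := by
  ext v; simp only [mem_vset, h]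

theorem subset_vset {l : List (Finset V)} {e : Finset V} (h : e ∈ l) : e ⊆ vset l :=
  fun _ hv => mem_vset.2 ⟨e, h, hv⟩

theorem getD_mem' {l : List (Finset V)} {i : ℕ} (h : i < l.length) : l.getD i ∅ ∈ l := by
  rw [List.getD_eq_getElem _ _ h]; exact List.getElem_mem h

theorem mem_getD {l : List (Finset V)} {e : Finset V} (h : e ∈ l) :
    ∃ i, i < l.length ∧ l.getD i ∅ = e := by
  obtain ⟨i, hi, rfl⟩ := List.getElem_of_mem h
  exact ⟨i, hi, List.getD_eq_getElem _ _ hi⟩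

theorem mem_vset_getD {l : List (Finset V)} {v : V} :
    v ∈ vset l ↔ ∃ i, i < l.length ∧ v ∈ l.getD i ∅ := by
  rw [mem_vset]
  constructor
  · rintro ⟨e, he, hv⟩
    obtain ⟨i, hi, rfl⟩ := mem_getD he
    exact ⟨i, hi, hv⟩
  · rintro ⟨i, hi, hv⟩
    exact ⟨_, getD_mem' hi, hv⟩

theorem getD_take' {l : List (Finset V)} {i n : ℕ} (h : i < n) :
    (l.take n).getD i ∅ = l.getD i ∅ := by
  simp [List.getD_eq_getElem?_getD, List.getElem?_take, h]

theorem getD_drop' (l : List (Finset V)) (i n : ℕ) :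
    (l.drop n).getD i ∅ = l.getD (n + i) ∅ := by
  simp [List.getD_eq_getElem?_getD, List.getElem?_drop]

theorem getD_app_left {P Q : List (Finset V)} {i : ℕ} (h : i < P.length) :
    (P ++ Q).getD i ∅ = P.getD i ∅ := by
  simp [List.getD_eq_getElem?_getD, List.getElem?_append, h]

theorem getD_app_right {P Q : List (Finset V)} {i : ℕ} (h : P.length ≤ i) :
    (P ++ Q).getD i ∅ = Q.getD (i - P.length) ∅ := by
  simp [List.getD_eq_getElem?_getD, List.getElem?_append, Nat.not_lt.2 h]

theorem mem_vset_take {l : List (Finset V)} {n : ℕ} {v : V} :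
    v ∈ vset (l.take n) ↔ ∃ i, i < n ∧ i < l.length ∧ v ∈ l.getD i ∅ := by
  rw [mem_vset_getD]
  constructor
  · rintro ⟨i, hi, hv⟩
    rw [List.length_take] at hi
    rw [getD_take' (by omega)] at hv
    exact ⟨i, by omega, by omega, hv⟩
  · rintro ⟨i, hi, hi', hv⟩
    refine ⟨i, by rw [List.length_take]; omega, ?_⟩
    rwa [getD_take' (by omega)]

/-- Nodup in terms of `getD`. -/
theorem nodup_getD {l : List (Finset V)} (h : l.Nodup) {i j : ℕ} (hi : i < l.length)
    (hj : j < l.length) (he : l.getD i ∅ = l.getD j ∅) : i = j := by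
  rw [List.getD_eq_getElem _ _ hi, List.getD_eq_getElem _ _ hj] at he
  exact (List.Nodup.getElem_inj_iff h).1 he

theorem nodup_of_getD {l : List (Finset V)}
    (h : ∀ i j, i < j → j < l.length → l.getD i ∅ ≠ l.getD j ∅) : l.Nodup := by
  rw [List.nodup_iff_injective_getElem]
  intro a b hab
  by_contra hne
  have hne' : (a : ℕ) ≠ b := fun h => hne (Fin.ext h)
  have ha := List.getD_eq_getElem l ∅ a.2
  have hb := List.getD_eq_getElem l ∅ b.2
  rcases lt_or_gt_of_ne hne' with h1 | h1
  · exact h _ _ h1 b.2 (by rw [ha, hb]; exact hab)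
  · exact h _ _ h1 a.2 (by rw [ha, hb]; exact hab.symm)

/-- Each edge has a vertex not in `A` or earlier edges. -/
def Fresh (A : Finset V) (l : List (Finset V)) : Prop :=
  ∀ i, i < l.length → ¬ l.getD i ∅ ⊆ A ∪ vset (l.take i)

theorem fresh_append {A : Finset V} {P Q : List (Finset V)} (hP : Fresh A P)
    (hQ : Fresh (A ∪ vset P) Q) : Fresh A (P ++ Q) := by
  intro i hi
  by_cases h : i < P.length
  · rw [getD_app_left h, List.take_append_of_le_length h.le]
    exact hP i h
  · rw [getD_app_right (not_lt.1 h), List.take_append, List.take_of_length_le (not_lt.1 h),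
      vset_append', ← Finset.union_assoc]
    rw [List.length_append] at hi
    exact hQ _ (by omega)

theorem chain_append {P Q : List (Finset V)} (hP : Chain P) (hQ : Chain Q)
    (h : P ≠ [] → Q ≠ [] → (P.getD (P.length - 1) ∅ ∩ Q.getD 0 ∅).Nonempty) : Chain (P ++ Q) := by
  intro i hi
  rw [List.length_append] at hi
  by_cases h1 : i + 1 < P.length
  · rw [getD_app_left (by omega), getD_app_left h1]
    exact hP i h1
  · by_cases h2 : i + 1 = P.length
    · rw [getD_app_left (by omega), getD_app_right (by omega)]
      have e1 : i = P.length - 1 := by omega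
      have e2 : i + 1 - P.length = 0 := by omega
      rw [e2, e1]
      apply h
      · rintro rfl; simp at h2
      · rintro rfl; simp at hi; omega
    · rw [getD_app_right (by omega), getD_app_right (by omega)]
      have e2 : i + 1 - P.length = (i - P.length) + 1 := by omega
      rw [e2]
      exact hQ _ (by omega)

theorem valid_of {k : ℕ} {l : List (Finset V)} (hu : ∀ e ∈ l, e.card = k) (hn : l.Nodup)
    (hc : Chain l) (hf : Fresh ∅ l) : Valid k l := by
  refine ⟨hn, fun i h0 hi => ⟨?_, ?_⟩⟩
  · obtain ⟨v, hv⟩ := hc (i - 1) (by omega)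
    rw [Finset.mem_inter, Nat.sub_add_cancel h0] at hv
    refine Finset.card_pos.2 ⟨v, Finset.mem_inter.2 ⟨hv.2, ?_⟩⟩
    exact mem_vset_take.2 ⟨i - 1, by omega, by omega, hv.1⟩
  · have h1 := hf i hi
    rw [Finset.empty_union] at h1
    have h2 : oldOf l i ⊂ l.getD i ∅ := by
      refine ⟨Finset.inter_subset_left, fun h => h1 (fun v hv => ?_)⟩
      exact (Finset.mem_inter.1 (h hv)).2
    have := Finset.card_lt_card h2
    rw [hu _ (getD_mem' hi)] at this
    omega

theorem lc_inter_sub {l : List (Finset V)} (h : LooseCycle l) {i : ℕ} (hi : i < l.length) :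
    (l.getD i ∅ ∩ vset (l.take i)).card ≤ 2 := by
  have hs : l.getD i ∅ ∩ vset (l.take i) ⊆
      (if 0 < i then l.getD (i - 1) ∅ ∩ l.getD i ∅ else ∅) ∪
      (if 0 < i then (if 1 < i then l.getD 0 ∅ ∩ l.getD i ∅ else ∅) else ∅) := by
    intro v hv
    rw [Finset.mem_inter, mem_vset_take] at hv
    obtain ⟨hv, j, hj, hj', hvj⟩ := hv
    have h3 := h.2.2 j i hj hi
    have hv' : v ∈ l.getD j ∅ ∩ l.getD i ∅ := Finset.mem_inter.2 ⟨hvj, hv⟩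
    have hpos : (l.getD j ∅ ∩ l.getD i ∅).card ≠ 0 := Finset.card_ne_zero_of_mem hv'
    rw [h3] at hpos
    have : i = j + 1 ∨ (j = 0 ∧ i = l.length - 1) := by
      by_contra hh; rw [if_neg hh] at hpos; exact hpos rfl
    rw [if_pos (by omega), if_pos (by omega), Finset.mem_union]
    rcases this with rfl | ⟨rfl, h5⟩
    · left; simpa using hv'
    · right; rw [if_pos (by have := h.1; omega)]; exact hv'
  refine (Finset.card_le_card hs).trans ((Finset.card_union_le _ _).trans ?_)
  have a1 : (if 0 < i then l.getD (i - 1) ∅ ∩ l.getD i ∅ else ∅).card ≤ 1 := by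
    split_ifs with h0
    · rw [h.2.2 (i-1) i (by omega) hi]; split_ifs <;> omega
    · simp
  have a2 : (if 0 < i then (if 1 < i then l.getD 0 ∅ ∩ l.getD i ∅ else ∅) else ∅).card ≤ 1 := by
    split_ifs with h0 h1
    · rw [h.2.2 0 i (by omega) hi]; split_ifs <;> omega
    · simp
    · simp
  omega

theorem lp_inter_sub {l : List (Finset V)} (h : LoosePath l) {i : ℕ} (hi : i < l.length) :
    (l.getD i ∅ ∩ vset (l.take i)).card ≤ 1 := by
  by_cases h0 : i = 0
  · subst h0; simp [vset_nil']
  have hs : l.getD i ∅ ∩ vset (l.take i) ⊆ l.getD (i - 1) ∅ ∩ l.getD i ∅ := by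
    intro v hv
    rw [Finset.mem_inter, mem_vset_take] at hv
    obtain ⟨hv, j, hj, hj', hvj⟩ := hv
    have h3 := h.2.2 j i hj hi
    have hv' : v ∈ l.getD j ∅ ∩ l.getD i ∅ := Finset.mem_inter.2 ⟨hvj, hv⟩
    have hpos : (l.getD j ∅ ∩ l.getD i ∅).card ≠ 0 := Finset.card_ne_zero_of_mem hv'
    rw [h3] at hpos
    have : i = j + 1 := by
      by_contra hh; rw [if_neg hh] at hpos; exact hpos rfl
    subst this
    simpa using hv'
  refine (Finset.card_le_card hs).trans ?_
  rw [h.2.2 (i-1) i (by omega) hi]; split_ifs <;> omega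

theorem lc_chain {l : List (Finset V)} (h : LooseCycle l) : Chain l := by
  intro i hi
  rw [← Finset.card_pos, h.2.2 i (i+1) (by omega) hi, if_pos (Or.inl rfl)]; omega

theorem lp_chain {l : List (Finset V)} (h : LoosePath l) : Chain l := by
  intro i hi
  rw [← Finset.card_pos, h.2.2 i (i+1) (by omega) hi, if_pos rfl]; omega

theorem lc_fresh {k : ℕ} (hk : 3 ≤ k) {l : List (Finset V)} (hu : ∀ e ∈ l, e.card = k)
    (h : LooseCycle l) {A : Finset V} (h0 : ¬ l.getD 0 ∅ ⊆ A) (hA : A ∩ vset l ⊆ l.getD 0 ∅) :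
    Fresh A l := by
  intro i hi hsub
  by_cases hi0 : i = 0
  · subst hi0; apply h0; simpa [vset_nil'] using hsub
  have h1 := lc_inter_sub h hi
  have h2 : l.getD i ∅ ⊆ l.getD i ∅ ∩ vset (l.take i) := by
    intro v hv
    refine Finset.mem_inter.2 ⟨hv, ?_⟩
    rcases Finset.mem_union.1 (hsub hv) with h3 | h3
    · have := hA (Finset.mem_inter.2 ⟨h3, subset_vset (getD_mem' hi) hv⟩)
      exact mem_vset_take.2 ⟨0, by omega, by omega, this⟩
    · exact h3
  have h3 := Finset.card_le_card h2
  rw [hu _ (getD_mem' hi)] at h3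
  omega

theorem lp_fresh {k : ℕ} (hk : 3 ≤ k) {l : List (Finset V)} (hu : ∀ e ∈ l, e.card = k)
    (h : LoosePath l) {A : Finset V} (hA : ∀ e ∈ l, (e ∩ A).card ≤ 1) :
    Fresh A l := by
  intro i hi hsub
  have h1 := lp_inter_sub h hi
  have h4 := hA _ (getD_mem' hi)
  have h2 : l.getD i ∅ ⊆ (l.getD i ∅ ∩ A) ∪ (l.getD i ∅ ∩ vset (l.take i)) := by
    intro v hv
    have := hsub hv
    simp only [Finset.mem_union, Finset.mem_inter] at this ⊢
    tauto
  have h3 := (Finset.card_le_card h2).trans (Finset.card_union_le _ _)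
  rw [hu _ (getD_mem' hi)] at h3
  omega

theorem op_iff {k : ℕ} {e f : Finset V} : OverlapPair k [e, f] ↔
    e ≠ f ∧ 2 ≤ (e ∩ f).card ∧ (e ∩ f).card ≤ k - 1 := by
  constructor
  · rintro ⟨a, b, h, h'⟩
    simp at h
    obtain ⟨rfl, rfl⟩ := h
    exact h'
  · intro h
    exact ⟨e, f, rfl, h⟩

theorem inter_card_lt {k : ℕ} {e f : Finset V} (he : e.card = k) (hf : f.card = k) (hne : e ≠ f) :
    (e ∩ f).card < k := by
  by_contra h
  have h1 : e ∩ f = e := Finset.eq_of_subset_of_card_le Finset.inter_subset_left (by omega)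
  have h2 : e ∩ f = f := Finset.eq_of_subset_of_card_le Finset.inter_subset_right (by omega)
  exact hne (h1.symm.trans h2)

theorem op_of {k : ℕ} {e f : Finset V} (he : e.card = k) (hf : f.card = k) (hne : e ≠ f)
    (h2 : 2 ≤ (e ∩ f).card) : OverlapPair k [e, f] :=
  op_iff.2 ⟨hne, h2, by have := inter_card_lt he hf hne; omega⟩

theorem op_symm {k : ℕ} {e f : Finset V} (h : OverlapPair k [e, f]) : OverlapPair k [f, e] := by
  rw [op_iff] at h ⊢
  rw [Finset.inter_comm]
  exact ⟨h.1.symm, h.2⟩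

theorem vset_pair (e f : Finset V) : vset [e, f] = e ∪ f := by
  simp [vset_cons', vset_nil']

theorem op_chain {k : ℕ} {l : List (Finset V)} (h : OverlapPair k l) : Chain l := by
  obtain ⟨e, f, rfl, h1, h2, h3⟩ := h
  intro i hi
  simp at hi
  subst hi
  rw [← Finset.card_pos]
  change 0 < (e ∩ f).card
  omega

theorem op_fresh {k : ℕ} (hk : 3 ≤ k) {l : List (Finset V)} (hu : ∀ e ∈ l, e.card = k)
    (h : OverlapPair k l) {A : Finset V} (h0 : ¬ l.getD 0 ∅ ⊆ A) (hA : A ∩ vset l ⊆ l.getD 0 ∅) :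
    Fresh A l := by
  obtain ⟨e, f, rfl, h1, h2, h3⟩ := h
  intro i hi
  simp at hi
  have : i = 0 ∨ i = 1 := by omega
  rcases this with rfl | rfl
  · simpa [vset_nil'] using h0
  · simp only [List.getD_cons_succ, List.getD_cons_zero, List.take_succ_cons, List.take_zero,
      vset_cons', vset_nil', Finset.union_empty] at hA ⊢
    intro hs
    have : f ⊆ e ∩ f := by
      intro v hv
      refine Finset.mem_inter.2 ⟨?_, hv⟩
      rcases Finset.mem_union.1 (hs hv) with h | h
      · exact hA (Finset.mem_inter.2 ⟨h, Finset.mem_union_right _ hv⟩)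
      · exact h
    have := Finset.card_le_card this
    rw [hu f (by simp)] at this
    omega

theorem oplc_chain {k : ℕ} {l : List (Finset V)} (h : OPorLC k l) : Chain l :=
  h.elim op_chain lc_chain

theorem oplc_fresh {k : ℕ} (hk : 3 ≤ k) {l : List (Finset V)} (hu : ∀ e ∈ l, e.card = k)
    (h : OPorLC k l) {A : Finset V} (h0 : ¬ l.getD 0 ∅ ⊆ A) (hA : A ∩ vset l ⊆ l.getD 0 ∅) :
    Fresh A l :=
  h.elim (fun h => op_fresh hk hu h h0 hA) (fun h => lc_fresh hk hu h h0 hA)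

theorem oplc_len {k : ℕ} {l : List (Finset V)} (h : OPorLC k l) : 2 ≤ l.length := by
  rcases h with ⟨e, f, rfl, _⟩ | h
  · simp
  · have := h.1; omega

theorem oplc_ne {k : ℕ} {l : List (Finset V)} (h : OPorLC k l) : l ≠ [] := by
  have := oplc_len h
  rintro rfl
  simp at this

theorem oplc_nodup {k : ℕ} {l : List (Finset V)} (h : OPorLC k l) : l.Nodup := by
  rcases h with ⟨e, f, rfl, h, _⟩ | h
  · simp [h]
  · exact h.2.1

theorem oplc_fresh0 {k : ℕ} (hk : 3 ≤ k) {l : List (Finset V)} (hu : ∀ e ∈ l, e.card = k)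
    (h : OPorLC k l) : Fresh ∅ l := by
  apply oplc_fresh hk hu h
  · intro h1
    have h2 := hu _ (getD_mem' (i := 0) (by have := oplc_len h; omega))
    rw [Finset.subset_empty.1 h1] at h2
    simp at h2; omega
  · simp

/-- Rotating a loose cycle. -/
theorem lc_rotate1 {l : List (Finset V)} (h : LooseCycle l) : LooseCycle (l.rotate 1) := by
  have hlen : (l.rotate 1).length = l.length := List.length_rotate _ _
  have hg : ∀ i, i < l.length → (l.rotate 1).getD i ∅ =
      l.getD (if i + 1 < l.length then i + 1 else 0) ∅ := by
    intro i hi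
    rw [List.getD_eq_getElem _ _ (by omega), List.getElem_rotate]
    split_ifs with h1
    · rw [List.getD_eq_getElem _ _ h1]
      congr 1
      exact Nat.mod_eq_of_lt h1
    · rw [List.getD_eq_getElem _ _ (by omega)]
      congr 1
      have : i + 1 = l.length := by omega
      rw [this, Nat.mod_self]
  refine ⟨by rw [hlen]; exact h.1, List.nodup_rotate.2 h.2.1, ?_⟩
  intro i j hij hj
  rw [hlen] at hj ⊢
  rw [hg i (by omega), hg j hj, if_pos (by omega)]
  split_ifs with h1 h2 h2
  · rw [h.2.2 _ _ (by omega) h1, if_pos (by omega)]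
  · rw [h.2.2 _ _ (by omega) h1, if_neg (by omega)]
  · rw [Finset.inter_comm, h.2.2 _ _ (by omega) (by omega), if_pos (by omega)]
  · rw [Finset.inter_comm, h.2.2 _ _ (by omega) (by omega), if_neg (by omega)]

theorem lc_rotate {l : List (Finset V)} (h : LooseCycle l) (n : ℕ) : LooseCycle (l.rotate n) := by
  induction n with
  | zero => simpa using h
  | succ n ih => rw [← List.rotate_rotate]; exact lc_rotate1 ih

theorem lc_first {l : List (Finset V)} (h : LooseCycle l) {e : Finset V} (he : e ∈ l) :
    ∃ l', LooseCycle l' ∧ (∀ f, f ∈ l' ↔ f ∈ l) ∧ l'.length = l.length ∧ l'.getD 0 ∅ = e := by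
  obtain ⟨i, hi, rfl⟩ := mem_getD he
  refine ⟨l.rotate i, lc_rotate h i, fun f => List.mem_rotate, List.length_rotate _ _, ?_⟩
  rw [List.getD_eq_getElem _ _ (by rw [List.length_rotate]; omega), List.getElem_rotate,
    List.getD_eq_getElem _ _ hi]
  congr 1
  rw [Nat.zero_add]
  exact Nat.mod_eq_of_lt hi

theorem lc_last {l : List (Finset V)} (h : LooseCycle l) {e : Finset V} (he : e ∈ l) :
    ∃ l', LooseCycle l' ∧ (∀ f, f ∈ l' ↔ f ∈ l) ∧ l'.length = l.length ∧
      l'.getD (l'.length - 1) ∅ = e := by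
  obtain ⟨l', h1, h2, h3, h4⟩ := lc_first h he
  have hl : l'.length ≠ 0 := by have := h1.1; omega
  refine ⟨l'.rotate 1, lc_rotate1 h1, fun f => by rw [List.mem_rotate, h2],
    by rw [List.length_rotate, h3], ?_⟩
  rw [List.getD_eq_getElem _ _ (by rw [List.length_rotate]; omega), List.getElem_rotate, ← h4,
    List.getD_eq_getElem _ _ (by omega)]
  congr 1
  rw [List.length_rotate, Nat.sub_add_cancel (by omega), Nat.mod_self]

theorem oplc_first {k : ℕ} {l : List (Finset V)} (h : OPorLC k l) {v : V} (hv : v ∈ vset l) :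
    ∃ l', OPorLC k l' ∧ (∀ f, f ∈ l' ↔ f ∈ l) ∧ v ∈ l'.getD 0 ∅ := by
  obtain ⟨e, he, hve⟩ := mem_vset.1 hv
  rcases h with h | h
  · have h' := h
    obtain ⟨a, b, rfl, _⟩ := h'
    simp at he
    rcases he with rfl | rfl
    · exact ⟨_, Or.inl h, fun _ => Iff.rfl, by simpa using hve⟩
    · exact ⟨_, Or.inl (op_symm h), fun _ => by simp [or_comm], by simpa using hve⟩
  · obtain ⟨l', h1, h2, h3, h4⟩ := lc_first h he
    exact ⟨l', Or.inr h1, h2, by rwa [h4]⟩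

theorem oplc_last {k : ℕ} {l : List (Finset V)} (h : OPorLC k l) {v : V} (hv : v ∈ vset l) :
    ∃ l', OPorLC k l' ∧ (∀ f, f ∈ l' ↔ f ∈ l) ∧ v ∈ l'.getD (l'.length - 1) ∅ := by
  obtain ⟨e, he, hve⟩ := mem_vset.1 hv
  rcases h with h | h
  · have h' := h
    obtain ⟨a, b, rfl, _⟩ := h'
    simp at he
    rcases he with rfl | rfl
    · exact ⟨_, Or.inl (op_symm h), fun _ => by simp [or_comm], by simpa using hve⟩
    · exact ⟨_, Or.inl h, fun _ => Iff.rfl, by simpa using hve⟩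
  · obtain ⟨l', h1, h2, h3, h4⟩ := lc_last h he
    exact ⟨l', Or.inr h1, h2, by rwa [h4]⟩

theorem lc_cons {e : Finset V} {q : List (Finset V)} (h : LoosePath q) (h2 : 2 ≤ q.length)
    (he : e ∉ q) (h0 : (e ∩ q.getD 0 ∅).card = 1) (hl : (e ∩ q.getD (q.length - 1) ∅).card = 1)
    (hm : ∀ i, 0 < i → i + 1 < q.length → e ∩ q.getD i ∅ = ∅) : LooseCycle (e :: q) := by
  refine ⟨by simp; omega, List.nodup_cons.2 ⟨he, h.2.1⟩, ?_⟩
  intro i j hij hj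
  obtain ⟨j, rfl⟩ : ∃ j', j = j' + 1 := ⟨j - 1, by omega⟩
  rw [List.getD_cons_succ]
  simp only [List.length_cons] at hj ⊢
  cases i with
  | zero =>
    rw [List.getD_cons_zero]
    by_cases hj0 : j = 0
    · subst hj0; rw [h0]; simp
    · by_cases hjl : j = q.length - 1
      · rw [hjl, hl, if_pos (by omega)]
      · rw [hm j (by omega) (by omega), if_neg (by omega)]; simp
  | succ i =>
    rw [List.getD_cons_succ, h.2.2 i j (by omega) (by omega)]
    by_cases h3 : j = i + 1
    · rw [if_pos h3, if_pos (by omega)]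
    · rw [if_neg h3, if_neg (by omega)]

theorem lc_take {l : List (Finset V)} (h : LooseCycle l) {j : ℕ} (hj : j + 1 < l.length) :
    LoosePath (l.take (j + 1)) := by
  refine ⟨?_, (List.take_sublist _ _).nodup h.2.1, ?_⟩
  · intro h0
    have := congrArg List.length h0
    rw [List.length_take] at this
    simp at this; subst this; simp at hj
  intro a b hab hb
  rw [List.length_take] at hb
  rw [getD_take' (by omega), getD_take' (by omega), h.2.2 a b hab (by omega)]
  by_cases h3 : b = a + 1
  · rw [if_pos (Or.inl h3), if_pos h3]
  · rw [if_neg h3, if_neg (by omega)]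

/-! ### Walks -/

/-- Two vertices lie in a common edge of `X`. -/
def AdjX (X : Set (Finset V)) (u v : V) : Prop := ∃ g ∈ X, u ∈ g ∧ v ∈ g

/-- A walk of edges in `X` from `A` to `B`. -/
def Wk (X : Set (Finset V)) (A B : Finset V) (q : List (Finset V)) : Prop :=
  q ≠ [] ∧ (∀ g ∈ q, g ∈ X) ∧ Chain q ∧ (q.getD 0 ∅ ∩ A).Nonempty ∧
    (q.getD (q.length - 1) ∅ ∩ B).Nonempty

theorem chain_take {q : List (Finset V)} (h : Chain q) (n : ℕ) : Chain (q.take n) := by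
  intro i hi
  rw [List.length_take] at hi
  rw [getD_take' (by omega), getD_take' (by omega)]
  exact h i (by omega)

theorem chain_drop {q : List (Finset V)} (h : Chain q) (n : ℕ) : Chain (q.drop n) := by
  intro i hi
  rw [List.length_drop] at hi
  rw [getD_drop', getD_drop']
  exact h (n + i) (by omega)

theorem wk_pos {X : Set (Finset V)} {A B : Finset V} {q : List (Finset V)} (h : Wk X A B q) :
    0 < q.length := List.length_pos_of_ne_nil h.1

theorem wk_take {X : Set (Finset V)} {A B B' : Finset V} {q : List (Finset V)} (h : Wk X A B q)
    {i : ℕ} (hi : i < q.length) (hB : (q.getD i ∅ ∩ B').Nonempty) :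
    Wk X A B' (q.take (i + 1)) := by
  have hl : (q.take (i + 1)).length = i + 1 := by rw [List.length_take]; omega
  refine ⟨?_, fun g hg => h.2.1 g (List.mem_of_mem_take hg), chain_take h.2.2.1 _, ?_, ?_⟩
  · intro h0; rw [h0] at hl; simp at hl
  · rw [getD_take' (by omega)]; exact h.2.2.2.1
  · rw [hl, getD_take' (by omega)]; exact hB

theorem wk_drop {X : Set (Finset V)} {A A' B : Finset V} {q : List (Finset V)} (h : Wk X A B q)
    {i : ℕ} (hi : i < q.length) (hA : (q.getD i ∅ ∩ A').Nonempty) :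
    Wk X A' B (q.drop i) := by
  have hl : (q.drop i).length = q.length - i := by rw [List.length_drop]
  refine ⟨?_, fun g hg => h.2.1 g (List.mem_of_mem_drop hg), chain_drop h.2.2.1 _, ?_, ?_⟩
  · intro h0; rw [h0] at hl; simp at hl; omega
  · rw [getD_drop']; exact hA
  · rw [hl, getD_drop']
    have : i + (q.length - i - 1) = q.length - 1 := by omega
    rw [this]; exact h.2.2.2.2

theorem wk_splice {X : Set (Finset V)} {A B : Finset V} {q : List (Finset V)} (h : Wk X A B q)
    {i j : ℕ} (hij : i < j) (hj : j < q.length) (hA : (q.getD i ∅ ∩ q.getD j ∅).Nonempty) :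
    Wk X A B (q.take (i + 1) ++ q.drop j) := by
  have hl : (q.take (i + 1)).length = i + 1 := by rw [List.length_take]; omega
  have hl' : (q.drop j).length = q.length - j := by rw [List.length_drop]
  refine ⟨?_, ?_, ?_, ?_, ?_⟩
  · intro h0
    have := congrArg List.length h0
    rw [List.length_append, hl] at this; simp at this
  · intro g hg
    rcases List.mem_append.1 hg with hg | hg
    · exact h.2.1 g (List.mem_of_mem_take hg)
    · exact h.2.1 g (List.mem_of_mem_drop hg)
  · refine chain_append (chain_take h.2.2.1 _) (chain_drop h.2.2.1 _) fun _ _ => ?_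
    rw [hl, getD_take' (by omega), getD_drop']
    exact hA
  · rw [getD_app_left (by omega), getD_take' (by omega)]; exact h.2.2.2.1
  · rw [List.length_append, hl, hl', getD_app_right (by omega), getD_drop', hl]
    have : j + (i + 1 + (q.length - j) - 1 - (i + 1)) = q.length - 1 := by omega
    rw [this]; exact h.2.2.2.2

theorem exists_min_len {Q : List (Finset V) → Prop} (h : ∃ q, Q q) :
    ∃ q, Q q ∧ ∀ q', Q q' → q.length ≤ q'.length := by
  classical
  have h' : ∃ n, ∃ q, Q q ∧ q.length = n := by
    obtain ⟨q, hq⟩ := h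
    exact ⟨_, q, hq, rfl⟩
  obtain ⟨q, hq, hl⟩ := Nat.find_spec h'
  refine ⟨q, hq, fun q' hq' => ?_⟩
  rw [hl]
  exact Nat.find_min' h' ⟨q', hq', rfl⟩

theorem wk_min {X : Set (Finset V)} {A B : Finset V} {q : List (Finset V)} (h : Wk X A B q)
    (hmin : ∀ q', Wk X A B q' → q.length ≤ q'.length) :
    (∀ i, 0 < i → i < q.length → q.getD i ∅ ∩ A = ∅) ∧
    (∀ i, i + 1 < q.length → q.getD i ∅ ∩ B = ∅) ∧
    (∀ i j, i + 1 < j → j < q.length → q.getD i ∅ ∩ q.getD j ∅ = ∅) ∧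
    (∀ i j, i < j → j < q.length → q.getD i ∅ ≠ q.getD j ∅) := by
  refine ⟨?_, ?_, ?_, ?_⟩
  · intro i h0 hi
    by_contra hne
    have := hmin _ (wk_drop h hi (Finset.nonempty_iff_ne_empty.2 hne))
    rw [List.length_drop] at this; omega
  · intro i hi
    by_contra hne
    have := hmin _ (wk_take h (by omega) (Finset.nonempty_iff_ne_empty.2 hne))
    rw [List.length_take] at this; omega
  · intro i j hij hj
    by_contra hne
    have := hmin _ (wk_splice h (by omega) hj (Finset.nonempty_iff_ne_empty.2 hne))
    rw [List.length_append, List.length_take, List.length_drop] at this; omega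
  · intro i j hij hj heq
    by_cases hl : j + 1 = q.length
    · have hB := h.2.2.2.2
      have e1 : q.length - 1 = j := by omega
      rw [e1, ← heq] at hB
      have := hmin _ (wk_take h (by omega) hB)
      rw [List.length_take] at this; omega
    · have hc := h.2.2.1 j (by omega)
      rw [← heq] at hc
      have := hmin _ (wk_splice h (i := i) (j := j + 1) (by omega) (by omega) hc)
      rw [List.length_append, List.length_take, List.length_drop] at this; omega

theorem wk_lp {X : Set (Finset V)} {A B : Finset V} {q : List (Finset V)} (h : Wk X A B q)
    (hmin : ∀ q', Wk X A B q' → q.length ≤ q'.length)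
    (h1 : ∀ i, i + 1 < q.length → (q.getD i ∅ ∩ q.getD (i + 1) ∅).card ≤ 1) : LoosePath q := by
  obtain ⟨m1, m2, m3, m4⟩ := wk_min h hmin
  refine ⟨h.1, nodup_of_getD m4, ?_⟩
  intro i j hij hj
  by_cases hji : j = i + 1
  · rw [if_pos hji]
    subst hji
    have := Finset.card_pos.2 (h.2.2.1 i hj)
    have := h1 i hj
    omega
  · rw [if_neg hji, m3 i j (by omega) hj]; rfl

theorem rtg_symm {X : Set (Finset V)} {u v : V} (h : Relation.ReflTransGen (AdjX X) u v) :
    Relation.ReflTransGen (AdjX X) v u := by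
  induction h with
  | refl => exact Relation.ReflTransGen.refl
  | tail _ hbc ih =>
    obtain ⟨g, hg, h1, h2⟩ := hbc
    exact Relation.ReflTransGen.head ⟨g, hg, h2, h1⟩ ih

theorem rtg_mono {X Y : Set (Finset V)} (hXY : X ⊆ Y) {u v : V}
    (h : Relation.ReflTransGen (AdjX X) u v) : Relation.ReflTransGen (AdjX Y) u v := by
  induction h with
  | refl => exact Relation.ReflTransGen.refl
  | tail _ hbc ih =>
    obtain ⟨g, hg, h1, h2⟩ := hbc
    exact Relation.ReflTransGen.tail ih ⟨g, hXY hg, h1, h2⟩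

theorem rtg_edge {X : Set (Finset V)} {g : Finset V} (hg : g ∈ X) {u v : V} (hu : u ∈ g)
    (hv : v ∈ g) : Relation.ReflTransGen (AdjX X) u v :=
  Relation.ReflTransGen.single ⟨g, hg, hu, hv⟩

theorem wk_of_rtg {X : Set (Finset V)} {u v : V} (h : Relation.ReflTransGen (AdjX X) u v)
    (hne : u ≠ v) : ∃ q, Wk X {u} {v} q := by
  have key : u = v ∨ ∃ q, Wk X {u} {v} q := by
    clear hne
    induction h with
    | refl => exact Or.inl rfl
    | tail _ hbc ih =>
      rename_i b c _
      obtain ⟨g, hg, hb, hc⟩ := hbc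
      right
      rcases ih with rfl | ⟨q, hq⟩
      · refine ⟨[g], by simp, by simpa using hg, fun i hi => by simp at hi, ?_, ?_⟩
        · exact ⟨u, by simpa using hb⟩
        · exact ⟨c, by simpa using hc⟩
      · have hpos := wk_pos hq
        refine ⟨q ++ [g], by simp, ?_, ?_, ?_, ?_⟩
        · intro f hf
          rcases List.mem_append.1 hf with hf | hf
          · exact hq.2.1 f hf
          · simp at hf; subst hf; exact hg
        · refine chain_append hq.2.2.1 (fun i hi => by simp at hi) fun _ _ => ?_
          obtain ⟨w, hw⟩ := hq.2.2.2.2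
          rw [Finset.mem_inter, Finset.mem_singleton] at hw
          obtain ⟨hw, rfl⟩ := hw
          exact ⟨w, Finset.mem_inter.2 ⟨hw, by simpa using hb⟩⟩
        · rw [getD_app_left hpos]; exact hq.2.2.2.1
        · rw [List.length_append, getD_app_right (by simp)]
          exact ⟨c, by simpa using hc⟩
  exact key.resolve_left hne

theorem rtg_of_chain {l : List (Finset V)} (h : Chain l) {u v : V} (hu : u ∈ vset l)
    (hv : v ∈ vset l) : Relation.ReflTransGen (AdjX {g | g ∈ l}) u v := by
  have key : ∀ j i, i ≤ j → j < l.length → ∀ u ∈ l.getD i ∅, ∀ v ∈ l.getD j ∅,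
      Relation.ReflTransGen (AdjX {g | g ∈ l}) u v := by
    intro j
    induction j with
    | zero =>
      intro i hi hj u hu v hv
      have : i = 0 := by omega
      subst this
      exact rtg_edge (getD_mem' hj) hu hv
    | succ j ih =>
      intro i hi hj u hu v hv
      by_cases hij : i = j + 1
      · subst hij; exact rtg_edge (getD_mem' hj) hu hv
      · obtain ⟨w, hw⟩ := h j hj
        rw [Finset.mem_inter] at hw
        exact (ih i (by omega) (by omega) u hu w hw.1).trans (rtg_edge (getD_mem' hj) hw.2 hv)
  obtain ⟨i, hi, hui⟩ := mem_vset_getD.1 hu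
  obtain ⟨j, hj, hvj⟩ := mem_vset_getD.1 hv
  rcases le_total i j with hij | hij
  · exact key j i hij hj u hui v hvj
  · exact rtg_symm (key i j hij hi v hvj u hui)

theorem rtg_of_conn {E : Finset (Finset V)} (h : HyperConnected E) {e f : Finset V} (he : e ∈ E)
    (hf : f ∈ E) {u v : V} (hu : u ∈ e) (hv : v ∈ f) :
    Relation.ReflTransGen (AdjX {g | g ∈ E}) u v := by
  classical
  let F := E.filter (fun g => ∃ w ∈ g, Relation.ReflTransGen (AdjX {g | g ∈ E}) u w)
  have heF : e ∈ F := Finset.mem_filter.2 ⟨he, u, hu, Relation.ReflTransGen.refl⟩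
  by_cases hfF : f ∈ F
  · obtain ⟨-, w, hw, hr⟩ := Finset.mem_filter.1 hfF
    exact hr.trans (rtg_edge hf hw hv)
  · exfalso
    obtain ⟨g, hg, g', hg', w, hw⟩ := h F (Finset.filter_subset _ _) ⟨e, heF⟩
      ⟨f, Finset.mem_sdiff.2 ⟨hf, hfF⟩⟩
    rw [Finset.mem_inter] at hw
    rw [Finset.mem_sdiff] at hg'
    obtain ⟨hgE, w', hw', hr⟩ := Finset.mem_filter.1 hg
    exact hg'.2 (Finset.mem_filter.2 ⟨hg'.1, w, hw.2, hr.trans (rtg_edge hgE hw' hw.1)⟩)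

/-! ### Handles and pairs of cycles -/

/-- The standing assumptions on the hypergraph. -/
structure Ctx (k : ℕ) (E : Finset (Finset V)) : Prop where
  hk : 3 ≤ k
  unif : Uniform k E
  conn : HyperConnected E
  nob : ¬ ContainsBicycle k E

theorem handle {k : ℕ} {E : Finset (Finset V)} (c : Ctx k E) {P : List (Finset V)}
    (hP : OPorLC k P) (hPE : ∀ g ∈ P, g ∈ E) {e : Finset V} (he : e ∈ E)
    (h2 : 2 ≤ (e ∩ vset P).card) : e ⊆ vset P := by
  by_contra hsub
  obtain ⟨v, hv⟩ : (e ∩ vset P).Nonempty := Finset.card_pos.1 (by omega)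
  rw [Finset.mem_inter] at hv
  obtain ⟨P', hP', hmem, hlast⟩ := oplc_last hP hv.2
  have hvs : vset P' = vset P := vset_congr hmem
  have hPE' : ∀ g ∈ P', g ∈ E := fun g hg => hPE g ((hmem g).1 hg)
  have hu : ∀ g ∈ P', g.card = k := fun g hg => c.unif g (hPE' g hg)
  have hall : ∀ g ∈ P' ++ [e], g ∈ E := by
    intro g hg
    rcases List.mem_append.1 hg with hg | hg
    · exact hPE' g hg
    · simp at hg; subst hg; exact he
  have hch : Chain (P' ++ [e]) := by
    refine chain_append (oplc_chain hP') (fun i hi => by simp at hi) fun _ _ => ?_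
    exact ⟨v, Finset.mem_inter.2 ⟨hlast, by simpa using hv.1⟩⟩
  have hval : Valid k (P' ++ [e]) := by
    refine valid_of (fun g hg => c.unif g (hall g hg)) ?_ hch ?_
    · rw [List.nodup_append]
      refine ⟨oplc_nodup hP', by simp, ?_⟩
      intro a ha b hb hab
      simp at hb
      subst hab; subst hb
      exact hsub (hvs ▸ subset_vset ha)
    · refine fresh_append (oplc_fresh0 c.hk hu hP') ?_
      intro i hi
      simp at hi; subst hi
      simpa [vset_nil', hvs] using hsub
  refine c.nob ⟨P' ++ [e], ?_, Or.inr (Or.inr (Or.inr (Or.inl ⟨hval, hch, P', e, rfl, hP', ?_⟩)))⟩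
  · intro g hg
    exact hall g (List.mem_toFinset.1 hg)
  · have hlen : (P' ++ [e]).length - 1 = P'.length := by simp
    have hold : oldOf (P' ++ [e]) ((P' ++ [e]).length - 1) = e ∩ vset P := by
      rw [hlen, oldOf, getD_app_right le_rfl, List.take_left, hvs]; simp
    unfold BadAt
    rw [hold]
    refine ⟨h2, ?_⟩
    have : (e ∩ vset P).card < e.card := by
      refine Finset.card_lt_card ⟨Finset.inter_subset_left, fun h => hsub fun v hv => ?_⟩
      exact (Finset.mem_inter.1 (h hv)).2
    rw [c.unif e he] at this
    omega

theorem mem_E_of_append {E : Finset (Finset V)} {P Q : List (Finset V)}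
    (hP : ∀ g ∈ P, g ∈ E) (hQ : ∀ g ∈ Q, g ∈ E) : ∀ g ∈ P ++ Q, g ∈ E := by
  intro g hg
  rcases List.mem_append.1 hg with h | h
  · exact hP g h
  · exact hQ g h

theorem c2c_one {k : ℕ} {E : Finset (Finset V)} (c : Ctx k E) {P C : List (Finset V)}
    (hP : OPorLC k P) (hPE : ∀ g ∈ P, g ∈ E) (hC : OPorLC k C) (hCE : ∀ g ∈ C, g ∈ E)
    (h1 : (vset P ∩ vset C).card = 1) : False := by
  obtain ⟨v, hv⟩ := Finset.card_eq_one.1 h1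
  have hv' : v ∈ vset P ∩ vset C := by rw [hv]; simp
  rw [Finset.mem_inter] at hv'
  obtain ⟨P', hP', hmem, hlast⟩ := oplc_last hP hv'.1
  obtain ⟨C', hC', hmem', hfirst⟩ := oplc_first hC hv'.2
  have hvs : vset P' = vset P := vset_congr hmem
  have hvs' : vset C' = vset C := vset_congr hmem'
  have hPE' : ∀ g ∈ P', g ∈ E := fun g hg => hPE g ((hmem g).1 hg)
  have hCE' : ∀ g ∈ C', g ∈ E := fun g hg => hCE g ((hmem' g).1 hg)
  have hall := mem_E_of_append hPE' hCE'
  have hk := c.hk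
  have hdis : ∀ g ∈ C', ¬ g ⊆ vset P' := by
    intro g hg hs
    have : g ⊆ vset P ∩ vset C := Finset.subset_inter (hvs ▸ hs) (hvs' ▸ subset_vset hg)
    have := Finset.card_le_card this
    rw [c.unif g (hCE' g hg)] at this
    omega
  have hch : Chain (P' ++ C') := by
    refine chain_append (oplc_chain hP') (oplc_chain hC') fun _ _ => ?_
    exact ⟨v, Finset.mem_inter.2 ⟨hlast, hfirst⟩⟩
  have hval : Valid k (P' ++ C') := by
    refine valid_of (fun g hg => c.unif g (hall g hg)) ?_ hch ?_
    · rw [List.nodup_append]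
      refine ⟨oplc_nodup hP', oplc_nodup hC', ?_⟩
      intro a ha b hb hab
      subst hab
      exact hdis a hb (subset_vset ha)
    · refine fresh_append (oplc_fresh0 c.hk (fun g hg => c.unif g (hPE' g hg)) hP') ?_
      refine oplc_fresh c.hk (fun g hg => c.unif g (hCE' g hg)) hC' ?_ ?_
      · rw [Finset.empty_union]
        exact hdis _ (getD_mem' (by have := oplc_len hC'; omega))
      · rw [Finset.empty_union, hvs, hvs', hv]
        simpa using hfirst
  refine c.nob ⟨P' ++ C', fun g hg => hall g (List.mem_toFinset.1 hg),
    Or.inr (Or.inr (Or.inr (Or.inr ⟨hval, hch, P', [], C', by simp, hP', hC', Or.inl ⟨rfl, ?_⟩⟩)))⟩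
  rw [hvs, hvs', h1]

theorem c2c_path {k : ℕ} {E : Finset (Finset V)} (c : Ctx k E) {P C q : List (Finset V)}
    (hP : OPorLC k P) (hPE : ∀ g ∈ P, g ∈ E) (hC : OPorLC k C) (hCE : ∀ g ∈ C, g ∈ E)
    (hq : LoosePath q) (hqE : ∀ g ∈ q, g ∈ E)
    (hPC : vset P ∩ vset C = ∅)
    (hq0 : (q.getD 0 ∅ ∩ vset P).card = 1)
    (hq0' : ∀ i, 0 < i → i < q.length → q.getD i ∅ ∩ vset P = ∅)
    (hq1 : (q.getD (q.length - 1) ∅ ∩ vset C).card = 1)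
    (hq1' : ∀ i, i + 1 < q.length → q.getD i ∅ ∩ vset C = ∅) : False := by
  have hpos : 0 < q.length := List.length_pos_of_ne_nil hq.1
  have hk := c.hk
  have eP : vset P ∩ vset q = q.getD 0 ∅ ∩ vset P := by
    ext v
    simp only [Finset.mem_inter]
    constructor
    · rintro ⟨h1, h2⟩
      obtain ⟨i, hi, hv⟩ := mem_vset_getD.1 h2
      by_cases h0 : i = 0
      · subst h0; exact ⟨hv, h1⟩
      · have := hq0' i (by omega) hi
        exact absurd (Finset.mem_inter.2 ⟨hv, h1⟩) (by rw [this]; simp)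
    · rintro ⟨h1, h2⟩
      exact ⟨h2, subset_vset (getD_mem' hpos) h1⟩
  have eC : vset q ∩ vset C = q.getD (q.length - 1) ∅ ∩ vset C := by
    ext v
    simp only [Finset.mem_inter]
    constructor
    · rintro ⟨h2, h1⟩
      obtain ⟨i, hi, hv⟩ := mem_vset_getD.1 h2
      by_cases h0 : i = q.length - 1
      · subst h0; exact ⟨hv, h1⟩
      · have := hq1' i (by omega)
        exact absurd (Finset.mem_inter.2 ⟨hv, h1⟩) (by rw [this]; simp)
    · rintro ⟨h1, h2⟩
      exact ⟨subset_vset (getD_mem' (by omega)) h1, h2⟩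
  obtain ⟨v, hv⟩ : (q.getD 0 ∅ ∩ vset P).Nonempty := Finset.card_pos.1 (by omega)
  obtain ⟨w, hw⟩ := Finset.card_eq_one.1 hq1
  have hw' : w ∈ q.getD (q.length - 1) ∅ ∩ vset C := by rw [hw]; simp
  rw [Finset.mem_inter] at hv hw'
  obtain ⟨P', hP', hmem, hlast⟩ := oplc_last hP hv.2
  obtain ⟨C', hC', hmem', hfirst⟩ := oplc_first hC hw'.2
  have hvs : vset P' = vset P := vset_congr hmem
  have hvs' : vset C' = vset C := vset_congr hmem'
  have hPE' : ∀ g ∈ P', g ∈ E := fun g hg => hPE g ((hmem g).1 hg)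
  have hCE' : ∀ g ∈ C', g ∈ E := fun g hg => hCE g ((hmem' g).1 hg)
  have hall := mem_E_of_append (mem_E_of_append hPE' hqE) hCE'
  have ePC : (vset P ∪ vset q) ∩ vset C = {w} := by
    rw [Finset.union_inter_distrib_right, hPC, eC, hw, Finset.empty_union]
  have hdis : ∀ g ∈ C', ¬ g ⊆ vset P ∪ vset q := by
    intro g hg hs
    have : g ⊆ (vset P ∪ vset q) ∩ vset C := Finset.subset_inter hs (hvs' ▸ subset_vset hg)
    have := Finset.card_le_card this
    rw [c.unif g (hCE' g hg), ePC] at this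
    simp at this
    omega
  have hqc : ∀ g ∈ q, (g ∩ vset P).card ≤ 1 := by
    intro g hg
    rw [← hq0, ← eP, Finset.inter_comm]
    exact Finset.card_le_card (Finset.inter_subset_inter_left (subset_vset hg))
  have hch1 : Chain (P' ++ q) := by
    refine chain_append (oplc_chain hP') (lp_chain hq) fun _ _ => ?_
    exact ⟨v, Finset.mem_inter.2 ⟨hlast, hv.1⟩⟩
  have hch : Chain (P' ++ q ++ C') := by
    refine chain_append hch1 (oplc_chain hC') fun _ _ => ?_
    refine ⟨w, Finset.mem_inter.2 ⟨?_, hfirst⟩⟩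
    rw [List.length_append, getD_app_right (by omega)]
    have : P'.length + q.length - 1 - P'.length = q.length - 1 := by omega
    rw [this]; exact hw'.1
  have hval : Valid k (P' ++ q ++ C') := by
    refine valid_of (fun g hg => c.unif g (hall g hg)) ?_ hch ?_
    · rw [List.nodup_append]
      refine ⟨?_, oplc_nodup hC', ?_⟩
      · rw [List.nodup_append]
        refine ⟨oplc_nodup hP', hq.2.1, ?_⟩
        intro a ha b hb hab
        subst hab
        have h1 := hqc a hb
        rw [Finset.inter_eq_left.2 (hvs ▸ subset_vset ha), c.unif a (hqE a hb)] at h1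
        omega
      · intro a ha b hb hab
        subst hab
        refine hdis a hb ?_
        rw [← hvs, ← vset_append']
        exact subset_vset ha
    · refine fresh_append (fresh_append
        (oplc_fresh0 c.hk (fun g hg => c.unif g (hPE' g hg)) hP') ?_) ?_
      · refine lp_fresh hk (fun g hg => c.unif g (hqE g hg)) hq ?_
        rw [Finset.empty_union, hvs]
        exact hqc
      · refine oplc_fresh c.hk (fun g hg => c.unif g (hCE' g hg)) hC' ?_ ?_
        · rw [Finset.empty_union, vset_append', hvs]
          exact hdis _ (getD_mem' (by have := oplc_len hC'; omega))
        · rw [Finset.empty_union, vset_append', hvs, hvs', ePC]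
          simpa using hfirst
  refine c.nob ⟨P' ++ q ++ C', fun g hg => hall g (List.mem_toFinset.1 hg),
    Or.inr (Or.inr (Or.inr (Or.inr ⟨hval, hch, P', q, C', rfl, hP', hC',
      Or.inr ⟨hq.1, hq, ?_, ?_, ?_, ?_⟩⟩)))⟩
  · rw [hvs, eP, hq0]
  · rw [hvs, hvs', hPC]
  · rw [hvs', eC, hq1]
  · intro h2
    rw [hvs, hvs']
    exact ⟨hq0' 1 (by omega) (by omega), hq1' _ (by omega)⟩

theorem not_disjoint {k : ℕ} {E : Finset (Finset V)} (c : Ctx k E) : ∀ (n : ℕ)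
    (P C q : List (Finset V)), OPorLC k P → (∀ g ∈ P, g ∈ E) → OPorLC k C → (∀ g ∈ C, g ∈ E) →
    vset P ∩ vset C = ∅ → Wk {g | g ∈ E} (vset P) (vset C) q → q.length ≤ n → False := by
  intro n
  induction n with
  | zero =>
    intro P C q _ _ _ _ _ hq hn
    have := wk_pos hq
    omega
  | succ n ih =>
    intro P C q₀ hP hPE hC hCE hPC hq₀ hn₀
    obtain ⟨q, hq, hmin⟩ := exists_min_len ⟨q₀, hq₀⟩
    have hn : q.length ≤ n + 1 := (hmin _ hq₀).trans hn₀
    obtain ⟨m1, m2, m3, m4⟩ := wk_min hq hmin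
    have hpos := wk_pos hq
    have hqE : ∀ g ∈ q, g ∈ E := fun g hg => hq.2.1 g hg
    have hq0 : (q.getD 0 ∅ ∩ vset P).card = 1 := by
      have h1 := Finset.card_pos.2 hq.2.2.2.1
      by_contra hne
      have hs := handle c hP hPE (hqE _ (getD_mem' hpos)) (by omega)
      by_cases h2 : 1 < q.length
      · obtain ⟨v, hv⟩ := hq.2.2.1 0 h2
        rw [Finset.mem_inter] at hv
        have : v ∈ q.getD 1 ∅ ∩ vset P := Finset.mem_inter.2 ⟨hv.2, hs hv.1⟩
        rw [m1 1 (by omega) h2] at this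
        simp at this
      · obtain ⟨v, hv⟩ := hq.2.2.2.2
        have e1 : q.length - 1 = 0 := by omega
        rw [e1, Finset.mem_inter] at hv
        have : v ∈ vset P ∩ vset C := Finset.mem_inter.2 ⟨hs hv.1, hv.2⟩
        rw [hPC] at this
        simp at this
    have hq1 : (q.getD (q.length - 1) ∅ ∩ vset C).card = 1 := by
      have h1 := Finset.card_pos.2 hq.2.2.2.2
      by_contra hne
      have hs : q.getD (q.length - 1) ∅ ⊆ vset C := handle c hC hCE (hqE _ (getD_mem' (by omega))) (by omega)
      by_cases h2 : 1 < q.length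
      · obtain ⟨v, hv⟩ := hq.2.2.1 (q.length - 2) (by omega)
        have e1 : q.length - 2 + 1 = q.length - 1 := by omega
        rw [Finset.mem_inter, e1] at hv
        have : v ∈ q.getD (q.length - 2) ∅ ∩ vset C := Finset.mem_inter.2 ⟨hv.1, hs hv.2⟩
        rw [m2 _ (by omega)] at this
        simp at this
      · obtain ⟨v, hv⟩ := hq.2.2.2.1
        have e1 : q.length - 1 = 0 := by omega
        rw [Finset.mem_inter] at hv
        rw [e1] at hs
        have : v ∈ vset P ∩ vset C := Finset.mem_inter.2 ⟨hv.2, hs hv.1⟩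
        rw [hPC] at this
        simp at this
    refine c2c_path c hP hPE hC hCE (wk_lp hq hmin ?_) hqE hPC hq0 m1 hq1 m2
    intro i hi
    by_contra hov
    have hO : OPorLC k [q.getD i ∅, q.getD (i + 1) ∅] := Or.inl
      (op_of (c.unif _ (hqE _ (getD_mem' (by omega)))) (c.unif _ (hqE _ (getD_mem' hi)))
        (m4 i (i + 1) (by omega) hi) (by omega))
    have hOE : ∀ g ∈ [q.getD i ∅, q.getD (i + 1) ∅], g ∈ E := by
      intro g hg
      simp only [List.mem_cons, List.not_mem_nil, or_false] at hg
      rcases hg with rfl | rfl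
      · exact hqE _ (getD_mem' (by omega))
      · exact hqE _ (getD_mem' hi)
    have hVO : vset P ∩ vset [q.getD i ∅, q.getD (i + 1) ∅] = q.getD i ∅ ∩ vset P := by
      rw [vset_pair, Finset.inter_union_distrib_left, Finset.inter_comm _ (q.getD (i + 1) ∅),
        m1 (i + 1) (by omega) hi, Finset.union_empty, Finset.inter_comm]
    by_cases h0 : i = 0
    · subst h0
      exact c2c_one c hP hPE hO hOE (by rw [hVO, hq0])
    · refine ih P _ (q.take (i - 1 + 1)) hP hPE hO hOE ?_ (wk_take hq (by omega) ?_) ?_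
      · rw [hVO, m1 i (by omega) (by omega)]
      · rw [vset_pair]
        obtain ⟨v, hv⟩ := hq.2.2.1 (i - 1) (by omega)
        rw [Finset.mem_inter, Nat.sub_add_cancel (by omega)] at hv
        exact ⟨v, Finset.mem_inter.2 ⟨hv.1, Finset.mem_union_left _ hv.2⟩⟩
      · rw [List.length_take]; omega

theorem two_common {k : ℕ} {E : Finset (Finset V)} (c : Ctx k E) {P C : List (Finset V)}
    (hP : OPorLC k P) (hPE : ∀ g ∈ P, g ∈ E) (hC : OPorLC k C) (hCE : ∀ g ∈ C, g ∈ E) :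
    2 ≤ (vset P ∩ vset C).card := by
  by_contra hlt
  by_cases h1 : (vset P ∩ vset C).card = 1
  · exact c2c_one c hP hPE hC hCE h1
  have h0 : vset P ∩ vset C = ∅ := Finset.card_eq_zero.1 (by omega)
  have hk := c.hk
  have ne : ∀ l, OPorLC k l → (∀ g ∈ l, g ∈ E) → ∃ e ∈ l, ∃ v, v ∈ e := by
    intro l hl hlE
    have hm : l.getD 0 ∅ ∈ l := getD_mem' (by have := oplc_len hl; omega)
    have : 0 < (l.getD 0 ∅).card := by rw [c.unif _ (hlE _ hm)]; omega
    obtain ⟨v, hv⟩ := Finset.card_pos.1 this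
    exact ⟨_, hm, v, hv⟩
  obtain ⟨e, he, u, hu⟩ := ne P hP hPE
  obtain ⟨f, hf, v, hv⟩ := ne C hC hCE
  have huv : u ≠ v := by
    rintro rfl
    have : u ∈ vset P ∩ vset C :=
      Finset.mem_inter.2 ⟨subset_vset he hu, subset_vset hf hv⟩
    rw [h0] at this
    simp at this
  obtain ⟨q, hq⟩ := wk_of_rtg (rtg_of_conn c.conn (hPE e he) (hCE f hf) hu hv) huv
  refine not_disjoint c q.length P C q hP hPE hC hCE h0
    ⟨hq.1, hq.2.1, hq.2.2.1, hq.2.2.2.1.mono ?_, hq.2.2.2.2.mono ?_⟩ le_rfl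
  · exact Finset.inter_subset_inter_left (by simpa using subset_vset he hu)
  · exact Finset.inter_subset_inter_left (by simpa using subset_vset hf hv)

/-! ### Ears -/

theorem inter_union_split {e a b : Finset V} (h : e ⊆ a ∪ b) :
    e.card ≤ (e ∩ a).card + (e ∩ b).card := by
  refine le_trans (Finset.card_le_card (t := (e ∩ a) ∪ (e ∩ b)) ?_) (Finset.card_union_le _ _)
  rw [← Finset.inter_union_distrib_left]
  exact Finset.subset_inter (Finset.Subset.refl _) h

theorem dop_false {k : ℕ} {E : Finset (Finset V)} (c : Ctx k E) {p1 p2 q1 q2 : Finset V}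
    (hP : OverlapPair k [p1, p2]) (hPE : ∀ g ∈ [p1, p2], g ∈ E)
    (hO : OverlapPair k [q1, q2]) (hOE : ∀ g ∈ [q1, q2], g ∈ E)
    {x y : V} (hxy : x ≠ y) (hx : q1 ∩ (p1 ∪ p2) = {x}) (hy : q2 ∩ (p1 ∪ p2) = {y})
    (hx1 : x ∈ p1) (hx2 : x ∉ p2) (hy1 : y ∉ p1) (hy2 : y ∈ p2)
    (h2 : (q1 ∩ q2).card ≤ k - 2) : False := by
  have hk := c.hk
  have hall := mem_E_of_append hPE (Q := [q2, q1]) (fun g hg => hOE g (by simp at hg ⊢; tauto))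
  have cq1 : q1.card = k := c.unif _ (hOE _ (by simp))
  have cq2 : q2.card = k := c.unif _ (hOE _ (by simp))
  have hx' : ∀ v, v ∈ q1 → v ∈ p1 ∪ p2 → v = x := fun v h h' => by
    have : v ∈ q1 ∩ (p1 ∪ p2) := Finset.mem_inter.2 ⟨h, h'⟩
    rw [hx] at this; simpa using this
  have hy' : ∀ v, v ∈ q2 → v ∈ p1 ∪ p2 → v = y := fun v h h' => by
    have : v ∈ q2 ∩ (p1 ∪ p2) := Finset.mem_inter.2 ⟨h, h'⟩
    rw [hy] at this; simpa using this
  have hxq : x ∈ q1 := by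
    have : x ∈ q1 ∩ (p1 ∪ p2) := by rw [hx]; simp
    exact (Finset.mem_inter.1 this).1
  have hyq : y ∈ q2 := by
    have : y ∈ q2 ∩ (p1 ∪ p2) := by rw [hy]; simp
    exact (Finset.mem_inter.1 this).1
  have hxq2 : x ∉ q2 := fun h => hxy (hy' x h (Finset.mem_union_left _ hx1))
  have hyq1 : y ∉ q1 := fun h => hxy (hx' y h (Finset.mem_union_right _ hy2)).symm
  have n1 : ¬ q2 ⊆ p1 ∪ p2 := by
    intro h
    have : q2 ∩ (p1 ∪ p2) = q2 := Finset.inter_eq_left.2 h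
    rw [this] at hy
    rw [hy] at cq2
    simp at cq2
    omega
  have n1' : ¬ q1 ⊆ p1 ∪ p2 := by
    intro h
    have : q1 ∩ (p1 ∪ p2) = q1 := Finset.inter_eq_left.2 h
    rw [this] at hx
    rw [hx] at cq1
    simp at cq1
    omega
  have n2 : ¬ q1 ⊆ (p1 ∪ p2) ∪ q2 := by
    intro h
    have := inter_union_split h
    rw [hx] at this
    simp at this
    omega
  have hch : Chain ([p1, p2] ++ [q2, q1]) := by
    refine chain_append (op_chain hP) (op_chain (op_symm hO)) fun _ _ => ?_
    exact ⟨y, by simp [hy2, hyq]⟩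
  have hval : Valid k ([p1, p2] ++ [q2, q1]) := by
    refine valid_of (fun g hg => c.unif g (hall g hg)) ?_ hch ?_
    · rw [List.nodup_append]
      refine ⟨oplc_nodup (Or.inl hP), oplc_nodup (Or.inl (op_symm hO)), ?_⟩
      intro a ha b hb hab
      subst hab
      have hs := subset_vset ha
      rw [vset_pair] at hs
      simp at hb
      rcases hb with rfl | rfl
      · exact n1 hs
      · exact n1' hs
    · refine fresh_append (oplc_fresh0 c.hk (fun g hg => c.unif g (hPE g hg)) (Or.inl hP)) ?_
      rw [Finset.empty_union, vset_pair]
      intro i hi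
      simp at hi
      have : i = 0 ∨ i = 1 := by omega
      rcases this with rfl | rfl
      · simpa [vset_nil'] using n1
      · simpa [vset_cons', vset_nil'] using n2
  refine c.nob ⟨[p1, p2] ++ [q2, q1], fun g hg => hall g (List.mem_toFinset.1 hg),
    Or.inr (Or.inl ⟨hval, hch, p1, p2, q2, q1, rfl, hP, op_symm hO, ?_, x, y, hxy, ?_, ?_, ?_⟩)⟩
  · rw [Finset.inter_comm]; exact h2
  · rw [vset_pair, vset_pair, Finset.inter_comm, Finset.union_inter_distrib_right, hx, hy]
    ext v; simp [or_comm]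
  · ext v
    simp only [Finset.mem_inter, Finset.mem_sdiff, Finset.mem_singleton]
    constructor
    · rintro ⟨h1, h2⟩
      exact hx' v h2.1 (Finset.mem_union_left _ h1.1)
    · rintro rfl
      exact ⟨⟨hx1, hx2⟩, hxq, hxq2⟩
  · ext v
    simp only [Finset.mem_inter, Finset.mem_sdiff, Finset.mem_singleton]
    constructor
    · rintro ⟨h1, h2⟩
      exact hy' v h2.1 (Finset.mem_union_right _ h1.1)
    · rintro rfl
      exact ⟨⟨hy2, hy1⟩, hyq, hyq1⟩

theorem base_same {k : ℕ} {E : Finset (Finset V)} (c : Ctx k E) {p1 p2 q1 q2 p : Finset V}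
    (hO : OverlapPair k [q1, q2]) (hOE : ∀ g ∈ [q1, q2], g ∈ E) (hp : p ∈ E)
    (hps : p ⊆ p1 ∪ p2)
    {x y : V} (hxy : x ≠ y) (hx : q1 ∩ (p1 ∪ p2) = {x}) (hy : q2 ∩ (p1 ∪ p2) = {y})
    (hx1 : x ∈ p) (hy1 : y ∈ p) : False := by
  have hk := c.hk
  have h1 : (p ∩ vset [q1, q2]) = {x, y} := by
    rw [vset_pair]
    ext v
    simp only [Finset.ext_iff, Finset.mem_inter, Finset.mem_union, Finset.mem_singleton,
      Finset.subset_iff, Finset.mem_insert] at *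
    grind
  have h2 := handle c (Or.inl hO) hOE hp (by rw [h1, Finset.card_pair hxy])
  rw [Finset.inter_eq_left.2 h2] at h1
  have := c.unif p hp
  rw [h1, Finset.card_pair hxy] at this
  omega

theorem base_op {k : ℕ} {E : Finset (Finset V)} (c : Ctx k E) {p1 p2 q1 q2 : Finset V}
    (hP : OverlapPair k [p1, p2]) (hPE : ∀ g ∈ [p1, p2], g ∈ E)
    (hO : OverlapPair k [q1, q2]) (hOE : ∀ g ∈ [q1, q2], g ∈ E)
    {x y : V} (hxy : x ≠ y) (hx : q1 ∩ (p1 ∪ p2) = {x}) (hy : q2 ∩ (p1 ∪ p2) = {y}) :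
    (p1 ∩ p2).card = k - 1 ∧ (q1 ∩ q2).card = k - 1 ∧
      ((x ∈ p1 ∧ x ∉ p2 ∧ y ∈ p2 ∧ y ∉ p1) ∨ (x ∈ p2 ∧ x ∉ p1 ∧ y ∈ p1 ∧ y ∉ p2)) := by
  have hk := c.hk
  wlog h : x ∈ p1 generalizing p1 p2 with H
  · have hxm : x ∈ q1 ∩ (p1 ∪ p2) := by rw [hx]; simp
    rw [Finset.mem_inter, Finset.mem_union] at hxm
    have hx2 : x ∈ p2 := hxm.2.resolve_left h
    have := H (p1 := p2) (p2 := p1) (op_symm hP) (fun g hg => hPE g (by simp at hg ⊢; tauto))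
      (by rwa [Finset.union_comm]) (by rwa [Finset.union_comm]) hx2
    rw [Finset.inter_comm p1]
    refine ⟨this.1, this.2.1, this.2.2.symm⟩
  have hy1 : y ∉ p1 := fun h' => base_same c (p := p1) hO hOE (hPE _ (by simp))
    Finset.subset_union_left hxy hx hy h h'
  have hym : y ∈ q2 ∩ (p1 ∪ p2) := by rw [hy]; simp
  rw [Finset.mem_inter, Finset.mem_union] at hym
  have hy2 : y ∈ p2 := hym.2.resolve_left hy1
  have hx2 : x ∉ p2 := fun h' => base_same c (p := p2) hO hOE (hPE _ (by simp))
    Finset.subset_union_right hxy hx hy h' hy2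
  have hxm : x ∈ q1 ∩ (p1 ∪ p2) := by rw [hx]; simp
  rw [Finset.mem_inter] at hxm
  have hP' := op_iff.1 hP
  have hO' := op_iff.1 hO
  have a1 : ∀ v, v ∈ q1 ∧ (v ∈ p1 ∨ v ∈ p2) ↔ v = x := by
    intro v; have := Finset.ext_iff.1 hx v; simpa using this
  have a2 : ∀ v, v ∈ q2 ∧ (v ∈ p1 ∨ v ∈ p2) ↔ v = y := by
    intro v; have := Finset.ext_iff.1 hy v; simpa using this
  refine ⟨?_, ?_, Or.inl ⟨h, hx2, hy2, hy1⟩⟩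
  · by_contra hne
    refine dop_false c hO hOE hP hPE hxy (x := x) (y := y) ?_ ?_ hxm.1 ?_ ?_ hym.1 (by omega)
    · ext v; simp only [Finset.mem_inter, Finset.mem_union, Finset.mem_singleton]; grind
    · ext v; simp only [Finset.mem_inter, Finset.mem_union, Finset.mem_singleton]; grind
    · grind
    · grind
  · by_contra hne
    exact dop_false c hP hPE hO hOE hxy hx hy h hx2 hy1 hy2 (by omega)

/-! ### Loose ears -/

/-- A loose path with at least two edges touching `A` exactly in its two ends. -/
structure LEar (A : Finset V) (q : List (Finset V)) (x y : V) : Prop where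
  lp : LoosePath q
  len : 2 ≤ q.length
  ne : x ≠ y
  first : q.getD 0 ∅ ∩ A = {x}
  last : q.getD (q.length - 1) ∅ ∩ A = {y}
  mid : ∀ i, 0 < i → i + 1 < q.length → q.getD i ∅ ∩ A = ∅

theorem LEar.inter {A : Finset V} {q : List (Finset V)} {x y : V} (h : LEar A q x y) {i : ℕ}
    (hi : i < q.length) {v : V} (hv : v ∈ q.getD i ∅) (hA : v ∈ A) :
    (i = 0 ∧ v = x) ∨ (i = q.length - 1 ∧ v = y) := by
  have hm : v ∈ q.getD i ∅ ∩ A := Finset.mem_inter.2 ⟨hv, hA⟩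
  by_cases h0 : i = 0
  · subst h0; rw [h.first] at hm; left; exact ⟨rfl, by simpa using hm⟩
  by_cases h1 : i = q.length - 1
  · subst h1; rw [h.last] at hm; right; exact ⟨rfl, by simpa using hm⟩
  rw [h.mid i (by omega) (by omega)] at hm
  simp at hm

theorem LEar.xmem {A : Finset V} {q : List (Finset V)} {x y : V} (h : LEar A q x y) :
    x ∈ q.getD 0 ∅ ∧ x ∈ A := by
  have : x ∈ q.getD 0 ∅ ∩ A := by rw [h.first]; simp
  exact Finset.mem_inter.1 this

theorem LEar.ymem {A : Finset V} {q : List (Finset V)} {x y : V} (h : LEar A q x y) :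
    y ∈ q.getD (q.length - 1) ∅ ∧ y ∈ A := by
  have : y ∈ q.getD (q.length - 1) ∅ ∩ A := by rw [h.last]; simp
  exact Finset.mem_inter.1 this

theorem LEar.vset {A : Finset V} {q : List (Finset V)} {x y : V} (h : LEar A q x y) :
    A ∩ vset q = {x, y} := by
  have hl := h.len
  ext v
  simp only [Finset.mem_inter, Finset.mem_insert, Finset.mem_singleton]
  constructor
  · rintro ⟨h1, h2⟩
    obtain ⟨i, hi, hv⟩ := mem_vset_getD.1 h2
    rcases h.inter hi hv h1 with h | h
    · exact Or.inl h.2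
    · exact Or.inr h.2
  · rintro (rfl | rfl)
    · exact ⟨h.xmem.2, subset_vset (getD_mem' (by omega)) h.xmem.1⟩
    · exact ⟨h.ymem.2, subset_vset (getD_mem' (by omega)) h.ymem.1⟩

theorem LEar.card_le {A : Finset V} {q : List (Finset V)} {x y : V} (h : LEar A q x y) :
    ∀ e ∈ q, (e ∩ A).card ≤ 1 := by
  intro e he
  obtain ⟨i, hi, rfl⟩ := mem_getD he
  by_cases h0 : i = 0
  · subst h0; rw [h.first]; simp
  by_cases h1 : i = q.length - 1
  · subst h1; rw [h.last]; simp
  rw [h.mid i (by omega) (by omega)]; simp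

theorem LEar.xnot {A : Finset V} {q : List (Finset V)} {x y : V} (h : LEar A q x y) {i : ℕ}
    (hi : i < q.length) (h0 : i ≠ 0) : x ∉ q.getD i ∅ := by
  intro hx
  rcases h.inter hi hx h.xmem.2 with h' | h'
  · exact h0 h'.1
  · exact h.ne h'.2

theorem LEar.ynot {A : Finset V} {q : List (Finset V)} {x y : V} (h : LEar A q x y) {i : ℕ}
    (hi : i < q.length) (h0 : i ≠ q.length - 1) : y ∉ q.getD i ∅ := by
  intro hx
  rcases h.inter hi hx h.ymem.2 with h' | h'
  · exact h.ne h'.2.symm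
  · exact h0 h'.1

theorem LEar.valid {k : ℕ} {E : Finset (Finset V)} (c : Ctx k E) {P q : List (Finset V)}
    (hP : OPorLC k P) (hPE : ∀ g ∈ P, g ∈ E) (hqE : ∀ g ∈ q, g ∈ E)
    {x y : V} (h : LEar (_root_.vset P) q x y) (hl : x ∈ P.getD (P.length - 1) ∅) :
    Valid k (P ++ q) ∧ Chain (P ++ q) := by
  have hk := c.hk
  have hall := mem_E_of_append hPE hqE
  have hch : Chain (P ++ q) := by
    refine chain_append (oplc_chain hP) (lp_chain h.lp) fun _ _ => ?_
    exact ⟨x, Finset.mem_inter.2 ⟨hl, h.xmem.1⟩⟩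
  refine ⟨valid_of (fun g hg => c.unif g (hall g hg)) ?_ hch ?_, hch⟩
  · rw [List.nodup_append]
    refine ⟨oplc_nodup hP, h.lp.2.1, ?_⟩
    intro a ha b hb hab
    subst hab
    have h1 := h.card_le a hb
    rw [Finset.inter_eq_left.2 (subset_vset ha), c.unif a (hPE a ha)] at h1
    omega
  · refine fresh_append (oplc_fresh0 c.hk (fun g hg => c.unif g (hPE g hg)) hP) ?_
    rw [Finset.empty_union]
    exact lp_fresh hk (fun g hg => c.unif g (hqE g hg)) h.lp h.card_le

theorem ear_lc {k : ℕ} {E : Finset (Finset V)} (c : Ctx k E) {P q : List (Finset V)}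
    (hP : LooseCycle P) (hPE : ∀ g ∈ P, g ∈ E) (hqE : ∀ g ∈ q, g ∈ E)
    {x y : V} (h : LEar (vset P) q x y) : False := by
  have hlen := h.len
  obtain ⟨e, he, hxe⟩ := mem_vset.1 h.xmem.2
  obtain ⟨P', hP', hmem, -, hlast⟩ := lc_last hP he
  have hvs : vset P' = vset P := vset_congr hmem
  rw [← hvs] at h
  have hPE' : ∀ g ∈ P', g ∈ E := fun g hg => hPE g ((hmem g).1 hg)
  rw [← hlast] at hxe
  obtain ⟨hval, hch⟩ := h.valid c (Or.inr hP') hPE' hqE hxe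
  have hpos : 0 < P'.length := by have := hP'.1; omega
  refine c.nob ⟨P' ++ q, fun g hg => mem_E_of_append hPE' hqE g (List.mem_toFinset.1 hg),
    Or.inr (Or.inr (Or.inl ⟨hval, hch, P', q, rfl, hP', h.lp, h.len, x, y, h.ne, h.vset, ?_, ?_⟩))⟩
  · ext v
    simp only [Finset.mem_inter, Finset.mem_sdiff, Finset.mem_singleton]
    constructor
    · rintro ⟨⟨h1, h2⟩, h3⟩
      rcases h.inter (by omega) h1 (subset_vset (getD_mem' (by omega)) h3) with h' | h'
      · exact h'.2
      · omega
    · rintro rfl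
      exact ⟨⟨h.xmem.1, h.xnot (by omega) (by omega)⟩, hxe⟩
  · obtain ⟨a, ha, hya⟩ := mem_vset_getD.1 h.ymem.2
    refine ⟨a, ha, ?_⟩
    ext v
    simp only [Finset.mem_inter, Finset.mem_sdiff, Finset.mem_singleton]
    constructor
    · rintro ⟨⟨h1, h2⟩, h3⟩
      rcases h.inter (by omega) h1 (subset_vset (getD_mem' (by omega)) h3) with h' | h'
      · omega
      · exact h'.2
    · rintro rfl
      exact ⟨⟨h.ymem.1, h.ynot (by omega) (by omega)⟩, hya⟩

theorem ear_spoil {k : ℕ} {E : Finset (Finset V)} (c : Ctx k E) {p1 p2 : Finset V}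
    {q : List (Finset V)}
    (hP : OverlapPair k [p1, p2]) (hPE : ∀ g ∈ [p1, p2], g ∈ E) (hqE : ∀ g ∈ q, g ∈ E)
    {x y : V} (h : LEar (vset [p1, p2]) q x y) (hx : x ∈ p2) (hx' : x ∉ p1) (hy : y ∈ p1)
    (hy' : y ∉ p2) : False := by
  have hlen := h.len
  obtain ⟨hval, hch⟩ := h.valid c (Or.inl hP) hPE hqE (by simpa using hx)
  have s1 : p1 ⊆ vset [p1, p2] := subset_vset (by simp)
  have s2 : p2 ⊆ vset [p1, p2] := subset_vset (by simp)
  refine c.nob ⟨[p1, p2] ++ q, fun g hg => mem_E_of_append hPE hqE g (List.mem_toFinset.1 hg),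
    Or.inl ⟨hval, hch, p1, p2, q, rfl, hP, h.lp, x, y, h.ne, h.vset, ?_, ?_⟩⟩
  · rw [if_pos hlen]
    ext v
    simp only [Finset.mem_inter, Finset.mem_sdiff, Finset.mem_singleton]
    constructor
    · rintro ⟨⟨h3, h4⟩, h1, h2⟩
      rcases h.inter (by omega) h1 (s2 h3) with h' | h'
      · exact h'.2
      · omega
    · rintro rfl
      exact ⟨⟨hx, hx'⟩, h.xmem.1, h.xnot (by omega) (by omega)⟩
  · rw [if_pos hlen]
    ext v
    simp only [Finset.mem_inter, Finset.mem_sdiff, Finset.mem_singleton]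
    constructor
    · rintro ⟨⟨h3, h4⟩, h1, h2⟩
      rcases h.inter (by omega) h1 (s1 h3) with h' | h'
      · omega
      · exact h'.2
    · rintro rfl
      exact ⟨⟨hy, hy'⟩, h.ymem.1, h.ynot (by omega) (by omega)⟩

theorem ear_same {k : ℕ} {E : Finset (Finset V)} (c : Ctx k E) {p1 p2 : Finset V}
    {q : List (Finset V)}
    (hP : OverlapPair k [p1, p2]) (hPE : ∀ g ∈ [p1, p2], g ∈ E) (hqE : ∀ g ∈ q, g ∈ E)
    {x y : V} (h : LEar (p1 ∪ p2) q x y) (hx : x ∈ p1) (hy : y ∈ p1) : False := by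
  have hlen := h.len
  have hk := c.hk
  have hP' := op_iff.1 hP
  have c1 := c.unif p1 (hPE _ (by simp))
  have c2 := c.unif p2 (hPE _ (by simp))
  have hq : p1 ∉ q := by
    intro hq
    have h1 := h.card_le p1 hq
    rw [Finset.inter_eq_left.2 (Finset.subset_union_left (s₁ := p1) (s₂ := p2))] at h1
    omega
  have hC : LooseCycle (p1 :: q) := by
    refine lc_cons h.lp h.len hq ?_ ?_ ?_
    · rw [Finset.card_eq_one]
      refine ⟨x, ?_⟩
      ext v
      simp only [Finset.mem_inter, Finset.mem_singleton]
      constructor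
      · rintro ⟨h1, h2⟩
        rcases h.inter (by omega) h2 (Finset.mem_union_left _ h1) with h' | h'
        · exact h'.2
        · omega
      · rintro rfl
        exact ⟨hx, h.xmem.1⟩
    · rw [Finset.card_eq_one]
      refine ⟨y, ?_⟩
      ext v
      simp only [Finset.mem_inter, Finset.mem_singleton]
      constructor
      · rintro ⟨h1, h2⟩
        rcases h.inter (by omega) h2 (Finset.mem_union_left _ h1) with h' | h'
        · omega
        · exact h'.2
      · rintro rfl
        exact ⟨hy, h.ymem.1⟩
    · intro i h0 hi
      have hm := h.mid i h0 hi
      rw [Finset.eq_empty_iff_forall_notMem] at hm ⊢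
      intro v hv
      rw [Finset.mem_inter] at hv
      exact hm v (Finset.mem_inter.2 ⟨hv.2, Finset.mem_union_left _ hv.1⟩)
  have he : p2 ∩ vset (p1 :: q) = p1 ∩ p2 := by
    ext v
    have h1 := Finset.ext_iff.1 h.vset v
    rw [vset_cons']
    simp only [Finset.mem_inter, Finset.mem_union, Finset.mem_insert,
      Finset.mem_singleton] at h1 ⊢
    grind
  have hs := handle c (Or.inr hC) (by
    intro g hg
    rcases List.mem_cons.1 hg with rfl | hg
    · exact hPE _ (by simp)
    · exact hqE g hg) (hPE p2 (by simp)) (by rw [he]; exact hP'.2.1)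
  rw [Finset.inter_eq_left.2 hs] at he
  have := hP'.2.2
  rw [← he, c2] at this
  omega

theorem ear_op {k : ℕ} {E : Finset (Finset V)} (c : Ctx k E) {p1 p2 : Finset V}
    {q : List (Finset V)}
    (hP : OverlapPair k [p1, p2]) (hPE : ∀ g ∈ [p1, p2], g ∈ E) (hqE : ∀ g ∈ q, g ∈ E)
    {x y : V} (h : LEar (p1 ∪ p2) q x y) : False := by
  have hx := Finset.mem_union.1 h.xmem.2
  have hy := Finset.mem_union.1 h.ymem.2
  have hPE' : ∀ g ∈ [p2, p1], g ∈ E := fun g hg => hPE g (by simp at hg ⊢; tauto)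
  have h' := h
  rw [Finset.union_comm] at h'
  by_cases hx1 : x ∈ p1
  · have hy1 : y ∉ p1 := fun hy => ear_same c hP hPE hqE h hx1 hy
    have hy2 := hy.resolve_left hy1
    have hx2 : x ∉ p2 := fun hx => ear_same c (op_symm hP) hPE' hqE h' hx hy2
    exact ear_spoil c (op_symm hP) hPE' hqE (by rwa [vset_pair]) hx1 hx2 hy2 hy1
  · have hx2 := hx.resolve_left hx1
    have hy2 : y ∉ p2 := fun hy => ear_same c (op_symm hP) hPE' hqE h' hx2 hy
    exact ear_spoil c hP hPE hqE (by rwa [vset_pair]) hx2 hx1 (hy.resolve_right hy2) hy2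

/-! ### The ear lemma -/

theorem min_ear {X : Set (Finset V)} {A : Finset V} (hX : ∀ g ∈ X, (g ∩ A).card ≤ 1)
    {x y : V} (hxy : x ≠ y) (hx : x ∈ A) (hy : y ∈ A)
    (h : Relation.ReflTransGen (AdjX X) x y) :
    ∃ q x y, x ≠ y ∧ (∀ g ∈ q, g ∈ X) ∧ 2 ≤ q.length ∧ q.getD 0 ∅ ∩ A = {x} ∧
      q.getD (q.length - 1) ∅ ∩ A = {y} ∧
      (∀ i, 0 < i → i + 1 < q.length → q.getD i ∅ ∩ A = ∅) ∧ q.Nodup ∧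
      ((∀ i, i + 1 < q.length → (q.getD i ∅ ∩ q.getD (i + 1) ∅).card ≤ 1) → LoosePath q) := by
  obtain ⟨q, ⟨x, y, hxy, hx, hy, hq⟩, hmin⟩ :=
    exists_min_len (Q := fun q => ∃ x y, x ≠ y ∧ x ∈ A ∧ y ∈ A ∧ Wk X {x} {y} q)
      (by obtain ⟨q, hq⟩ := wk_of_rtg h hxy
          exact ⟨q, x, y, hxy, hx, hy, hq⟩)
  have hmin' : ∀ q', Wk X {x} {y} q' → q.length ≤ q'.length :=
    fun q' h => hmin q' ⟨x, y, hxy, hx, hy, h⟩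
  obtain ⟨m1, m2, m3, m4⟩ := wk_min hq hmin'
  have hpos := wk_pos hq
  have hx0 : x ∈ q.getD 0 ∅ := by
    obtain ⟨v, hv⟩ := hq.2.2.2.1
    simp only [Finset.mem_inter, Finset.mem_singleton] at hv
    exact hv.2 ▸ hv.1
  have hy0 : y ∈ q.getD (q.length - 1) ∅ := by
    obtain ⟨v, hv⟩ := hq.2.2.2.2
    simp only [Finset.mem_inter, Finset.mem_singleton] at hv
    exact hv.2 ▸ hv.1
  have hl : 2 ≤ q.length := by
    by_contra hl
    have e1 : q.length - 1 = 0 := by omega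
    rw [e1] at hy0
    have h1 := hX _ (hq.2.1 _ (getD_mem' hpos))
    rw [Finset.card_le_one] at h1
    exact hxy (h1 x (Finset.mem_inter.2 ⟨hx0, hx⟩) y (Finset.mem_inter.2 ⟨hy0, hy⟩))
  have r1 : ∀ i, 0 < i → i < q.length → ∀ v ∈ q.getD i ∅, v ∈ A → v = y := by
    intro i h0 hi v hv hvA
    by_contra hne
    have := hmin _ ⟨v, y, hne, hvA, hy, wk_drop hq hi (A' := {v}) ⟨v, Finset.mem_inter.2 ⟨hv, Finset.mem_singleton_self v⟩⟩⟩
    rw [List.length_drop] at this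
    omega
  have r2 : ∀ i, i + 1 < q.length → ∀ v ∈ q.getD i ∅, v ∈ A → v = x := by
    intro i hi v hv hvA
    by_contra hne
    have := hmin _ ⟨x, v, Ne.symm hne, hx, hvA, wk_take hq (i := i) (by omega) (B' := {v})
      ⟨v, Finset.mem_inter.2 ⟨hv, Finset.mem_singleton_self v⟩⟩⟩
    rw [List.length_take] at this
    omega
  refine ⟨q, x, y, hxy, hq.2.1, hl, ?_, ?_, ?_, nodup_of_getD m4, wk_lp hq hmin'⟩
  · ext v
    simp only [Finset.mem_inter, Finset.mem_singleton]
    constructor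
    · rintro ⟨h1, h2⟩
      exact r2 0 (by omega) v h1 h2
    · rintro rfl; exact ⟨hx0, hx⟩
  · ext v
    simp only [Finset.mem_inter, Finset.mem_singleton]
    constructor
    · rintro ⟨h1, h2⟩
      exact r1 _ (by omega) (by omega) v h1 h2
    · rintro rfl; exact ⟨hy0, hy⟩
  · intro i h0 hi
    rw [Finset.eq_empty_iff_forall_notMem]
    intro v hv
    rw [Finset.mem_inter] at hv
    exact hxy ((r2 i hi v hv.1 hv.2).symm.trans (r1 i h0 (by omega) v hv.1 hv.2))

theorem ear_pre {k : ℕ} {E : Finset (Finset V)} (c : Ctx k E) {P : List (Finset V)}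
    (hP : OPorLC k P) (hPE : ∀ g ∈ P, g ∈ E) {X : Set (Finset V)} (hXE : ∀ g ∈ X, g ∈ E)
    (hX : ∀ g ∈ X, ¬ g ⊆ vset P) {x y : V} (hxy : x ≠ y) (hx : x ∈ vset P) (hy : y ∈ vset P)
    (h : Relation.ReflTransGen (AdjX X) x y) :
    (∃ q x y, (∀ g ∈ q, g ∈ E) ∧ LEar (vset P) q x y) ∨
    ∃ q1 ∈ X, ∃ q2 ∈ X, ∃ x y, x ≠ y ∧ q1 ∩ vset P = {x} ∧ q2 ∩ vset P = {y} ∧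
      OverlapPair k [q1, q2] := by
  have hX' : ∀ g ∈ X, (g ∩ vset P).card ≤ 1 := by
    intro g hg
    by_contra h2
    exact hX g hg (handle c hP hPE (hXE g hg) (by omega))
  obtain ⟨q, x, y, hxy, hqX, hl, h0, h1, hm, hnd, hlp⟩ := min_ear hX' hxy hx hy h
  by_cases hle : ∀ i, i + 1 < q.length → (q.getD i ∅ ∩ q.getD (i + 1) ∅).card ≤ 1
  · exact Or.inl ⟨q, x, y, fun g hg => hXE g (hqX g hg), hlp hle, hl, hxy, h0, h1, hm⟩
  right
  push Not at hle
  obtain ⟨i, hi, hle⟩ := hle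
  have hqi := hqX _ (getD_mem' (i := i) (l := q) (by omega))
  have hqi' := hqX _ (getD_mem' (i := i + 1) (l := q) (by omega))
  have hne : q.getD i ∅ ≠ q.getD (i + 1) ∅ := by
    intro he
    have := nodup_getD hnd (by omega) (by omega) he
    omega
  have hO : OverlapPair k [q.getD i ∅, q.getD (i + 1) ∅] :=
    op_of (c.unif _ (hXE _ hqi)) (c.unif _ (hXE _ hqi')) hne (by omega)
  have h2 := two_common c hP hPE (Or.inl hO) (by
    intro g hg
    simp only [List.mem_cons, List.not_mem_nil, or_false] at hg
    rcases hg with rfl | rfl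
    · exact hXE _ hqi
    · exact hXE _ hqi')
  rw [vset_pair, Finset.inter_comm, Finset.union_inter_distrib_right] at h2
  have h3 := Finset.card_union_le (q.getD i ∅ ∩ vset P) (q.getD (i + 1) ∅ ∩ vset P)
  have hi0 : i = 0 := by
    by_contra hne0
    rw [hm i (by omega) (by omega)] at h2 h3
    have := hX' _ hqi'
    rw [Finset.empty_union] at h2
    omega
  subst hi0
  have hl2 : 0 + 1 = q.length - 1 := by
    by_contra hne0
    rw [hm (0 + 1) (by omega) (by omega)] at h2 h3
    have := hX' _ hqi
    rw [Finset.union_empty] at h2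
    omega
  rw [← hl2] at h1
  exact ⟨_, hqi, _, hqi', x, y, hxy, h0, h1, hO⟩

theorem ear_main_op {k : ℕ} {E : Finset (Finset V)} (c : Ctx k E) {p1 p2 : Finset V}
    (hP : OverlapPair k [p1, p2]) (hPE : ∀ g ∈ [p1, p2], g ∈ E)
    {X : Set (Finset V)} (hXE : ∀ g ∈ X, g ∈ E)
    (hX : ∀ g ∈ X, ¬ g ⊆ p1 ∪ p2) {x y : V} (hxy : x ≠ y) (hx : x ∈ p1 ∪ p2)
    (hy : y ∈ p1 ∪ p2) (h : Relation.ReflTransGen (AdjX X) x y) :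
    (p1 ∩ p2).card = k - 1 ∧ ∃ q1 ∈ X, ∃ q2 ∈ X, q1 ≠ q2 ∧ (q1 ∩ q2).card = k - 1 := by
  rw [← vset_pair] at hX hx hy
  rcases ear_pre c (Or.inl hP) hPE hXE hX hxy hx hy h with
    ⟨q, x, y, hq, he⟩ | ⟨q1, hq1, q2, hq2, x, y, hxy, h1, h2, hO⟩
  · rw [vset_pair] at he
    exact (ear_op c hP hPE hq he).elim
  · rw [vset_pair] at h1 h2
    have := base_op c hP hPE hO (by
      intro g hg
      simp only [List.mem_cons, List.not_mem_nil, or_false] at hg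
      rcases hg with rfl | rfl
      · exact hXE _ hq1
      · exact hXE _ hq2) hxy h1 h2
    exact ⟨this.1, q1, hq1, q2, hq2, (op_iff.1 hO).1, this.2.1⟩

theorem lc_inter_le {P : List (Finset V)} (hP : LooseCycle P) {e f : Finset V} (he : e ∈ P)
    (hf : f ∈ P) (hne : e ≠ f) : (e ∩ f).card ≤ 1 := by
  obtain ⟨i, hi, rfl⟩ := mem_getD he
  obtain ⟨j, hj, rfl⟩ := mem_getD hf
  rcases lt_trichotomy i j with h | h | h
  · rw [hP.2.2 i j h hj]; split_ifs <;> simp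
  · subst h; exact absurd rfl hne
  · rw [Finset.inter_comm, hP.2.2 j i h hi]; split_ifs <;> simp

theorem base_lc {k : ℕ} {E : Finset (Finset V)} (c : Ctx k E) {P : List (Finset V)}
    (hP : LooseCycle P) (hPE : ∀ g ∈ P, g ∈ E) {q1 q2 : Finset V} (hO : OverlapPair k [q1, q2])
    (hOE : ∀ g ∈ [q1, q2], g ∈ E) {x y : V} (hxy : x ≠ y) (h1 : q1 ∩ vset P = {x})
    (h2 : q2 ∩ vset P = {y}) : False := by
  have hk := c.hk
  have hx : x ∈ q1 ∩ vset P := by rw [h1]; simp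
  have hy : y ∈ q2 ∩ vset P := by rw [h2]; simp
  rw [Finset.mem_inter] at hx hy
  obtain ⟨-, g1, hg1, g2, hg2, hne, hcard⟩ := ear_main_op c hO hOE (X := {g | g ∈ P}) hPE (by
    intro g hg hsub
    have := inter_union_split hsub
    have a1 := Finset.card_le_card (s := g ∩ q1) (t := q1 ∩ vset P) (by
      rw [Finset.inter_comm]; exact Finset.inter_subset_inter_left (subset_vset hg))
    have a2 := Finset.card_le_card (s := g ∩ q2) (t := q2 ∩ vset P) (by
      rw [Finset.inter_comm]; exact Finset.inter_subset_inter_left (subset_vset hg))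
    rw [h1, Finset.card_singleton] at a1
    rw [h2, Finset.card_singleton] at a2
    rw [c.unif g (hPE g hg)] at this
    omega) hxy (Finset.mem_union_left _ hx.1) (Finset.mem_union_right _ hy.1)
    (rtg_of_chain (lc_chain hP) hx.2 hy.2)
  have := lc_inter_le hP hg1 hg2 hne
  omega

theorem ear_main_lc {k : ℕ} {E : Finset (Finset V)} (c : Ctx k E) {P : List (Finset V)}
    (hP : LooseCycle P) (hPE : ∀ g ∈ P, g ∈ E)
    {X : Set (Finset V)} (hXE : ∀ g ∈ X, g ∈ E)
    (hX : ∀ g ∈ X, ¬ g ⊆ vset P) {x y : V} (hxy : x ≠ y) (hx : x ∈ vset P)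
    (hy : y ∈ vset P) (h : Relation.ReflTransGen (AdjX X) x y) : False := by
  rcases ear_pre c (Or.inr hP) hPE hXE hX hxy hx hy h with
    ⟨q, x, y, hq, he⟩ | ⟨q1, hq1, q2, hq2, x, y, hxy, h1, h2, hO⟩
  · exact ear_lc c hP hPE hq he
  · refine base_lc c hP hPE hO (by
      intro g hg
      simp only [List.mem_cons, List.not_mem_nil, or_false] at hg
      rcases hg with rfl | rfl
      · exact hXE _ hq1
      · exact hXE _ hq2) hxy h1 h2

/-- Combined ear lemma. -/
theorem ear_main {k : ℕ} {E : Finset (Finset V)} (c : Ctx k E) {P : List (Finset V)}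
    (hP : OPorLC k P) (hPE : ∀ g ∈ P, g ∈ E)
    {X : Set (Finset V)} (hXE : ∀ g ∈ X, g ∈ E)
    (hX : ∀ g ∈ X, ¬ g ⊆ vset P) {x y : V} (hxy : x ≠ y) (hx : x ∈ vset P)
    (hy : y ∈ vset P) (h : Relation.ReflTransGen (AdjX X) x y) :
    ∃ q1 ∈ X, ∃ q2 ∈ X, q1 ≠ q2 ∧ (q1 ∩ q2).card = k - 1 ∧
      ∃ x y, x ≠ y ∧ q1 ∩ vset P = {x} ∧ q2 ∩ vset P = {y} := by
  rcases hP with hP | hP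
  · obtain ⟨p1, p2, rfl, -⟩ := id hP
    rcases ear_pre c (Or.inl hP) hPE hXE hX hxy hx hy h with
      ⟨q, x, y, hq, he⟩ | ⟨q1, hq1, q2, hq2, x, y, hxy, h1, h2, hO⟩
    · rw [vset_pair] at he
      exact (ear_op c hP hPE hq he).elim
    · rw [vset_pair] at h1 h2
      have := base_op c hP hPE hO (by
        intro g hg
        simp only [List.mem_cons, List.not_mem_nil, or_false] at hg
        rcases hg with rfl | rfl
        · exact hXE _ hq1
        · exact hXE _ hq2) hxy h1 h2
      rw [vset_pair]
      exact ⟨q1, hq1, q2, hq2, (op_iff.1 hO).1, this.2.1, x, y, hxy, h1, h2⟩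
  · exact (ear_main_lc c hP hPE hXE hX hxy hx hy h).elim

theorem base_main {k : ℕ} {E : Finset (Finset V)} (c : Ctx k E) {P : List (Finset V)}
    (hP : OPorLC k P) (hPE : ∀ g ∈ P, g ∈ E) {q1 q2 : Finset V} (hO : OverlapPair k [q1, q2])
    (hOE : ∀ g ∈ [q1, q2], g ∈ E) {x y : V} (hxy : x ≠ y) (h1 : q1 ∩ vset P = {x})
    (h2 : q2 ∩ vset P = {y}) : ∃ p1 p2, P = [p1, p2] ∧ OverlapPair k [p1, p2] ∧
      (p1 ∩ p2).card = k - 1 ∧ (q1 ∩ q2).card = k - 1 ∧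
      ((x ∈ p1 ∧ x ∉ p2 ∧ y ∈ p2 ∧ y ∉ p1) ∨ (x ∈ p2 ∧ x ∉ p1 ∧ y ∈ p1 ∧ y ∉ p2)) := by
  rcases hP with hP | hP
  · obtain ⟨e, f, rfl, -⟩ := id hP
    rw [vset_pair] at h1 h2
    exact ⟨e, f, rfl, hP, base_op c hP hPE hO hOE hxy h1 h2⟩
  · exact (base_lc c hP hPE hO hOE hxy h1 h2).elim

/-! ### Growing a core -/

theorem mem_pair_E {E : Finset (Finset V)} {a b : Finset V} (ha : a ∈ E) (hb : b ∈ E) :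
    ∀ g ∈ [a, b], g ∈ E := by
  intro g hg
  simp only [List.mem_cons, List.not_mem_nil, or_false] at hg
  rcases hg with rfl | rfl
  · exact ha
  · exact hb

theorem exists_cycle {k : ℕ} {E : Finset (Finset V)} (c : Ctx k E) {e : Finset V} (he : e ∈ E)
    {X : Set (Finset V)} (hXE : ∀ g ∈ X, g ∈ E) (heX : e ∉ X) {p q : V} (hpq : p ≠ q)
    (hp : p ∈ e) (hq : q ∈ e) (h : Relation.ReflTransGen (AdjX X) p q) :
    ∃ C, OPorLC k C ∧ ∀ g ∈ C, g = e ∨ g ∈ X := by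
  by_cases hX : ∀ g ∈ X, (g ∩ e).card ≤ 1
  · obtain ⟨l, x, y, hxy, hlX, hlen, h0, h1, hm, hnd, hlp⟩ := min_ear hX hpq hp hq h
    by_cases hle : ∀ i, i + 1 < l.length → (l.getD i ∅ ∩ l.getD (i + 1) ∅).card ≤ 1
    · refine ⟨e :: l, Or.inr (lc_cons (hlp hle) hlen (fun h => heX (hlX e h)) ?_ ?_ ?_), ?_⟩
      · rw [Finset.inter_comm, h0]; simp
      · rw [Finset.inter_comm, h1]; simp
      · intro i h0 hi; rw [Finset.inter_comm]; exact hm i h0 hi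
      · intro g hg
        rcases List.mem_cons.1 hg with rfl | hg
        · exact Or.inl rfl
        · exact Or.inr (hlX g hg)
    · push Not at hle
      obtain ⟨i, hi, hle⟩ := hle
      have hqi := hlX _ (getD_mem' (i := i) (l := l) (by omega))
      have hqi' := hlX _ (getD_mem' (i := i + 1) (l := l) (by omega))
      have hne : l.getD i ∅ ≠ l.getD (i + 1) ∅ := by
        intro he
        have := nodup_getD hnd (by omega) (by omega) he
        omega
      refine ⟨_, Or.inl (op_of (c.unif _ (hXE _ hqi)) (c.unif _ (hXE _ hqi')) hne
        (by omega)), ?_⟩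
      intro g hg
      simp only [List.mem_cons, List.not_mem_nil, or_false] at hg
      rcases hg with rfl | rfl
      · exact Or.inr hqi
      · exact Or.inr hqi'
  · push Not at hX
    obtain ⟨g, hg, h2⟩ := hX
    refine ⟨[g, e], Or.inl (op_of (c.unif g (hXE g hg)) (c.unif e he) ?_ (by omega)), ?_⟩
    · rintro rfl; exact heX hg
    · intro f hf
      simp only [List.mem_cons, List.not_mem_nil, or_false] at hf
      rcases hf with rfl | rfl
      · exact Or.inr hg
      · exact Or.inl rfl

theorem exists_star_pair {k : ℕ} {E : Finset (Finset V)} (c : Ctx k E) {P : List (Finset V)}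
    (hP : OPorLC k P) (hPE : ∀ g ∈ P, g ∈ E) {F : Set (Finset V)} (hFE : ∀ g ∈ F, g ∈ E)
    (hF : ∀ g ∈ F, ¬ g ⊆ vset P) {e : Finset V} (he : e ∈ E) (heF : e ∉ F)
    (heP : ¬ e ⊆ vset P) {p q x y : V} (hpq : p ≠ q) (hp : p ∈ e) (hq : q ∈ e)
    (hx : x ∈ vset P) (hy : y ∈ vset P)
    (hpx : Relation.ReflTransGen (AdjX F) p x) (hqy : Relation.ReflTransGen (AdjX F) q y) :
    ∃ q1 q2, (q1 = e ∨ q1 ∈ F) ∧ (q2 = e ∨ q2 ∈ F) ∧ q1 ≠ q2 ∧ (q1 ∩ q2).card = k - 1 ∧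
      ∃ x y, x ≠ y ∧ q1 ∩ vset P = {x} ∧ q2 ∩ vset P = {y} := by
  have hXE : ∀ g ∈ ({g | g = e ∨ g ∈ F} : Set (Finset V)), g ∈ E := by
    rintro g (rfl | hg)
    · exact he
    · exact hFE g hg
  have hX : ∀ g ∈ ({g | g = e ∨ g ∈ F} : Set (Finset V)), ¬ g ⊆ vset P := by
    rintro g (rfl | hg)
    · exact heP
    · exact hF g hg
  have hsub : F ⊆ {g | g = e ∨ g ∈ F} := fun g hg => Or.inr hg
  suffices hs : ∃ u ∈ vset P, ∃ v ∈ vset P, u ≠ v ∧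
      Relation.ReflTransGen (AdjX {g | g = e ∨ g ∈ F}) u v by
    obtain ⟨u, hu, v, hv, huv, hr⟩ := hs
    obtain ⟨q1, h1, q2, h2, h3⟩ := ear_main c hP hPE hXE hX huv hu hv hr
    exact ⟨q1, q2, h1, h2, h3⟩
  by_cases hxy : x = y
  · subst hxy
    obtain ⟨C, hC, hCX⟩ := exists_cycle c he hFE heF hpq hp hq (hpx.trans (rtg_symm hqy))
    have h2 := two_common c hP hPE hC (fun g hg => hXE g (hCX g hg))
    obtain ⟨u, hu, v, hv, huv⟩ := Finset.one_lt_card.1 h2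
    rw [Finset.mem_inter] at hu hv
    exact ⟨u, hu.1, v, hv.1, huv, rtg_mono (fun g hg => hCX g hg)
      (rtg_of_chain (oplc_chain hC) hu.2 hv.2)⟩
  · exact ⟨x, hx, y, hy, hxy, ((rtg_symm (rtg_mono hsub hpx)).trans
      (rtg_edge (Or.inl rfl) hp hq)).trans (rtg_mono hsub hqy)⟩

/-- Each edge of the list meets what came before in exactly one vertex. -/
def Grow : Finset V → List (Finset V) → Prop
  | _, [] => True
  | A, g :: G => (g ∩ A).card = 1 ∧ Grow (A ∪ g) G

theorem grow_inter {G : List (Finset V)} : ∀ {A B : Finset V}, B ⊆ A → Grow A G →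
    ∀ g ∈ G, (g ∩ B).card ≤ 1 := by
  induction G with
  | nil => intro A B _ _ g hg; simp at hg
  | cons f G ih =>
    intro A B hBA h g hg
    rcases List.mem_cons.1 hg with rfl | hg
    · rw [← h.1]; exact Finset.card_le_card (Finset.inter_subset_inter_left hBA)
    · exact ih (hBA.trans Finset.subset_union_left) h.2 g hg

theorem grow_pair {G : List (Finset V)} : ∀ {A : Finset V}, Grow A G →
    ∀ g ∈ G, ∀ g' ∈ G, g ≠ g' → (g ∩ g').card ≤ 1 := by
  induction G with
  | nil => intro A _ g hg; simp at hg
  | cons f G ih =>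
    intro A h g hg g' hg' hne
    rcases List.mem_cons.1 hg with h1 | h1
    · rcases List.mem_cons.1 hg' with h2 | h2
      · exact absurd (h1.trans h2.symm) hne
      · rw [Finset.inter_comm, h1]; exact grow_inter Finset.subset_union_right h.2 g' h2
    · rcases List.mem_cons.1 hg' with h2 | h2
      · rw [h2]; exact grow_inter Finset.subset_union_right h.2 g h1
      · exact ih h.2 g h1 g' h2 hne

theorem grow_rtg {G : List (Finset V)} : ∀ {A : Finset V}, Grow A G →
    ∀ v ∈ A ∪ vset G, ∃ x ∈ A, Relation.ReflTransGen (AdjX {g | g ∈ G}) v x := by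
  induction G with
  | nil => intro A _ v hv; exact ⟨v, by simpa [vset_nil'] using hv, Relation.ReflTransGen.refl⟩
  | cons f G ih =>
    intro A h v hv
    rw [vset_cons', ← Finset.union_assoc] at hv
    obtain ⟨x, hx, hr⟩ := ih h.2 v hv
    have hr' : Relation.ReflTransGen (AdjX {g | g ∈ f :: G}) v x :=
      rtg_mono (fun g hg => List.mem_cons_of_mem _ hg) hr
    by_cases hxA : x ∈ A
    · exact ⟨x, hxA, hr'⟩
    · have hxf : x ∈ f := (Finset.mem_union.1 hx).resolve_left hxA
      obtain ⟨w, hw⟩ := Finset.card_pos.1 (by rw [h.1]; exact one_pos : 0 < (f ∩ A).card)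
      rw [Finset.mem_inter] at hw
      exact ⟨w, hw.2, hr'.trans (rtg_edge (g := f) (List.mem_cons_self) hxf hw.1)⟩

theorem core {k : ℕ} {E : Finset (Finset V)} (c : Ctx k E) {P F : List (Finset V)}
    (hP : OPorLC k P) (hPE : ∀ g ∈ P, g ∈ E) (hFE : ∀ g ∈ F, g ∈ E)
    (hG : Grow (vset P) F) {e f : Finset V} (he : e ∈ E) (hf : f ∈ E) (hef : e ≠ f) {z : V}
    (hz : f ∩ (vset P ∪ vset F) = {z}) (hsub : e ⊆ (vset P ∪ vset F) ∪ f)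
    (hnew : ∃ w ∈ e, w ∉ vset P ∪ vset F) :
    ∃ p1 p2 t, P = [p1, p2] ∧ OverlapPair k [p1, p2] ∧ (p1 ∩ p2).card = k - 1 ∧
      (f ∩ e).card = k - 1 ∧ t ∈ e ∧ z ∈ f ∧ z ∉ e ∧ t ∉ f ∧ z ≠ t ∧
      f ∩ vset P = {z} ∧ e ∩ vset P = {t} ∧
      e ∩ (vset P ∪ vset F) = {t} ∧ e.erase t = f.erase z ∧
      ((z ∈ p1 ∧ z ∉ p2 ∧ t ∈ p2 ∧ t ∉ p1) ∨ (z ∈ p2 ∧ z ∉ p1 ∧ t ∈ p1 ∧ t ∉ p2)) := by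
  have hk := c.hk
  have ce := c.unif e he
  have cf := c.unif f hf
  set W := vset P ∪ vset F with hW
  obtain ⟨w, hwe, hwW⟩ := hnew
  have hzm : z ∈ f ∩ W := by rw [hz]; simp
  rw [Finset.mem_inter] at hzm
  have hz' : ∀ v, v ∈ f → v ∈ W → v = z := fun v h h' => by
    have : v ∈ f ∩ W := Finset.mem_inter.2 ⟨h, h'⟩
    rw [hz] at this; simpa using this
  have hPW : vset P ⊆ W := Finset.subset_union_left
  have hFW : ∀ g ∈ F, g ⊆ W := fun g hg => (subset_vset hg).trans Finset.subset_union_right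
  have notsub : ¬ e ⊆ f := fun h => hef (Finset.eq_of_subset_of_card_le h (by omega))
  by_cases hT : 2 ≤ (e ∩ W).card
  · exfalso
    obtain ⟨p, hp, q, hq, hpq⟩ := Finset.one_lt_card.1 hT
    rw [Finset.mem_inter] at hp hq
    obtain ⟨x, hx, hpx⟩ := grow_rtg hG p hp.2
    obtain ⟨y, hy, hqy⟩ := grow_rtg hG q hq.2
    have heF : e ∉ {g | g ∈ F} := fun h => hwW (hFW e h hwe)
    obtain ⟨q1, q2, h1, h2, hne, hcard, x, y, hxy, hx, hy⟩ := exists_star_pair c hP hPE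
      (F := {g | g ∈ F}) hFE (by
        intro g hg hs
        have := grow_inter (Finset.Subset.refl _) hG g hg
        rw [Finset.inter_eq_left.2 hs, c.unif g (hFE g hg)] at this
        omega) he heF (fun h => hwW (hPW (h hwe))) hpq hp.1 hq.1 hx hy hpx hqy
    have key : ∀ g ∈ F, ∀ u v, u ≠ v → (e ∩ g).card = k - 1 → e ∩ vset P = {u} →
        g ∩ vset P = {v} → False := by
      intro g hg u v huv hcard hu hv
      have hum : u ∈ e ∩ vset P := by rw [hu]; simp
      rw [Finset.mem_inter] at hum
      have hug : u ∉ g := by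
        intro hug
        have : u ∈ g ∩ vset P := Finset.mem_inter.2 ⟨hug, hum.2⟩
        rw [hv] at this
        exact huv (by simpa using this)
      have hwg : w ∉ g := fun h => hwW (hFW g hg h)
      have huw : u ≠ w := by rintro rfl; exact hwW (hPW hum.2)
      have hs : insert u (insert w (e ∩ g)) ⊆ e := by
        intro v hv
        simp only [Finset.mem_insert, Finset.mem_inter] at hv
        rcases hv with rfl | rfl | hv
        · exact hum.1
        · exact hwe
        · exact hv.1
      have := Finset.card_le_card hs
      rw [Finset.card_insert_of_notMem (by simp [huw, hug]),
        Finset.card_insert_of_notMem (by simp [hwg])] at this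
      omega
    rcases h1 with rfl | h1
    · rcases h2 with rfl | h2
      · exact hne rfl
      · exact key q2 h2 x y hxy hcard hx hy
    · rcases h2 with rfl | h2
      · exact key q1 h1 y x hxy.symm (by rwa [Finset.inter_comm]) hy hx
      · have := grow_pair hG q1 h1 q2 h2 hne
        omega
  · have hT1 : (e ∩ W).card = 1 := by
      have : (e ∩ W).Nonempty := by
        by_contra h
        rw [Finset.not_nonempty_iff_eq_empty] at h
        refine notsub fun v hv => ?_
        rcases Finset.mem_union.1 (hsub hv) with h' | h'
        · exact absurd (Finset.mem_inter.2 ⟨hv, h'⟩) (by rw [h]; simp)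
        · exact h'
      have := Finset.card_pos.2 this
      omega
    obtain ⟨t, ht⟩ := Finset.card_eq_one.1 hT1
    have htm : t ∈ e ∩ W := by rw [ht]; simp
    rw [Finset.mem_inter] at htm
    have ht' : ∀ v, v ∈ e → v ∈ W → v = t := fun v h h' => by
      have : v ∈ e ∩ W := Finset.mem_inter.2 ⟨h, h'⟩
      rw [ht] at this; simpa using this
    have hes : ∀ v ∈ e, v ≠ t → v ∈ f := by
      intro v hv hvt
      rcases Finset.mem_union.1 (hsub hv) with h' | h'
      · exact absurd (ht' v hv h') hvt
      · exact h'
    have hzt : z ≠ t := by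
      rintro rfl
      refine notsub fun v hv => ?_
      by_cases hvz : v = z
      · subst hvz; exact hzm.1
      · exact hes v hv hvz
    have hze : z ∉ e := fun h => hzt (ht' z h hzm.2)
    have htf : t ∉ f := fun h => hzt (hz' t h htm.2).symm
    have her : e.erase t = f.erase z := by
      refine Finset.eq_of_subset_of_card_le ?_ ?_
      · intro v hv
        rw [Finset.mem_erase] at hv ⊢
        exact ⟨fun h => hze (h ▸ hv.2), hes v hv.2 hv.1⟩
      · rw [Finset.card_erase_of_mem hzm.1, Finset.card_erase_of_mem htm.1]; omega
    have hinter : f ∩ e = e.erase t := by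
      ext v
      rw [Finset.mem_inter, Finset.mem_erase]
      constructor
      · rintro ⟨h1, h2⟩; exact ⟨fun h => htf (h ▸ h1), h2⟩
      · rintro ⟨h1, h2⟩; exact ⟨hes v h2 h1, h2⟩
    have hc : (f ∩ e).card = k - 1 := by rw [hinter, Finset.card_erase_of_mem htm.1, ce]
    have hO : OverlapPair k [f, e] := op_of cf ce hef.symm (by omega)
    have hOE := mem_pair_E hf he
    have h2 := two_common c hP hPE (Or.inl hO) hOE
    rw [vset_pair] at h2
    have hs : vset P ∩ (f ∪ e) ⊆ {z, t} := by
      intro v hv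
      rw [Finset.mem_inter, Finset.mem_union] at hv
      simp only [Finset.mem_insert, Finset.mem_singleton]
      exact hv.2.imp (fun h => hz' v h (hPW hv.1)) (fun h => ht' v h (hPW hv.1))
    have hse := Finset.eq_of_subset_of_card_le hs (by rw [Finset.card_pair hzt]; exact h2)
    have hzP : z ∈ vset P := by
      have : z ∈ vset P ∩ (f ∪ e) := by rw [hse]; simp
      exact (Finset.mem_inter.1 this).1
    have htP : t ∈ vset P := by
      have : t ∈ vset P ∩ (f ∪ e) := by rw [hse]; simp
      exact (Finset.mem_inter.1 this).1
    have hz1 : f ∩ vset P = {z} := by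
      ext v
      rw [Finset.mem_inter, Finset.mem_singleton]
      constructor
      · rintro ⟨h1, h2⟩; exact hz' v h1 (hPW h2)
      · rintro rfl; exact ⟨hzm.1, hzP⟩
    have ht1 : e ∩ vset P = {t} := by
      ext v
      rw [Finset.mem_inter, Finset.mem_singleton]
      constructor
      · rintro ⟨h1, h2⟩; exact ht' v h1 (hPW h2)
      · rintro rfl; exact ⟨htm.1, htP⟩
    obtain ⟨p1, p2, h1, h2, h3, -, h4⟩ := base_main c hP hPE hO hOE hzt hz1 ht1
    exact ⟨p1, p2, t, h1, h2, h3, hc, htm.1, hzm.1, hze, htf, hzt, hz1, ht1, ht, her, h4⟩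

/-! ### Edges inside a loose cycle -/

theorem lc3 {a b d : Finset V} (hab : a ≠ b) (had : a ≠ d) (hbd : b ≠ d)
    (h1 : (a ∩ b).card = 1) (h2 : (b ∩ d).card = 1) (h3 : (a ∩ d).card = 1) :
    LooseCycle [a, b, d] := by
  refine ⟨by simp, by simp [hab, had, hbd], ?_⟩
  intro i j hij hj
  simp only [List.length_cons, List.length_nil] at hj
  have : (i = 0 ∧ j = 1) ∨ (i = 0 ∧ j = 2) ∨ (i = 1 ∧ j = 2) := by omega
  rcases this with ⟨rfl, rfl⟩ | ⟨rfl, rfl⟩ | ⟨rfl, rfl⟩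
  · simpa using h1
  · simpa using h3
  · simpa using h2

theorem vset_triple (a b d : Finset V) : vset [a, b, d] = a ∪ b ∪ d := by
  simp [vset_cons', vset_nil', Finset.union_assoc]

theorem mem_triple_E {E : Finset (Finset V)} {a b d : Finset V} (ha : a ∈ E) (hb : b ∈ E)
    (hd : d ∈ E) : ∀ g ∈ [a, b, d], g ∈ E := by
  intro g hg
  simp only [List.mem_cons, List.not_mem_nil, or_false] at hg
  rcases hg with rfl | rfl | rfl
  · exact ha
  · exact hb
  · exact hd

theorem one_of_le {a b : Finset V} (h : (a ∩ b).card ≤ 1) {v : V} (ha : v ∈ a) (hb : v ∈ b) :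
    (a ∩ b).card = 1 := by
  have := Finset.card_pos.2 ⟨v, Finset.mem_inter.2 ⟨ha, hb⟩⟩
  omega

theorem eq_of_le {a b : Finset V} (h : (a ∩ b).card ≤ 1) {v w : V} (ha : v ∈ a) (hb : v ∈ b)
    (ha' : w ∈ a) (hb' : w ∈ b) : v = w :=
  Finset.card_le_one.1 h v (Finset.mem_inter.2 ⟨ha, hb⟩) w (Finset.mem_inter.2 ⟨ha', hb'⟩)

theorem two_le_inter {a b : Finset V} {v w : V} (hvw : v ≠ w) (ha : v ∈ a) (hb : v ∈ b)
    (ha' : w ∈ a) (hb' : w ∈ b) : 2 ≤ (a ∩ b).card :=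
  Finset.one_lt_card.2 ⟨v, Finset.mem_inter.2 ⟨ha, hb⟩, w, Finset.mem_inter.2 ⟨ha', hb'⟩, hvw⟩

/-- If `h` meets `g` at most once and `e` meets `g` at least twice then `h` is not inside
`e ∪ g`. -/
theorem not_sub_pair {k : ℕ} {e g h : Finset V} (he : e.card = k) (hh : h.card = k)
    (hne : h ≠ e) (h1 : (h ∩ g).card ≤ 1) (h2 : 2 ≤ (e ∩ g).card) : ¬ h ⊆ e ∪ g := by
  intro hs
  obtain ⟨w, hw, hwe⟩ : ∃ w ∈ h, w ∉ e := by
    by_contra hc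
    push Not at hc
    exact hne (Finset.eq_of_subset_of_card_le hc (by omega))
  have hwg : w ∈ g := (Finset.mem_union.1 (hs hw)).resolve_left hwe
  have hd : Disjoint (h ∩ e) (e ∩ g) := by
    rw [Finset.disjoint_left]
    intro v hv hv'
    rw [Finset.mem_inter] at hv hv'
    have := eq_of_le h1 hv.1 hv'.2 hw hwg
    exact hwe (this ▸ hv.2)
  have hu : (h ∩ e) ∪ (e ∩ g) ⊆ e :=
    Finset.union_subset Finset.inter_subset_right Finset.inter_subset_left
  have := Finset.card_le_card hu
  rw [Finset.card_union_of_disjoint hd] at this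
  have := inter_union_split hs
  omega

theorem star3_two {k : ℕ} {E : Finset (Finset V)} (c : Ctx k E) {g1 g2 g3 e : Finset V} {v : V}
    (h1 : g1 ∈ E) (h2 : g2 ∈ E) (h3 : g3 ∈ E) (he : e ∈ E)
    (v1 : v ∈ g1) (v2 : v ∈ g2) (v3 : v ∈ g3)
    (i12 : (g1 ∩ g2).card ≤ 1) (i13 : (g1 ∩ g3).card ≤ 1)
    (e1 : e ≠ g1) (e2 : e ≠ g2) (e3 : e ≠ g3) (hs : e ⊆ g1 ∪ g2 ∪ g3)
    (ho : 2 ≤ (e ∩ g1).card) : False := by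
  have hO := op_of (c.unif e he) (c.unif g1 h1) e1 ho
  have key : ∀ h ∈ E, v ∈ h → (g1 ∩ h).card ≤ 1 → e ≠ h → ∀ u ∈ e, u ∈ h → u = v := by
    intro h hh hv hi hne u hu huh
    by_contra huv
    have := handle c (Or.inl hO) (mem_pair_E he h1) hh (two_le_inter huv huh
      (by rw [vset_pair]; exact Finset.mem_union_left _ hu) hv
      (by rw [vset_pair]; exact Finset.mem_union_right _ v1))
    rw [vset_pair] at this
    exact not_sub_pair (c.unif e he) (c.unif h hh) hne.symm (by rwa [Finset.inter_comm]) ho this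
  refine e1 (Finset.eq_of_subset_of_card_le ?_ (by rw [c.unif e he, c.unif g1 h1]))
  intro u hu
  have := hs hu
  simp only [Finset.mem_union] at this
  rcases this with (h | h) | h
  · exact h
  · rw [key g2 h2 v2 i12 e2 u hu h]; exact v1
  · rw [key g3 h3 v3 i13 e3 u hu h]; exact v1

theorem star3 {k : ℕ} {E : Finset (Finset V)} (c : Ctx k E) {g1 g2 g3 e : Finset V} {v : V}
    (h1 : g1 ∈ E) (h2 : g2 ∈ E) (h3 : g3 ∈ E) (he : e ∈ E)
    (v1 : v ∈ g1) (v2 : v ∈ g2) (v3 : v ∈ g3) (n12 : g1 ≠ g2)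
    (i12 : (g1 ∩ g2).card ≤ 1) (i13 : (g1 ∩ g3).card ≤ 1) (i23 : (g2 ∩ g3).card ≤ 1)
    (e1 : e ≠ g1) (e2 : e ≠ g2) (e3 : e ≠ g3) (hs : e ⊆ g1 ∪ g2 ∪ g3) : False := by
  have hk := c.hk
  have ce := c.unif e he
  have j1 : (e ∩ g1).card ≤ 1 := by
    by_contra h
    exact star3_two c h1 h2 h3 he v1 v2 v3 i12 i13 e1 e2 e3 hs (by omega)
  have j2 : (e ∩ g2).card ≤ 1 := by
    by_contra h
    refine star3_two c h2 h1 h3 he v2 v1 v3 (by rwa [Finset.inter_comm]) i23 e2 e1 e3 ?_ (by omega)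
    rwa [Finset.union_comm g2]
  have j3 : (e ∩ g3).card ≤ 1 := by
    by_contra h
    refine star3_two c h3 h1 h2 he v3 v1 v2 (by rwa [Finset.inter_comm])
      (by rwa [Finset.inter_comm]) e3 e1 e2 ?_ (by omega)
    rw [Finset.union_assoc, Finset.union_comm]; exact hs
  have s1 := inter_union_split hs
  have s2 : (e ∩ (g1 ∪ g2)).card ≤ (e ∩ g1).card + (e ∩ g2).card := by
    rw [Finset.inter_union_distrib_left]; exact Finset.card_union_le _ _
  have hC : LooseCycle [e, g1, g2] := lc3 e1 e2 n12 (by omega) (one_of_le i12 v1 v2) (by omega)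
  have hve : v ∉ e := by
    intro hv
    have : e ⊆ {v} := by
      intro u hu
      have := hs hu
      simp only [Finset.mem_union] at this
      rw [Finset.mem_singleton]
      rcases this with (h | h) | h
      · exact eq_of_le j1 hu h hv v1
      · exact eq_of_le j2 hu h hv v2
      · exact eq_of_le j3 hu h hv v3
    have := Finset.card_le_card this
    rw [Finset.card_singleton] at this
    omega
  obtain ⟨u, hu⟩ := Finset.card_pos.1 (by omega : 0 < (e ∩ g3).card)
  rw [Finset.mem_inter] at hu
  have hsub := handle c (Or.inr hC) (mem_triple_E he h1 h2) h3
    (two_le_inter (v := u) (w := v) (by rintro rfl; exact hve hu.1) hu.2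
      (subset_vset (List.mem_cons_self) hu.1) v3
      (subset_vset (List.mem_cons_of_mem _ List.mem_cons_self) v1))
  have : g3 ⊆ {u, v} := by
    intro w hw
    have := hsub hw
    rw [vset_triple] at this
    simp only [Finset.mem_union, Finset.mem_insert, Finset.mem_singleton] at this ⊢
    rcases this with (h | h) | h
    · left; exact eq_of_le j3 h hw hu.1 hu.2
    · right; exact eq_of_le i13 h hw v1 v3
    · right; exact eq_of_le i23 h hw v2 v3
  have := Finset.card_le_card this
  have := Finset.card_le_two (a := u) (b := v)
  rw [c.unif g3 h3] at *
  omega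

/-- No vertex in three edges. -/
def ND (σ : List (Finset V)) : Prop :=
  ∀ a ∈ σ, ∀ b ∈ σ, ∀ d ∈ σ, a ≠ b → a ≠ d → b ≠ d → ∀ v, v ∈ a → v ∈ b → v ∉ d

theorem lc_adj {σ : List (Finset V)} (h : LooseCycle σ) {i j : ℕ} (hij : i < j)
    (hj : j < σ.length) {v : V} (hi : v ∈ σ.getD i ∅) (hv : v ∈ σ.getD j ∅) :
    j = i + 1 ∨ (i = 0 ∧ j = σ.length - 1) := by
  by_contra hc
  have := h.2.2 i j hij hj
  rw [if_neg hc, Finset.card_eq_zero] at this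
  exact absurd (Finset.mem_inter.2 ⟨hi, hv⟩) (by rw [this]; simp)

theorem lc_ne {σ : List (Finset V)} (h : LooseCycle σ) {i j : ℕ} (hij : i ≠ j)
    (hi : i < σ.length) (hj : j < σ.length) : σ.getD i ∅ ≠ σ.getD j ∅ :=
  fun he => hij (nodup_getD h.2.1 hi hj he)

theorem lc_meet {σ : List (Finset V)} (h : LooseCycle σ) {i : ℕ} (hi : i + 1 < σ.length) :
    ∃ v, v ∈ σ.getD i ∅ ∧ v ∈ σ.getD (i + 1) ∅ := by
  obtain ⟨v, hv⟩ := lc_chain h i hi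
  exact ⟨v, Finset.mem_inter.1 hv⟩

theorem lc_meet_last {σ : List (Finset V)} (h : LooseCycle σ) :
    ∃ v, v ∈ σ.getD 0 ∅ ∧ v ∈ σ.getD (σ.length - 1) ∅ := by
  have hl := h.1
  have := h.2.2 0 (σ.length - 1) (by omega) (by omega)
  rw [if_pos (Or.inr ⟨rfl, rfl⟩)] at this
  obtain ⟨v, hv⟩ := Finset.card_pos.1 (by omega : 0 < (σ.getD 0 ∅ ∩ σ.getD (σ.length - 1) ∅).card)
  exact ⟨v, Finset.mem_inter.1 hv⟩

theorem lc_closure {k : ℕ} {E : Finset (Finset V)} (c : Ctx k E) {σ C : List (Finset V)}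
    (hσ : LooseCycle σ) (hσE : ∀ g ∈ σ, g ∈ E) (hND : ND σ) (hC : OPorLC k C)
    (hCE : ∀ g ∈ C, g ∈ E) {h : Finset V} (hh : h ∈ σ) (hhC : h ⊆ vset C) :
    ∀ g ∈ σ, g ⊆ vset C := by
  have hk := c.hk
  by_contra hcon
  push Not at hcon
  obtain ⟨g, hg, hgC⟩ := hcon
  obtain ⟨τ, hτ, hmem, hlen, h0⟩ := lc_first hσ hg
  have hτE : ∀ g ∈ τ, g ∈ E := fun g hg => hσE g ((hmem g).1 hg)
  have hND' : ∀ a b d, a ≠ b → a ≠ d → b ≠ d → a < τ.length → b < τ.length → d < τ.length →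
      ∀ v, v ∈ τ.getD a ∅ → v ∈ τ.getD b ∅ → v ∉ τ.getD d ∅ :=
    fun a b d hab had hbd ha hb hd => hND _ ((hmem _).1 (getD_mem' ha)) _
      ((hmem _).1 (getD_mem' hb)) _ ((hmem _).1 (getD_mem' hd)) (lc_ne hτ hab ha hb)
      (lc_ne hτ had ha hd) (lc_ne hτ hbd hb hd)
  have hl3 := hτ.1
  let S := (Finset.range τ.length).filter (fun i => τ.getD i ∅ ⊆ vset C)
  have hSne : S.Nonempty := by
    obtain ⟨i, hi, hih⟩ := mem_getD ((hmem h).2 hh)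
    exact ⟨i, Finset.mem_filter.2 ⟨Finset.mem_range.2 hi, by rw [hih]; exact hhC⟩⟩
  obtain ⟨i, hiS, himin⟩ : ∃ i ∈ S, ∀ n ∈ S, i ≤ n := ⟨S.min' hSne, S.min'_mem _, fun n hn =>
    S.min'_le n hn⟩
  obtain ⟨j, hjS, hjmax⟩ : ∃ j ∈ S, ∀ n ∈ S, n ≤ j := ⟨S.max' hSne, S.max'_mem _, fun n hn =>
    S.le_max' n hn⟩
  have memS : ∀ n, n ∈ S ↔ n < τ.length ∧ τ.getD n ∅ ⊆ vset C := by
    intro n; simp only [S, Finset.mem_filter, Finset.mem_range]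
  have hi := (memS i).1 hiS
  have hj := (memS j).1 hjS
  have hij := hjmax i hiS
  have hi0 : i ≠ 0 := by
    rintro rfl
    exact hgC (h0 ▸ hi.2)
  let X : Set (Finset V) := {g | g ∈ τ ∧ ¬ g ⊆ vset C}
  obtain ⟨x, hx1, hx2⟩ := lc_meet hτ (i := i - 1) (by omega)
  rw [Nat.sub_add_cancel (by omega)] at hx2
  -- the first vertex is connected to all of the initial edge
  have hrx : ∀ u ∈ τ.getD 0 ∅, Relation.ReflTransGen (AdjX X) x u := by
    intro u hu
    refine rtg_mono ?_ (rtg_of_chain (chain_take (lc_chain hτ) i) ?_ ?_)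
    · intro f hf
      obtain ⟨n, hn, rfl⟩ := mem_getD hf
      rw [List.length_take] at hn
      rw [getD_take' (by omega)]
      refine ⟨getD_mem' (by omega), fun hs => ?_⟩
      have := himin n ((memS n).2 ⟨by omega, hs⟩)
      omega
    · exact mem_vset_take.2 ⟨i - 1, by omega, by omega, hx1⟩
    · exact mem_vset_take.2 ⟨0, by omega, by omega, hu⟩
  obtain ⟨z, hz0, hz1⟩ := lc_meet_last hτ
  suffices hs : ∃ y, y ∈ vset C ∧ x ≠ y ∧ ∃ u ∈ τ.getD 0 ∅, Relation.ReflTransGen (AdjX X) u y by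
    obtain ⟨y, hy, hxy, u, hu, hr⟩ := hs
    obtain ⟨q1, hq1, q2, hq2, hne, hcard, -⟩ := ear_main c hC hCE (X := X)
      (fun g hg => hτE g hg.1) (fun g hg => hg.2) hxy (hi.2 hx2) hy ((hrx u hu).trans hr)
    have := lc_inter_le hτ hq1.1 hq2.1 hne
    omega
  by_cases hjl : j = τ.length - 1
  · subst hjl
    refine ⟨z, hj.2 hz1, ?_, z, hz0, Relation.ReflTransGen.refl⟩
    rintro rfl
    by_cases hi1 : i = τ.length - 1
    · exact hND' 0 (i - 1) i (by omega) (by omega) (by omega) (by omega) (by omega) (by omega) x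
        hz0 hx1 hx2
    · exact hND' 0 i (τ.length - 1) (by omega) (by omega) (by omega) (by omega) (by omega)
        (by omega) x hz0 hx2 hz1
  · obtain ⟨y, hy1, hy2⟩ := lc_meet hτ (i := j) (by omega)
    refine ⟨y, hj.2 hy1, ?_, z, hz0, ?_⟩
    · rintro rfl
      exact hND' (i - 1) i (j + 1) (by omega) (by omega) (by omega) (by omega) (by omega)
        (by omega) x hx1 hx2 hy2
    · refine rtg_mono ?_ (rtg_of_chain (chain_drop (lc_chain hτ) (j + 1)) ?_ ?_)
      · intro f hf
        obtain ⟨n, hn, rfl⟩ := mem_getD hf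
        rw [List.length_drop] at hn
        rw [getD_drop']
        refine ⟨getD_mem' (by omega), fun hs => ?_⟩
        have := hjmax _ ((memS (j + 1 + n)).2 ⟨by omega, hs⟩)
        omega
      · refine mem_vset_getD.2 ⟨τ.length - 1 - (j + 1), by rw [List.length_drop]; omega, ?_⟩
        rw [getD_drop', show j + 1 + (τ.length - 1 - (j + 1)) = τ.length - 1 by omega]
        exact hz1
      · refine mem_vset_getD.2 ⟨0, by rw [List.length_drop]; omega, ?_⟩
        rw [getD_drop']
        exact hy2

theorem inside_lc_nd {k : ℕ} {E : Finset (Finset V)} (c : Ctx k E) {σ : List (Finset V)}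
    (hσ : LooseCycle σ) (hσE : ∀ g ∈ σ, g ∈ E) {e : Finset V} (he : e ∈ E) (heσ : e ∉ σ)
    (hs : e ⊆ vset σ) : ND σ := by
  intro a ha b hb d hd hab had hbd v va vb vd
  have hl := hσ.1
  have ia := lc_inter_le hσ ha hb hab
  have ib := lc_inter_le hσ ha hd had
  have id' := lc_inter_le hσ hb hd hbd
  refine star3 c (hσE a ha) (hσE b hb) (hσE d hd) he va vb vd hab ia ib id'
    (fun h => heσ (h ▸ ha)) (fun h => heσ (h ▸ hb)) (fun h => heσ (h ▸ hd)) ?_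
  obtain ⟨i, hi, rfl⟩ := mem_getD ha
  obtain ⟨j, hj, rfl⟩ := mem_getD hb
  obtain ⟨m, hm, rfl⟩ := mem_getD hd
  have hij : i ≠ j := by rintro rfl; exact hab rfl
  have him : i ≠ m := by rintro rfl; exact had rfl
  have hjm : j ≠ m := by rintro rfl; exact hbd rfl
  have adj : ∀ a b, a ≠ b → a < σ.length → b < σ.length → v ∈ σ.getD a ∅ → v ∈ σ.getD b ∅ →
      (b = a + 1 ∨ a = b + 1 ∨ (a = 0 ∧ b = σ.length - 1) ∨ (b = 0 ∧ a = σ.length - 1)) := by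
    intro a b hab ha hb hva hvb
    rcases lt_or_gt_of_ne hab with h | h
    · have := lc_adj hσ h hb hva hvb; omega
    · have := lc_adj hσ h ha hvb hva; omega
  have a1 := adj i j hij hi hj va vb
  have a2 := adj i m him hi hm va vd
  have a3 := adj j m hjm hj hm vb vd
  have h3 : σ.length = 3 := by omega
  intro u hu
  obtain ⟨n, hn, hun⟩ := mem_vset_getD.1 (hs hu)
  have : n = i ∨ n = j ∨ n = m := by omega
  simp only [Finset.mem_union]
  rcases this with rfl | rfl | rfl
  · exact Or.inl (Or.inl hun)
  · exact Or.inl (Or.inr hun)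
  · exact Or.inr hun

theorem inside_lc {k : ℕ} {E : Finset (Finset V)} (c : Ctx k E) {σ : List (Finset V)}
    (hσ : LooseCycle σ) (hσE : ∀ g ∈ σ, g ∈ E) {e : Finset V} (he : e ∈ E) (heσ : e ∉ σ)
    (hs : e ⊆ vset σ) : σ.length = 3 ∧ k = 3 ∧ ND σ ∧ (∀ g ∈ σ, (e ∩ g).card = 1) ∧
      ∀ g ∈ σ, ∀ g' ∈ σ, g' ≠ g → ∀ u ∈ e, u ∈ g → u ∉ g' := by
  have hk := c.hk
  have hND := inside_lc_nd c hσ hσE he heσ hs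
  have ce := c.unif e he
  have step1 : ∀ g ∈ σ, (e ∩ g).card ≤ 1 := by
    intro g hg
    by_contra h2
    have hO := op_of ce (c.unif g (hσE g hg)) (fun h => heσ (h ▸ hg)) (by omega)
    have hcl := lc_closure c hσ hσE hND (Or.inl hO) (mem_pair_E he (hσE g hg)) hg
      (subset_vset (by simp))
    obtain ⟨h, hh, hne⟩ : ∃ h ∈ σ, h ≠ g := by
      have hl := hσ.1
      by_cases h0 : σ.getD 0 ∅ = g
      · exact ⟨σ.getD 1 ∅, getD_mem' (by omega), by
          rw [← h0]; exact lc_ne hσ (by omega) (by omega) (by omega)⟩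
      · exact ⟨_, getD_mem' (by omega), h0⟩
    have hsub := hcl h hh
    rw [vset_pair] at hsub
    exact not_sub_pair ce (c.unif h (hσE h hh)) (fun h' => heσ (h' ▸ hh))
      (lc_inter_le hσ hh hg hne) (by omega) hsub
  have step2 : ∀ g ∈ σ, k = 3 ∧ (e ∩ g).card = 1 ∧
      ∀ g' ∈ σ, g' ≠ g → ∀ u ∈ e, u ∈ g → u ∉ g' := by
    intro g hg
    obtain ⟨τ, hτ, hmem, hlen, h0⟩ := lc_first hσ hg
    have hl3 := hτ.1
    have cg := c.unif g (hσE g hg)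
    -- two vertices of `e` outside `g`
    have hout : 2 ≤ (e \ g).card := by
      have := Finset.card_sdiff_add_card_inter e g
      have := step1 g hg
      omega
    obtain ⟨p, hp, q, hq, hpq⟩ := Finset.one_lt_card.1 hout
    rw [Finset.mem_sdiff] at hp hq
    have hdrop : ∀ p ∈ e, p ∉ g → p ∈ vset (τ.drop 1) := by
      intro p hp hpg
      have hpσ := hs hp
      rw [← vset_congr hmem] at hpσ
      obtain ⟨n, hn, hpn⟩ := mem_vset_getD.1 hpσ
      have hn0 : n ≠ 0 := by rintro rfl; exact hpg (h0 ▸ hpn)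
      refine mem_vset_getD.2 ⟨n - 1, by rw [List.length_drop]; omega, ?_⟩
      rw [getD_drop', show 1 + (n - 1) = n by omega]; exact hpn
    have hX : ∀ f ∈ τ.drop 1, f ∈ σ ∧ f ≠ g := by
      intro f hf
      obtain ⟨n, hn, rfl⟩ := mem_getD hf
      rw [List.length_drop] at hn
      rw [getD_drop', ← h0]
      exact ⟨(hmem _).1 (getD_mem' (by omega)), lc_ne hτ (by omega) (by omega) (by omega)⟩
    obtain ⟨C, hC, hCX⟩ := exists_cycle c he (X := {f | f ∈ τ.drop 1})
      (fun f hf => hσE f (hX f hf).1) (fun h => heσ (hX e h).1) hpq hp.1 hq.1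
      (rtg_of_chain (chain_drop (lc_chain hτ) 1) (hdrop p hp.1 hp.2) (hdrop q hq.1 hq.2))
    have hCE : ∀ f ∈ C, f ∈ E := by
      intro f hf
      rcases hCX f hf with rfl | h
      · exact he
      · exact hσE f (hX f h).1
    obtain ⟨h, hhC, hhσ⟩ : ∃ h ∈ C, h ∈ σ := by
      have hCl := oplc_len hC
      rcases hCX _ (getD_mem' (i := 0) (l := C) (by omega)) with h1 | h1
      · rcases hCX _ (getD_mem' (i := 1) (l := C) (by omega)) with h2 | h2
        · have := nodup_getD (oplc_nodup hC) (by omega) (by omega) (h1.trans h2.symm)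
          omega
        · exact ⟨_, getD_mem' (by omega), (hX _ h2).1⟩
      · exact ⟨_, getD_mem' (by omega), (hX _ h1).1⟩
    have hgC := lc_closure c hσ hσE hND hC hCE hhσ (subset_vset hhC) g hg
    have hnb : ∀ v ∈ g, ∀ f ∈ σ, f ≠ g → v ∈ f → f = τ.getD 1 ∅ ∨ f = τ.getD (τ.length - 1) ∅ := by
      intro v hv f hf hfg hvf
      obtain ⟨n, hn, rfl⟩ := mem_getD ((hmem f).2 hf)
      have hn0 : n ≠ 0 := by rintro rfl; exact hfg h0
      rcases lc_adj hτ (i := 0) (j := n) (by omega) hn (h0.symm ▸ hv) hvf with h | h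
      · left; rw [h]
      · right; rw [h.2]
    have hsub : g ⊆ e ∪ (τ.getD 1 ∅ ∪ τ.getD (τ.length - 1) ∅) := by
      intro v hv
      obtain ⟨f, hf, hvf⟩ := mem_vset.1 (hgC hv)
      rcases hCX f hf with rfl | hf'
      · exact Finset.mem_union_left _ hvf
      · obtain ⟨hfσ, hfg⟩ := hX f hf'
        refine Finset.mem_union_right _ ?_
        rw [Finset.mem_union]
        rcases hnb v hv f hfσ hfg hvf with h | h
        · left; rw [← h]; exact hvf
        · right; rw [← h]; exact hvf
    have i1 : (g ∩ τ.getD 1 ∅).card ≤ 1 :=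
      lc_inter_le hτ ((hmem g).2 hg) (getD_mem' (by omega))
        (by rw [← h0]; exact lc_ne hτ (by omega) (by omega) (by omega))
    have i2 : (g ∩ τ.getD (τ.length - 1) ∅).card ≤ 1 :=
      lc_inter_le hτ ((hmem g).2 hg) (getD_mem' (by omega))
        (by rw [← h0]; exact lc_ne hτ (by omega) (by omega) (by omega))
    have i3 := step1 g hg
    have t1 := inter_union_split hsub
    have t2 : (g ∩ (τ.getD 1 ∅ ∪ τ.getD (τ.length - 1) ∅)).card ≤
        (g ∩ τ.getD 1 ∅).card + (g ∩ τ.getD (τ.length - 1) ∅).card := by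
      rw [Finset.inter_union_distrib_left]; exact Finset.card_union_le _ _
    rw [Finset.inter_comm g e] at t1
    refine ⟨by omega, by omega, ?_⟩
    intro g' hg' hne u hue hug hug'
    have : g ⊆ τ.getD 1 ∅ ∪ τ.getD (τ.length - 1) ∅ := by
      intro v hv
      rcases Finset.mem_union.1 (hsub hv) with h | h
      · have := eq_of_le i3 h hv hue hug
        subst this
        rw [Finset.mem_union]
        rcases hnb v hv g' hg' hne hug' with h' | h'
        · left; rw [← h']; exact hug'
        · right; rw [← h']; exact hug'
      · exact h
    have := inter_union_split this
    omega
  have hl := hσ.1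
  have hk3 : k = 3 := (step2 _ (getD_mem' (i := 0) (by omega))).1
  refine ⟨?_, hk3, hND, fun g hg => (step2 g hg).2.1, fun g hg => (step2 g hg).2.2⟩
  have heq : e = σ.toFinset.biUnion (fun g => e ∩ g) := by
    ext v
    simp only [Finset.mem_biUnion, List.mem_toFinset, Finset.mem_inter]
    constructor
    · intro hv
      obtain ⟨g, hg, hvg⟩ := mem_vset.1 (hs hv)
      exact ⟨g, hg, hv, hvg⟩
    · rintro ⟨g, -, hv, -⟩; exact hv
  have hcard := Finset.card_biUnion (s := σ.toFinset) (t := fun g => e ∩ g) (by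
    intro g hg g' hg' hne
    change Disjoint (e ∩ g) (e ∩ g')
    rw [Finset.disjoint_left]
    intro u hu hu'
    rw [Finset.mem_inter] at hu hu'
    exact (step2 g (List.mem_toFinset.1 hg)).2.2 g' (List.mem_toFinset.1 hg') hne.symm u hu.1
      hu.2 hu'.2)
  rw [← heq, Finset.sum_congr rfl (fun g hg => (step2 g (List.mem_toFinset.1 hg)).2.1),
    Finset.sum_const, List.toFinset_card_of_nodup hσ.2.1, ce] at hcard
  simp at hcard
  omega

theorem sub_eq {k : ℕ} {e f : Finset V} (he : e.card = k) (hf : f.card = k) (h : e ⊆ f) : e = f :=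
  Finset.eq_of_subset_of_card_le h (by omega)

theorem exists_third {k : ℕ} (hk : 3 ≤ k) {e : Finset V} (he : e.card = k) (x y : V) :
    ∃ v ∈ e, v ≠ x ∧ v ≠ y := by
  have h : ¬ e ⊆ {x, y} := fun h => by
    have := Finset.card_le_card h
    have := Finset.card_le_two (a := x) (b := y)
    omega
  obtain ⟨v, hv, hn⟩ := Finset.not_subset.1 h
  simp only [Finset.mem_insert, Finset.mem_singleton, not_or] at hn
  exact ⟨v, hv, hn⟩

/-- The concrete form of a star with four edges. -/
structure Star4 (c1 c2 : V) (a1 b1 a2 b2 : Finset V) : Prop where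
  hc : c1 ≠ c2
  ma1 : c1 ∈ a1
  mb1 : c1 ∈ b1
  ma2 : c2 ∈ a2
  mb2 : c2 ∈ b2
  na1 : c2 ∉ a1
  nb1 : c2 ∉ b1
  na2 : c1 ∉ a2
  nb2 : c1 ∉ b2
  ha : a1.erase c1 = a2.erase c2
  hb : b1.erase c1 = b2.erase c2
  i1 : a1 ∩ b1 = {c1}
  i2 : a2 ∩ b2 = {c2}

namespace Star4

variable {c1 c2 : V} {a1 b1 a2 b2 : Finset V}

theorem swapAB (h : Star4 c1 c2 a1 b1 a2 b2) : Star4 c1 c2 b1 a1 b2 a2 :=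
  ⟨h.hc, h.mb1, h.ma1, h.mb2, h.ma2, h.nb1, h.na1, h.nb2, h.na2, h.hb, h.ha,
    by rw [Finset.inter_comm]; exact h.i1, by rw [Finset.inter_comm]; exact h.i2⟩

theorem swap12 (h : Star4 c1 c2 a1 b1 a2 b2) : Star4 c2 c1 a2 b2 a1 b1 :=
  ⟨h.hc.symm, h.ma2, h.mb2, h.ma1, h.mb1, h.na2, h.nb2, h.na1, h.nb1, h.ha.symm, h.hb.symm,
    h.i2, h.i1⟩

theorem mem_iff (h : Star4 c1 c2 a1 b1 a2 b2) {v : V} (h1 : v ≠ c1) (h2 : v ≠ c2) :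
    v ∈ a1 ↔ v ∈ a2 := by
  have := congrArg (fun s => v ∈ s) h.ha
  simpa [h1, h2] using this

theorem inter_a (h : Star4 c1 c2 a1 b1 a2 b2) : a1 ∩ a2 = a1.erase c1 := by
  ext v
  rw [Finset.mem_inter, Finset.mem_erase]
  constructor
  · rintro ⟨h1, h2⟩
    exact ⟨fun hh => h.na2 (hh ▸ h2), h1⟩
  · rintro ⟨h1, h2⟩
    exact ⟨h2, (h.mem_iff h1 (fun hh => h.na1 (hh ▸ h2))).1 h2⟩

theorem card_a (h : Star4 c1 c2 a1 b1 a2 b2) {k : ℕ} (hk : a1.card = k) :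
    (a1 ∩ a2).card = k - 1 := by
  rw [h.inter_a, Finset.card_erase_of_mem h.ma1, hk]

theorem ne_a (h : Star4 c1 c2 a1 b1 a2 b2) : a1 ≠ a2 := fun hh => h.na2 (hh ▸ h.ma1)

theorem disj (h : Star4 c1 c2 a1 b1 a2 b2) : a1 ∩ b2 = ∅ := by
  ext v
  simp only [Finset.mem_inter, Finset.notMem_empty, iff_false, not_and]
  intro h1 h2
  have n1 : v ≠ c1 := fun hh => h.nb2 (hh ▸ h2)
  have n2 : v ≠ c2 := fun hh => h.na1 (hh ▸ h1)
  have : v ∈ a1 ∩ b1 := Finset.mem_inter.2 ⟨h1, (h.swapAB.mem_iff n1 n2).2 h2⟩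
  rw [h.i1, Finset.mem_singleton] at this
  exact n1 this

theorem op_a {k : ℕ} {E : Finset (Finset V)} (c : Ctx k E) (h : Star4 c1 c2 a1 b1 a2 b2)
    (ha1 : a1 ∈ E) (ha2 : a2 ∈ E) : OverlapPair k [a1, a2] := by
  have := c.hk
  exact op_of (c.unif _ ha1) (c.unif _ ha2) h.ne_a (by rw [h.card_a (c.unif _ ha1)]; omega)

/-- An edge inside one overlapping pair of the star cannot contain both centres. -/
theorem no_both {k : ℕ} {E : Finset (Finset V)} (c : Ctx k E) (h : Star4 c1 c2 a1 b1 a2 b2)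
    (hb1 : b1 ∈ E) (hb2 : b2 ∈ E) {g : Finset V} (hg : g ∈ E) (h1 : c1 ∈ g) (h2 : c2 ∈ g)
    (hs : g ⊆ a1 ∪ a2) : False := by
  have hsub := handle c (Or.inl (h.swapAB.op_a c hb1 hb2)) (mem_pair_E hb1 hb2) hg (by
    rw [vset_pair]
    exact two_le_inter h.hc h1 (Finset.mem_union_left _ h.mb1) h2 (Finset.mem_union_right _ h.mb2))
  rw [vset_pair] at hsub
  obtain ⟨v, hv, n1, n2⟩ := exists_third c.hk (c.unif _ hg) c1 c2
  have hva : v ∈ a1 := by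
    rcases Finset.mem_union.1 (hs hv) with hh | hh
    · exact hh
    · exact (h.mem_iff n1 n2).2 hh
  have hvb : v ∈ b1 := by
    rcases Finset.mem_union.1 (hsub hv) with hh | hh
    · exact hh
    · exact (h.swapAB.mem_iff n1 n2).2 hh
  have : v ∈ a1 ∩ b1 := Finset.mem_inter.2 ⟨hva, hvb⟩
  rw [h.i1, Finset.mem_singleton] at this
  exact n1 this

theorem mem_of_sub {k : ℕ} (h : Star4 c1 c2 a1 b1 a2 b2) {g : Finset V}
    (hg : g.card = k) (ha : a1.card = k) (hne : g ≠ a1) (hs : g ⊆ a1 ∪ a2) : c2 ∈ g := by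
  by_contra hn
  apply hne
  apply sub_eq hg ha
  intro v hv
  rcases Finset.mem_union.1 (hs hv) with hh | hh
  · exact hh
  · have n2 : v ≠ c2 := fun h' => hn (h' ▸ hv)
    have n1 : v ≠ c1 := fun h' => h.na2 (h' ▸ hh)
    exact (h.mem_iff n1 n2).2 hh

theorem inside_a {k : ℕ} {E : Finset (Finset V)} (c : Ctx k E) (h : Star4 c1 c2 a1 b1 a2 b2)
    (ha1 : a1 ∈ E) (ha2 : a2 ∈ E)
    (hb1 : b1 ∈ E) (hb2 : b2 ∈ E) {g : Finset V} (hg : g ∈ E) (n1 : g ≠ a1) (n2 : g ≠ a2)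
    (ho : 2 ≤ (g ∩ (a1 ∪ a2)).card) : False := by
  have hsub := handle c (Or.inl (h.op_a c ha1 ha2)) (mem_pair_E ha1 ha2) hg (by
    rw [vset_pair]; exact ho)
  rw [vset_pair] at hsub
  refine h.no_both c hb1 hb2 hg ?_ ?_ hsub
  · exact h.swap12.mem_of_sub (c.unif _ hg) (c.unif _ ha2) n2 (by rwa [Finset.union_comm])
  · exact h.mem_of_sub (c.unif _ hg) (c.unif _ ha1) n1 hsub

theorem inside {k : ℕ} {E : Finset (Finset V)} (c : Ctx k E) (h : Star4 c1 c2 a1 b1 a2 b2)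
    (ha1 : a1 ∈ E) (ha2 : a2 ∈ E)
    (hb1 : b1 ∈ E) (hb2 : b2 ∈ E) {g : Finset V} (hg : g ∈ E) (n1 : g ≠ a1) (n2 : g ≠ a2)
    (n3 : g ≠ b1) (n4 : g ≠ b2) (hs : g ⊆ (a1 ∪ a2) ∪ (b1 ∪ b2)) : False := by
  have h1 := inter_union_split hs
  rw [c.unif _ hg] at h1
  have hk := c.hk
  by_cases ho : 2 ≤ (g ∩ (a1 ∪ a2)).card
  · exact h.inside_a c ha1 ha2 hb1 hb2 hg n1 n2 ho
  · exact h.swapAB.inside_a c hb1 hb2 ha1 ha2 hg n3 n4 (by omega)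

theorem third {k : ℕ} {E : Finset (Finset V)} (c : Ctx k E) (h : Star4 c1 c2 a1 b1 a2 b2)
    (ha1 : a1 ∈ E) (ha2 : a2 ∈ E)
    (hb1 : b1 ∈ E) {g : Finset V} (hg : g ∈ E) (h2 : c2 ∉ g)
    (ia : g ∩ a1 = {c1}) (ib : g ∩ b1 = {c1}) : False := by
  have hk := c.hk
  have cc : ∀ {x y : Finset V}, x ∈ E → x ∩ y = {c1} → x ≠ y := by
    intro x y hx hxy he
    rw [← he, Finset.inter_self] at hxy
    have := c.unif _ hx
    rw [hxy, Finset.card_singleton] at this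
    omega
  have hlc := lc3 (cc ha1 h.i1) (cc hg ia).symm (cc hg ib).symm (by rw [h.i1]; simp)
    (by rw [Finset.inter_comm, ib]; simp) (by rw [Finset.inter_comm, ia]; simp)
  have hsub := handle c (Or.inr hlc) (mem_triple_E ha1 hb1 hg) ha2 (by
    have h1 := h.card_a (c.unif _ ha1)
    have : (a1 ∩ a2).card ≤ (a2 ∩ vset [a1, b1, g]).card := by
      apply Finset.card_le_card
      intro v hv
      rw [Finset.mem_inter] at hv
      rw [Finset.mem_inter]
      exact ⟨hv.2, mem_vset.2 ⟨a1, by simp, hv.1⟩⟩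
    omega)
  have := hsub h.ma2
  rw [vset_triple, Finset.mem_union, Finset.mem_union] at this
  rcases this with (hh | hh) | hh
  · exact h.na1 hh
  · exact h.nb1 hh
  · exact h2 hh

end Star4

theorem star_u2 {k u : ℕ} {E : Finset (Finset V)} (c : Ctx k E) {σ : List (Finset V)}
    (hσE : ∀ g ∈ σ, g ∈ E) (hu : 2 ≤ u) (h : StarKU2 k u σ) :
    u = 2 ∧ ∃ c1 c2 a1 b1 a2 b2, Star4 c1 c2 a1 b1 a2 b2 ∧ [a1, b1, a2, b2].Perm σ := by
  obtain ⟨-, -, c1, c2, l1, l2, hc, hl1, hl2, hp, s1, s2, he⟩ := h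
  have m1 : ∀ i < u, l1.getD i ∅ ∈ E ∧ c1 ∈ l1.getD i ∅ := by
    intro i hi
    have hm : l1.getD i ∅ ∈ l1 := getD_mem' (by omega)
    exact ⟨hσE _ (hp.mem_iff.1 (List.mem_append_left _ hm)), s1.2.2.1 _ hm⟩
  have m2 : ∀ i < u, l2.getD i ∅ ∈ E ∧ c2 ∈ l2.getD i ∅ := by
    intro i hi
    have hm : l2.getD i ∅ ∈ l2 := getD_mem' (by omega)
    exact ⟨hσE _ (hp.mem_iff.1 (List.mem_append_right _ hm)), s2.2.2.1 _ hm⟩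
  have n1 : ∀ i < u, c2 ∉ l1.getD i ∅ := by
    intro i hi hh
    have : c2 ∈ (l2.getD i ∅).erase c2 := by
      rw [← he i hi]; exact Finset.mem_erase.2 ⟨hc.symm, hh⟩
    exact Finset.notMem_erase _ _ this
  have n2 : ∀ i < u, c1 ∉ l2.getD i ∅ := by
    intro i hi hh
    have : c1 ∈ (l1.getD i ∅).erase c1 := by
      rw [he i hi]; exact Finset.mem_erase.2 ⟨hc, hh⟩
    exact Finset.notMem_erase _ _ this
  have hS : Star4 c1 c2 (l1.getD 0 ∅) (l1.getD 1 ∅) (l2.getD 0 ∅) (l2.getD 1 ∅) :=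
    ⟨hc, (m1 0 (by omega)).2, (m1 1 (by omega)).2, (m2 0 (by omega)).2, (m2 1 (by omega)).2,
      n1 0 (by omega), n1 1 (by omega), n2 0 (by omega), n2 1 (by omega), he 0 (by omega),
      he 1 (by omega), s1.2.2.2 0 1 (by omega) (by omega), s2.2.2.2 0 1 (by omega) (by omega)⟩
  have hu2 : u = 2 := by
    by_contra hne
    refine hS.third c (m1 0 (by omega)).1 (m2 0 (by omega)).1 (m1 1 (by omega)).1
      (m1 2 (by omega)).1 (n1 2 (by omega)) ?_ ?_
    · rw [Finset.inter_comm]; exact s1.2.2.2 0 2 (by omega) (by omega)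
    · rw [Finset.inter_comm]; exact s1.2.2.2 1 2 (by omega) (by omega)
  refine ⟨hu2, c1, c2, _, _, _, _, hS, ?_⟩
  subst hu2
  match l1, l2, hl1, hl2, hp with
  | [x, y], [x', y'], _, _, hp => simpa using hp

/-- An edge inside an overlapping pair. -/
theorem inside_op {k : ℕ} {E : Finset (Finset V)} (c : Ctx k E) {p q e : Finset V}
    (hO : OverlapPair k [p, q]) (hp : p ∈ E) (hq : q ∈ E) (he : e ∈ E) (hep : e ≠ p)
    (hs : e ⊆ p ∪ q) : p ∪ e = p ∪ q := by
  have ho := op_iff.1 hO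
  have h1 : (p ∪ q).card = p.card + q.card - (p ∩ q).card := Finset.card_union p q
  have h2 : (p ∪ e).card = p.card + e.card - (p ∩ e).card := Finset.card_union p e
  have h3 : p ∪ e ⊆ p ∪ q := Finset.union_subset Finset.subset_union_left hs
  have h4 := Finset.card_le_card h3
  have cp := c.unif _ hp
  have cq := c.unif _ hq
  have ce := c.unif _ he
  have hk := c.hk
  have h5 : (p ∩ e).card ≤ k := by rw [← cp]; exact Finset.card_le_card Finset.inter_subset_left
  have hsub := handle c (Or.inl (op_of cp ce hep.symm (by omega))) (mem_pair_E hp he) hq (by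
    rw [vset_pair]
    have : (p ∩ q).card ≤ (q ∩ (p ∪ e)).card := by
      apply Finset.card_le_card
      intro v hv
      rw [Finset.mem_inter] at hv
      exact Finset.mem_inter.2 ⟨hv.2, Finset.mem_union_left _ hv.1⟩
    omega)
  rw [vset_pair] at hsub
  exact Finset.Subset.antisymm h3 (Finset.union_subset Finset.subset_union_left hsub)

theorem link_pair {k u a : ℕ} {σ : List (Finset V)} (h : KLink k u a σ) {x y : Finset V}
    (hx : x ∈ σ) (hy : y ∈ σ) (hne : x ≠ y) : (x ∪ y).card = k + a ∧ x ∪ y = vset σ := by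
  have key : (x ∪ y).card = k + a := by
    obtain ⟨i, hi, rfl⟩ := mem_getD hx
    obtain ⟨j, hj, rfl⟩ := mem_getD hy
    have hij : i ≠ j := fun hh => hne (by rw [hh])
    have hu := h.2.1
    rcases Nat.lt_or_gt_of_ne hij with h1 | h1
    · exact h.2.2.2 i j h1 (by omega)
    · rw [Finset.union_comm]; exact h.2.2.2 j i h1 (by omega)
  refine ⟨key, Finset.eq_of_subset_of_card_le
    (Finset.union_subset (subset_vset hx) (subset_vset hy)) ?_⟩
  rw [h.2.2.1, key]

theorem link_of {k u a : ℕ} {τ : List (Finset V)} (hal : Allowed τ) (hl : τ.length = u)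
    (hc : (vset τ).card = k + a)
    (hp : ∀ x ∈ τ, ∀ y ∈ τ, x ≠ y → x ∪ y = vset τ) : KLink k u a τ := by
  refine ⟨hal, hl, hc, fun i j hij hj => ?_⟩
  rw [hp _ (getD_mem' (by omega)) _ (getD_mem' (by omega)) ?_, hc]
  intro hh
  have := nodup_getD hal.1 (by omega) (by omega) hh
  omega

/-- No third edge of a link is compatible with the outcome of `core`. -/
theorem link_third {k : ℕ} {E : Finset (Finset V)} (c : Ctx k E) {W e f g : Finset V} {z t : V}
    (he : e ∈ E) (hf : f ∈ E) (hg : g ∈ E) (hef : f ≠ e) (hfe : (f ∩ e).card = k - 1)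
    (hze : z ∈ f) (hte : t ∈ e) (hzt : z ≠ t) (hfW : f ∩ W = {z}) (heW : e ∩ W = {t})
    (hgW : g ⊆ W) (hzg : z ∈ g) (htg : t ∈ g) : False := by
  have hk := c.hk
  have hsub := handle c (Or.inl (op_of (c.unif _ hf) (c.unif _ he) hef (by omega)))
    (mem_pair_E hf he) hg (by
    rw [vset_pair]
    exact two_le_inter hzt hzg (Finset.mem_union_left _ hze) htg (Finset.mem_union_right _ hte))
  rw [vset_pair] at hsub
  obtain ⟨v, hv, n1, n2⟩ := exists_third hk (c.unif _ hg) z t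
  rcases Finset.mem_union.1 (hsub hv) with hh | hh
  · have : v ∈ f ∩ W := Finset.mem_inter.2 ⟨hh, hgW hv⟩
    rw [hfW, Finset.mem_singleton] at this
    exact n1 this
  · have : v ∈ e ∩ W := Finset.mem_inter.2 ⟨hh, hgW hv⟩
    rw [heW, Finset.mem_singleton] at this
    exact n2 this

theorem pasch_data {σ : List (Finset V)} (h : Pasch σ) : ∃ a b d g, σ = [a, b, d, g] ∧
    LooseCycle [a, b, d] ∧ (∀ v ∈ vset σ, v ∉ g → (v ∈ a ∧ v ∈ b) ∨ (v ∈ a ∧ v ∈ d) ∨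
      (v ∈ b ∧ v ∈ d)) ∧ vset [a, b, d] = vset σ ∧ σ.Nodup := by
  obtain ⟨hal, hl, -, h2, h1⟩ := h
  match σ, hl with
  | [a, b, d, g], _ =>
    have hnd := hal.1
    have key : ∀ v ∈ vset [a, b, d, g], ∃ i j, i < j ∧ j < 4 ∧ v ∈ [a, b, d, g].getD i ∅ ∧
        v ∈ [a, b, d, g].getD j ∅ := by
      intro v hv
      obtain ⟨i, j, hij, he⟩ := Finset.card_eq_two.1 (h2 v hv)
      have hi : i ∈ (Finset.range 4).filter fun i => v ∈ [a, b, d, g].getD i ∅ := by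
        rw [he]; simp
      have hj : j ∈ (Finset.range 4).filter fun i => v ∈ [a, b, d, g].getD i ∅ := by
        rw [he]; simp
      rw [Finset.mem_filter, Finset.mem_range] at hi hj
      rcases Nat.lt_or_gt_of_ne hij with h | h
      · exact ⟨i, j, h, hj.1, hi.2, hj.2⟩
      · exact ⟨j, i, h, hi.1, hj.2, hi.2⟩
    have key2 : ∀ v ∈ vset [a, b, d, g], v ∉ g → (v ∈ a ∧ v ∈ b) ∨ (v ∈ a ∧ v ∈ d) ∨
      (v ∈ b ∧ v ∈ d) := by
      intro v hv hg
      obtain ⟨i, j, hij, hj, hi', hj'⟩ := key v hv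
      interval_cases j <;> interval_cases i <;> simp_all
    refine ⟨a, b, d, g, rfl, ?_, key2, ?_, hnd⟩
    · have h01 := h1 0 1 (by omega) (by omega)
      have h12 := h1 1 2 (by omega) (by omega)
      have h02 := h1 0 2 (by omega) (by omega)
      simp at hnd h01 h12 h02
      exact lc3 hnd.1.1 hnd.1.2.1 hnd.2.1.1 h01 h12 h02
    · ext v
      constructor
      · intro hv
        obtain ⟨e, he, hve⟩ := mem_vset.1 hv
        refine mem_vset.2 ⟨e, ?_, hve⟩
        simp only [List.mem_cons, List.not_mem_nil, or_false] at he ⊢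
        tauto
      · intro hv
        obtain ⟨i, j, hij, hj, hi', hj'⟩ := key v hv
        have : i = 0 ∨ i = 1 ∨ i = 2 := by omega
        rcases this with rfl | rfl | rfl
        · exact mem_vset.2 ⟨a, by simp, hi'⟩
        · exact mem_vset.2 ⟨b, by simp, hi'⟩
        · exact mem_vset.2 ⟨d, by simp, hi'⟩

theorem pasch_inside {k : ℕ} {E : Finset (Finset V)} (c : Ctx k E) {σ : List (Finset V)}
    (h : Pasch σ) (hσE : ∀ g ∈ σ, g ∈ E) {e : Finset V} (he : e ∈ E) (heσ : e ∉ σ)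
    (hs : e ⊆ vset σ) : False := by
  obtain ⟨a, b, d, g, rfl, hlc, h2, hv, hnd⟩ := pasch_data h
  have hlc' := inside_lc c hlc (mem_triple_E (hσE a (by simp)) (hσE b (by simp))
    (hσE d (by simp))) he (fun hh => heσ (by
      simp only [List.mem_cons, List.not_mem_nil, or_false] at hh ⊢; tauto)) (by rw [hv]; exact hs)
  obtain ⟨-, -, -, -, hx⟩ := hlc'
  apply heσ
  have : e = g := by
    apply sub_eq (c.unif _ he) (c.unif _ (hσE g (by simp)))
    intro v hve
    by_contra hvg
    simp at hnd
    rcases h2 v (hs hve) hvg with ⟨h1, h2⟩ | ⟨h1, h2⟩ | ⟨h1, h2⟩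
    · exact hx a (by simp) b (by simp) (Ne.symm hnd.1.1) v hve h1 h2
    · exact hx a (by simp) d (by simp) (Ne.symm hnd.1.2.1) v hve h1 h2
    · exact hx b (by simp) d (by simp) (Ne.symm hnd.2.1.1) v hve h1 h2
  rw [this]; simp

theorem cover3 {x y w e : Finset V} (hx : x.card = 3) (h1 : (x ∩ y).card = 1)
    (h2 : (x ∩ w).card = 1) (h3 : (e ∩ x).card = 1) (n1 : ∀ v ∈ x, v ∈ y → v ∉ w)
    (n2 : ∀ v ∈ x, v ∈ y → v ∉ e) (n3 : ∀ v ∈ x, v ∈ w → v ∉ e) :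
    ∀ v ∈ x, v ∈ y ∨ v ∈ w ∨ v ∈ e := by
  have d1 : Disjoint (x ∩ y) (x ∩ w) := by
    rw [Finset.disjoint_left]
    intro v hv hv'
    rw [Finset.mem_inter] at hv hv'
    exact n1 v hv.1 hv.2 hv'.2
  have d2 : Disjoint ((x ∩ y) ∪ (x ∩ w)) (e ∩ x) := by
    rw [Finset.disjoint_left]
    intro v hv hv'
    rw [Finset.mem_union, Finset.mem_inter, Finset.mem_inter] at hv
    rw [Finset.mem_inter] at hv'
    rcases hv with hv | hv
    · exact n2 v hv.1 hv.2 hv'.1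
    · exact n3 v hv.1 hv.2 hv'.1
  have hc := Finset.card_union_of_disjoint d2
  rw [Finset.card_union_of_disjoint d1] at hc
  have : (x ∩ y) ∪ (x ∩ w) ∪ (e ∩ x) = x := by
    apply Finset.eq_of_subset_of_card_le
    · intro v hv
      simp only [Finset.mem_union, Finset.mem_inter] at hv
      tauto
    · omega
  intro v hv
  rw [← this] at hv
  simp only [Finset.mem_union, Finset.mem_inter] at hv
  tauto

theorem pasch_of {x y w e : Finset V} (hal : Allowed [x, y, w, e]) (hx : x.card = 3)
    (hy : y.card = 3)
    (hw : w.card = 3) (hxy : (x ∩ y).card = 1) (hxw : (x ∩ w).card = 1) (hyw : (y ∩ w).card = 1)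
    (hex : (e ∩ x).card = 1) (hey : (e ∩ y).card = 1) (hew : (e ∩ w).card = 1)
    (n0 : ∀ v ∈ x, v ∈ y → v ∉ w)
    (n1 : ∀ v ∈ e, v ∈ x → v ∉ y) (n2 : ∀ v ∈ e, v ∈ x → v ∉ w) (n3 : ∀ v ∈ e, v ∈ y → v ∉ w)
    (hs : e ⊆ x ∪ y ∪ w) : Pasch [x, y, w, e] := by
  have c1 := cover3 (e := e) hx hxy hxw hex n0 (fun v h1 h2 h3 => n1 v h3 h1 h2)
    (fun v h1 h2 h3 => n2 v h3 h1 h2)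
  have c2 := cover3 (e := e) hy (by rwa [Finset.inter_comm]) hyw hey (fun v h1 h2 => n0 v h2 h1)
    (fun v h1 h2 h3 => n1 v h3 h2 h1) (fun v h1 h2 h3 => n3 v h3 h1 h2)
  have c3 := cover3 (e := e) hw (by rwa [Finset.inter_comm]) (by rwa [Finset.inter_comm]) hew
    (fun v h1 h2 h3 => n0 v h2 h3 h1)
    (fun v h1 h2 h3 => n2 v h3 h2 h1) (fun v h1 h2 h3 => n3 v h3 h2 h1)
  have hv : vset [x, y, w, e] = x ∪ y ∪ w := by
    ext v
    have := @hs v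
    simp only [Finset.mem_union] at this
    simp only [vset_cons', vset_nil', Finset.mem_union, Finset.notMem_empty]
    tauto
  refine ⟨hal, rfl, ?_, ?_, ?_⟩
  · rw [hv]
    have e1 := Finset.card_union_add_card_inter x y
    have e2 := Finset.card_union_add_card_inter (x ∪ y) w
    have e3 : Disjoint (x ∩ w) (y ∩ w) := by
      rw [Finset.disjoint_left]
      intro v h1 h2
      rw [Finset.mem_inter] at h1 h2
      exact n0 v h1.1 h2.1 h1.2
    have e4 := Finset.card_union_of_disjoint e3
    rw [Finset.union_inter_distrib_right] at e2
    omega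
  · intro v hvv
    rw [hv] at hvv
    simp only [Finset.mem_union] at hvv
    have c1 := c1 v
    have c2 := c2 v
    have c3 := c3 v
    have n0 := n0 v
    have n1 := n1 v
    have n2 := n2 v
    have n3 := n3 v
    have hr : (Finset.range 4) = {0, 1, 2, 3} := by decide
    rw [hr]
    by_cases hx' : v ∈ x <;> by_cases hy' : v ∈ y <;> by_cases hw' : v ∈ w <;>
      by_cases he' : v ∈ e <;>
      simp_all [Finset.filter_insert, Finset.filter_singleton]
  · intro i j hij hj
    have hex' : (x ∩ e).card = 1 := by rwa [Finset.inter_comm]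
    have hey' : (y ∩ e).card = 1 := by rwa [Finset.inter_comm]
    have hew' : (w ∩ e).card = 1 := by rwa [Finset.inter_comm]
    interval_cases j <;> interval_cases i <;> assumption

theorem allowed_of {l : List (Finset V)} (hn : l.Nodup)
    (h : ∀ i, 0 < i → i < l.length → ∃ j < i, ∃ v, v ∈ l.getD i ∅ ∧ v ∈ l.getD j ∅) :
    Allowed l := by
  refine ⟨hn, fun i h0 hi => ?_⟩
  obtain ⟨j, hj, v, h1, h2⟩ := h i h0 hi
  apply Finset.card_pos.2
  refine ⟨v, Finset.mem_inter.2 ⟨h1, ?_⟩⟩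
  exact mem_vset_take.2 ⟨j, hj, by omega, h2⟩

theorem allowed_take {l : List (Finset V)} (h : Allowed l) (n : ℕ) : Allowed (l.take n) := by
  refine ⟨h.1.sublist (List.take_sublist n l), fun i h0 hi => ?_⟩
  rw [List.length_take] at hi
  have := h.2 i h0 (by omega)
  unfold oldOf at this ⊢
  rwa [getD_take' (by omega), List.take_take, min_eq_left (by omega)]

theorem grow_of_good {l : List (Finset V)} : ∀ (n s : ℕ), s + n ≤ l.length →
    (∀ j, s ≤ j → j < s + n → GoodAt l j) → Grow (vset (l.take s)) ((l.drop s).take n) := by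
  intro n
  induction n with
  | zero => intro s _ _; simp [Grow]
  | succ n ih =>
    intro s hs hg
    have hd : l.drop s = l.getD s ∅ :: l.drop (s + 1) := by
      rw [List.drop_eq_getElem_cons (by omega), List.getD_eq_getElem _ _ (by omega)]
    rw [hd, List.take_succ_cons]
    refine ⟨hg s le_rfl (by omega), ?_⟩
    have := ih (s + 1) (by omega) (fun j h1 h2 => hg j (by omega) (by omega))
    have he : vset (l.take (s + 1)) = vset (l.take s) ∪ l.getD s ∅ := by
      rw [List.take_succ_eq_append_getElem (by omega), vset_append', vset_cons', vset_nil',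
        Finset.union_empty, List.getD_eq_getElem _ _ (by omega)]
    rwa [he] at this

/-- Building the four edge star out of the outcome of `core`. -/
theorem star_of {k : ℕ} (hk : 3 ≤ k) {p1 p2 e f : Finset V} {z t : V}
    (ep1 : p1.card = k) (ep2 : p2.card = k)
    (hp : (p1 ∩ p2).card = k - 1) (hzt : z ≠ t)
    (hf : f ∩ (p1 ∪ p2) = {z}) (he : e ∩ (p1 ∪ p2) = {t}) (hee : e.erase t = f.erase z)
    (h1 : z ∈ p1) (h2 : z ∉ p2) (h3 : t ∈ p2) (h4 : t ∉ p1) (l : List (Finset V))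
    (hl : Allowed l) (hperm : [p1, f, p2, e].Perm l) : StarKU2 k 2 l := by
  have hlen := hperm.length_eq
  have hz : z ∈ f := Finset.mem_of_mem_inter_left (hf ▸ Finset.mem_singleton_self z)
  have ht : t ∈ e := Finset.mem_of_mem_inter_left (he ▸ Finset.mem_singleton_self t)
  have hnd := hperm.nodup_iff.2 hl.1
  have i1 : p1 ∩ f = {z} := by
    ext v
    have := congrArg (fun s => v ∈ s) hf
    simp only [Finset.mem_inter, Finset.mem_union, Finset.mem_singleton, eq_iff_iff] at this ⊢
    constructor
    · tauto
    · rintro rfl; exact ⟨h1, hz⟩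
  have i2 : p2 ∩ e = {t} := by
    ext v
    have := congrArg (fun s => v ∈ s) he
    simp only [Finset.mem_inter, Finset.mem_union, Finset.mem_singleton, eq_iff_iff] at this ⊢
    constructor
    · tauto
    · rintro rfl; exact ⟨h3, ht⟩
  have j1 : p1 ∩ p2 = p1.erase z := by
    apply Finset.eq_of_subset_of_card_le
    · intro v hv
      rw [Finset.mem_inter] at hv
      exact Finset.mem_erase.2 ⟨fun hh => h2 (hh ▸ hv.2), hv.1⟩
    · rw [Finset.card_erase_of_mem h1]; omega
  have j2 : p1 ∩ p2 = p2.erase t := by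
    apply Finset.eq_of_subset_of_card_le
    · intro v hv
      rw [Finset.mem_inter] at hv
      exact Finset.mem_erase.2 ⟨fun hh => h4 (hh ▸ hv.1), hv.2⟩
    · rw [Finset.card_erase_of_mem h3]; omega
  simp at hnd
  refine ⟨hl, hlen.symm, z, t, [p1, f], [p2, e], hzt, rfl, rfl, hperm, ?_, ?_, ?_⟩
  · refine ⟨by simp, by simp [hnd.1.1], by simp [h1, hz], ?_⟩
    intro i j hij hj
    simp at hj
    have : i = 0 := by omega
    have : j = 1 := by omega
    subst i j
    exact i1
  · refine ⟨by simp, by simp [hnd.2.2], by simp [h3, ht], ?_⟩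
    intro i j hij hj
    simp at hj
    have : i = 0 := by omega
    have : j = 1 := by omega
    subst i j
    exact i2
  · intro i hi
    interval_cases i
    · change p1.erase z = p2.erase t
      rw [← j1, ← j2]
    · exact hee.symm

theorem first_kbad {k s : ℕ} {E : Finset (Finset V)} (c : Ctx k E)
    {l : List (Finset V)} (hl : Allowed l) (hlE : l.toFinset = E)
    (hgk : ∀ j, s ≤ j → j < l.length → GoodAt l j ∨ KBadAt k l j)
    (hkb : ∀ j, s + 1 ≤ j → j < l.length → KBadAt k l j →
      KBadAt k l (j - 1) ∨
        ∃ x ∈ l.getD j ∅, x ∈ l.getD (j - 1) ∅ ∧ x ∉ vset (l.take (j - 1)))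
    (hex : ∃ j, s ≤ j ∧ j < l.length ∧ KBadAt k l j) :
    (s < l.length ∧ l.getD s ∅ ∈ E ∧ l.getD s ∅ ∉ l.take s ∧
      l.getD s ∅ ⊆ vset (l.take s)) ∨
    ∃ m, s + 1 ≤ m ∧ m < l.length ∧ ∃ (G : List (Finset V)) (z : V), (∀ g ∈ G, g ∈ E) ∧
      Grow (vset (l.take s)) G ∧ l.getD (m - 1) ∅ ∈ E ∧ l.getD m ∅ ∈ E ∧
      l.getD m ∅ ≠ l.getD (m - 1) ∅ ∧
      l.getD (m - 1) ∅ ∩ (vset (l.take s) ∪ vset G) = {z} ∧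
      l.getD m ∅ ⊆ (vset (l.take s) ∪ vset G) ∪ l.getD (m - 1) ∅ ∧
      ∃ w ∈ l.getD m ∅, w ∉ vset (l.take s) ∪ vset G := by
  classical
  have hE : ∀ g ∈ l, g ∈ E := fun g hg => by rw [← hlE]; exact List.mem_toFinset.2 hg
  have hsub : ∀ j, j < l.length → KBadAt k l j → l.getD j ∅ ⊆ vset (l.take j) := by
    intro j hj hb
    have h1 : l.getD j ∅ ∩ vset (l.take j) = l.getD j ∅ := by
      apply Finset.eq_of_subset_of_card_le Finset.inter_subset_left
      rw [c.unif _ (hE _ (getD_mem' hj))]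
      exact hb.ge
    rw [← h1]; exact Finset.inter_subset_right
  obtain ⟨m, ⟨hm1, hm2, hm3⟩, hmin⟩ : ∃ m, (s ≤ m ∧ m < l.length ∧ KBadAt k l m) ∧
      ∀ j < m, ¬ (s ≤ j ∧ j < l.length ∧ KBadAt k l j) :=
    ⟨Nat.find hex, Nat.find_spec hex, fun j hj => Nat.find_min hex hj⟩
  rcases Nat.eq_or_lt_of_le hm1 with rfl | hlt
  · left
    refine ⟨hm2, hE _ (getD_mem' hm2), ?_, hsub _ hm2 hm3⟩
    intro hh
    obtain ⟨i, hi, he⟩ := mem_getD hh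
    rw [List.length_take] at hi
    rw [getD_take' (by omega)] at he
    have := nodup_getD hl.1 (by omega) hm2 he
    omega
  · right
    obtain ⟨n, rfl⟩ : ∃ n, m = s + n + 1 := ⟨m - s - 1, by omega⟩
    have hgood : ∀ j, s ≤ j → j < s + n + 1 → GoodAt l j := by
      intro j h1 h2
      rcases hgk j h1 (by omega) with h | h
      · exact h
      · exact absurd ⟨h1, by omega, h⟩ (hmin j h2)
    have hv : vset (l.take (s + n)) = vset (l.take s) ∪ vset ((l.drop s).take n) := by
      rw [List.take_add, vset_append']
    have hv1 : vset (l.take (s + n + 1)) = vset (l.take (s + n)) ∪ l.getD (s + n) ∅ := by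
      rw [List.take_succ_eq_append_getElem (by omega), vset_append', vset_cons', vset_nil',
        Finset.union_empty, List.getD_eq_getElem _ _ (by omega)]
    obtain ⟨z, hz⟩ := Finset.card_eq_one.1 (hgood (s + n) (by omega) (by omega))
    refine ⟨s + n + 1, by omega, hm2, (l.drop s).take n, z, ?_, ?_, ?_, ?_, ?_, ?_, ?_, ?_⟩
    · intro g hg
      exact hE g (List.mem_of_mem_drop (List.mem_of_mem_take hg))
    · exact grow_of_good n s (by omega) (fun j h1 h2 => hgood j h1 (by omega))
    · exact hE _ (getD_mem' (by omega))
    · exact hE _ (getD_mem' (by omega))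
    · intro hh
      have := nodup_getD hl.1 hm2 (by omega) hh
      omega
    · rw [← hv]; exact hz
    · rw [← hv]
      have := hsub _ hm2 hm3
      rwa [hv1] at this
    · rcases hkb _ (by omega) hm2 hm3 with h | ⟨x, h1, h2, h3⟩
      · exact absurd ⟨by omega, by omega, h⟩ (hmin (s + n) (by omega))
      · exact ⟨x, h1, by rw [← hv]; exact h3⟩

section
variable {k s : ℕ} {E : Finset (Finset V)} {σ l : List (Finset V)}

/-- The first alternative. -/
def Alt1 (k s : ℕ) (σ l : List (Finset V)) : Prop :=
  ∃ j, s + 1 ≤ j ∧ j < l.length ∧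
    StarKU2 k 2 [l.getD 0 ∅, l.getD 1 ∅, l.getD (j - 1) ∅, l.getD j ∅] ∧
    (OverlapPair k σ ∨
      (4 ≤ s ∧ (∃ u, s = 2 * u ∧ StarKU2 k u σ) ∧
        StarKU2 k (s / 2 + 1) (l.take s ++ [l.getD (j - 1) ∅, l.getD j ∅])))

/-- The second alternative. -/
def Alt2 (k s : ℕ) (σ l : List (Finset V)) : Prop :=
  KLink k 3 ((l.getD 0 ∅ \ l.getD 1 ∅).card) [l.getD 0 ∅, l.getD 1 ∅, l.getD s ∅] ∧
    (OverlapPair k σ ∨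
      (3 ≤ s ∧ KLink k s ((l.getD 0 ∅ \ l.getD 1 ∅).card) σ ∧
        KLink k (s + 1) ((l.getD 0 ∅ \ l.getD 1 ∅).card) (l.take (s + 1))))

/-- The third alternative. -/
def Alt3 (k s : ℕ) (σ l : List (Finset V)) : Prop :=
  LooseCycle σ ∧ s = 3 ∧ k = 3 ∧ Pasch (l.take 4)

/-- The first edges of the order are the edges of the configuration. -/
theorem take_mem (hstart : (l.take s).toFinset = σ.toFinset) (g : Finset V) :
    g ∈ l.take s ↔ g ∈ σ := by
  rw [← List.mem_toFinset, hstart, List.mem_toFinset]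

theorem l_in_E (hlE : l.toFinset = E) {i : ℕ} (hi : i < l.length) : l.getD i ∅ ∈ E := by
  rw [← hlE]; exact List.mem_toFinset.2 (getD_mem' hi)

theorem l_in_σ (hstart : (l.take s).toFinset = σ.toFinset) (hs : s ≤ l.length) {i : ℕ}
    (hi : i < s) : l.getD i ∅ ∈ σ := by
  rw [← take_mem hstart, ← getD_take' hi]
  exact getD_mem' (by rw [List.length_take]; omega)

theorem l_ne (hl : Allowed l) {i j : ℕ} (hij : i ≠ j) (hi : i < l.length) (hj : j < l.length) :
    l.getD i ∅ ≠ l.getD j ∅ := fun h => hij (nodup_getD hl.1 hi hj h)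

theorem card_sdiff_pair {k a : ℕ} {x y : Finset V} (hy : y.card = k)
    (h : (x ∪ y).card = k + a) : (x \ y).card = a := by
  have := Finset.card_sdiff_add_card x y
  omega

/-- A new edge inside a family all of whose pairs have the same union extends the link. -/
theorem link_extend {a : ℕ} (c : Ctx k E) (hl : Allowed l) (hlE : l.toFinset = E)
    (hs2 : 2 ≤ s) (hs : s < l.length)
    (hc : (vset (l.take s)).card = k + a)
    (hp : ∀ x ∈ l.take s, ∀ y ∈ l.take s, x ≠ y → OverlapPair k [x, y] ∧ x ∪ y = vset (l.take s))
    (hsub : l.getD s ∅ ⊆ vset (l.take s)) :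
    (l.getD 0 ∅ \ l.getD 1 ∅).card = a ∧ KLink k 3 a [l.getD 0 ∅, l.getD 1 ∅, l.getD s ∅] ∧
      KLink k (s + 1) a (l.take (s + 1)) := by
  have mem : ∀ i < s, l.getD i ∅ ∈ l.take s := by
    intro i hi
    rw [← getD_take' hi]
    exact getD_mem' (by rw [List.length_take]; omega)
  have htE : ∀ g ∈ l.take s, g ∈ E := fun g hg => by
    rw [← hlE]; exact List.mem_toFinset.2 (List.mem_of_mem_take hg)
  have heE := l_in_E hlE hs
  have n01 := l_ne hl (i := 0) (j := 1) (by omega) (by omega) (by omega)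
  have n0 := l_ne hl (i := 0) (j := s) (by omega) (by omega) (by omega)
  have n1 := l_ne hl (i := 1) (j := s) (by omega) (by omega) (by omega)
  have hu01 := (hp _ (mem 0 (by omega)) _ (mem 1 (by omega)) n01)
  have hnotin : l.getD s ∅ ∉ l.take s := by
    intro hh
    obtain ⟨i, hi, he⟩ := mem_getD hh
    rw [List.length_take] at hi
    rw [getD_take' (by omega)] at he
    exact l_ne hl (by omega) (by omega) hs he
  have key : ∀ x ∈ l.take s, x ∪ l.getD s ∅ = vset (l.take s) := by
    intro x hx
    obtain ⟨y, hy, hxy⟩ : ∃ y ∈ l.take s, x ≠ y := by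
      by_cases h : x = l.getD 0 ∅
      · exact ⟨_, mem 1 (by omega), h ▸ n01⟩
      · exact ⟨_, mem 0 (by omega), h⟩
    obtain ⟨ho, hu⟩ := hp x hx y hy hxy
    rw [← hu]
    exact inside_op c ho (htE _ hx) (htE _ hy) heE (fun h => hnotin (h ▸ hx)) (hu ▸ hsub)
  refine ⟨?_, ?_, ?_⟩
  · exact card_sdiff_pair (c.unif _ (htE _ (mem 1 (by omega)))) (by rw [hu01.2, hc])
  · have hv : vset [l.getD 0 ∅, l.getD 1 ∅, l.getD s ∅] = vset (l.take s) := by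
      rw [vset_triple, hu01.2]
      exact Finset.union_eq_left.2 hsub
    have ho := op_iff.1 hu01.1
    have hk := c.hk
    apply link_of
    · apply allowed_of
      · simp
        exact ⟨⟨n01, n0⟩, n1⟩
      · intro i h0 hi
        simp only [List.length_cons, List.length_nil] at hi
        have : i = 1 ∨ i = 2 := by omega
        rcases this with rfl | rfl
        · obtain ⟨v, hv⟩ := Finset.card_pos.1 (by omega : 0 < (l.getD 0 ∅ ∩ l.getD 1 ∅).card)
          rw [Finset.mem_inter] at hv
          exact ⟨0, by omega, v, hv.2, hv.1⟩
        · have : (l.getD s ∅).Nonempty := Finset.card_pos.1 (by rw [c.unif _ heE]; omega)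
          obtain ⟨v, hv'⟩ := this
          have := hsub hv'
          rw [← hu01.2, Finset.mem_union] at this
          rcases this with h | h
          · exact ⟨0, by omega, v, hv', h⟩
          · exact ⟨1, by omega, v, hv', h⟩
    · rfl
    · rw [hv, hc]
    · rw [hv]
      have k0 := key _ (mem 0 (by omega))
      have k1 := key _ (mem 1 (by omega))
      intro x hx y hy hxy
      simp only [List.mem_cons, List.not_mem_nil, or_false] at hx hy
      rcases hx with rfl | rfl | rfl <;> rcases hy with rfl | rfl | rfl <;>
        first
        | exact absurd rfl hxy
        | assumption
        | exact hu01.2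
        | (rw [Finset.union_comm]; first | assumption | exact hu01.2)
  · have hmem : ∀ g, g ∈ l.take (s + 1) ↔ g ∈ l.take s ∨ g = l.getD s ∅ := by
      intro g
      rw [List.take_succ_eq_append_getElem hs, List.mem_append, List.mem_singleton,
        List.getD_eq_getElem _ _ hs]
    have hv : vset (l.take (s + 1)) = vset (l.take s) := by
      rw [List.take_succ_eq_append_getElem hs, vset_append', vset_cons', vset_nil',
        Finset.union_empty]
      rw [List.getD_eq_getElem _ _ hs] at hsub
      exact Finset.union_eq_left.2 hsub
    apply link_of (allowed_take hl _)
    · rw [List.length_take]; omega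
    · rw [hv, hc]
    · rw [hv]
      intro x hx y hy hxy
      rcases (hmem x).1 hx with hx | hx <;> rcases (hmem y).1 hy with hy | hy
      · exact (hp x hx y hy hxy).2
      · rw [hy]; exact key x hx
      · rw [hx, Finset.union_comm]; exact key y hy
      · exact absurd (hx.trans hy.symm) hxy

end

section
variable {k s : ℕ} {E : Finset (Finset V)} {σ l : List (Finset V)}

/-- Overlaps of the edges of a link. -/
theorem link_op {a : ℕ} (c : Ctx k E) (h3 : 3 ≤ s) (ha : 1 ≤ a) (hak : a ≤ k / (s - 1))
    (h : KLink k s a σ) (hσE : ∀ g ∈ σ, g ∈ E) {x y : Finset V} (hx : x ∈ σ) (hy : y ∈ σ)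
    (hne : x ≠ y) : OverlapPair k [x, y] ∧ x ∪ y = vset σ := by
  obtain ⟨h1, h2⟩ := link_pair h hx hy hne
  refine ⟨?_, h2⟩
  have hk := c.hk
  have : a ≤ k / 2 := hak.trans (Nat.div_le_div_left (by omega) (by omega))
  have cx := c.unif _ (hσE _ hx)
  have cy := c.unif _ (hσE _ hy)
  have := Finset.card_union_add_card_inter x y
  exact op_of cx cy hne (by omega)

theorem exists_inside (c : Ctx k E) (hσ : SConfig k s σ) (hl : Allowed l) (hlE : l.toFinset = E)
    (hstart : (l.take s).toFinset = σ.toFinset) (hs : s < l.length)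
    (hsub : l.getD s ∅ ⊆ vset (l.take s)) (hnot : l.getD s ∅ ∉ l.take s) :
    Alt1 k s σ l ∨ Alt2 k s σ l ∨ Alt3 k s σ l := by
  have hmem := take_mem hstart
  have hv : vset (l.take s) = vset σ := vset_congr hmem
  have hσE : ∀ g ∈ σ, g ∈ E := fun g hg => by
    rw [← hlE]; exact List.mem_toFinset.2 (List.mem_of_mem_take ((hmem g).2 hg))
  have heE := l_in_E hlE hs
  have hin := fun {i : ℕ} (hi : i < s) => l_in_σ hstart hs.le hi
  obtain ⟨hlen, hO | hC | ⟨h4, u, hu, hst⟩ | ⟨h3, a, ha, hak, hlk⟩ | ⟨hk3, hPa⟩⟩ := hσ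
  · right; left
    obtain ⟨p, q, rfl, hne, h2, hk1⟩ := hO
    simp only [List.length_cons, List.length_nil] at hlen
    have hO : OverlapPair k [p, q] := op_iff.2 ⟨hne, h2, hk1⟩
    have cp := c.unif p (hσE p (by simp))
    have cq := c.unif q (hσE q (by simp))
    have hcard : (vset (l.take s)).card = k + (k - (p ∩ q).card) := by
      rw [hv, vset_pair]
      have := Finset.card_union_add_card_inter p q
      omega
    obtain ⟨e1, e2, -⟩ := link_extend c hl hlE (by omega) hs hcard (by
      intro x hx y hy hxy
      rw [hmem] at hx hy
      simp only [List.mem_cons, List.not_mem_nil, or_false] at hx hy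
      rw [hv, vset_pair]
      rcases hx with rfl | rfl <;> rcases hy with rfl | rfl
      · exact absurd rfl hxy
      · exact ⟨hO, rfl⟩
      · exact ⟨op_symm hO, Finset.union_comm _ _⟩
      · exact absurd rfl hxy) hsub
    refine ⟨?_, Or.inl hO⟩
    rw [e1]; exact e2
  · right; right
    obtain ⟨h3, hk3, hND, hone, hsep⟩ := inside_lc c hC hσE heE (by rwa [← hmem]) (by rwa [← hv])
    have hs3 : s = 3 := by omega
    subst hs3
    refine ⟨hC, rfl, hk3, ?_⟩
    have htk : l.take 4 = [l.getD 0 ∅, l.getD 1 ∅, l.getD 2 ∅, l.getD 3 ∅] := by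
      match l, hs with
      | x :: y :: w :: e :: r, _ => simp
    have hal := allowed_take hl 4
    have n01 := l_ne hl (i := 0) (j := 1) (by omega) (by omega) (by omega)
    have n02 := l_ne hl (i := 0) (j := 2) (by omega) (by omega) (by omega)
    have n12 := l_ne hl (i := 1) (j := 2) (by omega) (by omega) (by omega)
    have m0 := hin (i := 0) (by omega)
    have m1 := hin (i := 1) (by omega)
    have m2 := hin (i := 2) (by omega)
    have hinter : ∀ x ∈ σ, ∀ y ∈ σ, x ≠ y → (x ∩ y).card = 1 := by
      intro x hx y hy hxy
      obtain ⟨i, hi, rfl⟩ := mem_getD hx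
      obtain ⟨j, hj, rfl⟩ := mem_getD hy
      have hij : i ≠ j := fun h => hxy (by rw [h])
      rcases Nat.lt_or_gt_of_ne hij with h | h
      · rw [hC.2.2 i j h hj, if_pos (by omega)]
      · rw [Finset.inter_comm, hC.2.2 j i h hi, if_pos (by omega)]
    rw [htk] at hal ⊢
    refine pasch_of hal ?_ ?_ ?_ (hinter _ m0 _ m1 n01) (hinter _ m0 _ m2 n02) (hinter _ m1 _ m2 n12)
      (hone _ m0) (hone _ m1) (hone _ m2) ?_ ?_ ?_ ?_ ?_
    · rw [← hk3]; exact c.unif _ (hσE _ m0)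
    · rw [← hk3]; exact c.unif _ (hσE _ m1)
    · rw [← hk3]; exact c.unif _ (hσE _ m2)
    · intro v h1 h2
      exact hND _ m0 _ m1 _ m2 n01 n02 n12 v h1 h2
    · exact hsep _ m0 _ m1 n01.symm
    · exact hsep _ m0 _ m2 n02.symm
    · exact hsep _ m1 _ m2 n12.symm
    · intro v hvv
      obtain ⟨i, h1, h2, h3⟩ := mem_vset_take.1 (hsub hvv)
      rw [Finset.mem_union, Finset.mem_union]
      interval_cases i
      · exact Or.inl (Or.inl h3)
      · exact Or.inl (Or.inr h3)
      · exact Or.inr h3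
  · exfalso
    obtain ⟨-, c1, c2, a1, b1, a2, b2, hS, hp⟩ := star_u2 c hσE (by omega) hst
    have mm : ∀ g, g ∈ σ ↔ g = a1 ∨ g = b1 ∨ g = a2 ∨ g = b2 := fun g => by
      rw [← hp.mem_iff]; simp
    have hn : ¬ (l.getD s ∅ = a1 ∨ l.getD s ∅ = b1 ∨ l.getD s ∅ = a2 ∨ l.getD s ∅ = b2) := by
      rw [← mm, ← hmem]; exact hnot
    push Not at hn
    refine hS.inside c (hσE _ ((mm _).2 (by simp))) (hσE _ ((mm _).2 (by simp)))
      (hσE _ ((mm _).2 (by simp))) (hσE _ ((mm _).2 (by simp))) heE hn.1 hn.2.2.1 hn.2.1 hn.2.2.2 ?_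
    intro v hvv
    have := hsub hvv
    rw [hv] at this
    obtain ⟨g, hg, hvg⟩ := mem_vset.1 this
    simp only [Finset.mem_union]
    rcases (mm g).1 hg with rfl | rfl | rfl | rfl <;> tauto
  · right; left
    obtain ⟨e1, e2, e3⟩ := link_extend (a := a) c hl hlE (by omega) hs (by rw [hv, hlk.2.2.1]) (by
      intro x hx y hy hxy
      rw [hmem] at hx hy
      rw [hv]
      exact link_op c h3 ha hak hlk hσE hx hy hxy) hsub
    refine ⟨?_, Or.inr ⟨h3, ?_, ?_⟩⟩
    · rw [e1]; exact e2
    · rw [e1]; exact hlk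
    · rw [e1]; exact e3
  · exfalso
    exact pasch_inside c hPa hσE heE (by rwa [← hmem]) (by rwa [← hv])

theorem exists_outside (c : Ctx k E) (hσ : SConfig k s σ) (hl : Allowed l) (hlE : l.toFinset = E)
    (hstart : (l.take s).toFinset = σ.toFinset)
    {m : ℕ} (hm1 : s + 1 ≤ m) (hm2 : m < l.length) {G : List (Finset V)} {z : V}
    (hGE : ∀ g ∈ G, g ∈ E) (hGr : Grow (vset (l.take s)) G) (hf : l.getD (m - 1) ∅ ∈ E)
    (he : l.getD m ∅ ∈ E) (hef : l.getD m ∅ ≠ l.getD (m - 1) ∅)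
    (hz : l.getD (m - 1) ∅ ∩ (vset (l.take s) ∪ vset G) = {z})
    (hsub : l.getD m ∅ ⊆ (vset (l.take s) ∪ vset G) ∪ l.getD (m - 1) ∅)
    (hnew : ∃ w ∈ l.getD m ∅, w ∉ vset (l.take s) ∪ vset G) : Alt1 k s σ l := by
  have hmem := take_mem hstart
  have hv : vset (l.take s) = vset σ := vset_congr hmem
  have hσE : ∀ g ∈ σ, g ∈ E := fun g hg => by
    rw [← hlE]; exact List.mem_toFinset.2 (List.mem_of_mem_take ((hmem g).2 hg))
  have hin := fun {i : ℕ} (hi : i < s) => l_in_σ hstart (by omega) hi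
  have hk := c.hk
  rw [hv] at hGr hz hsub hnew
  have long : ∀ P : List (Finset V), LooseCycle P → (∀ g ∈ P, g ∈ E) → vset P = vset σ →
      False := by
    intro P hP hPE hPv
    obtain ⟨p1, p2, t, rfl, -⟩ := core c (Or.inr hP) hPE hGE (by rwa [hPv]) he hf hef
      (by rwa [hPv]) (by rwa [hPv]) (by rwa [hPv])
    have := hP.1
    simp at this
  obtain ⟨hlen, hO | hC | ⟨h4, u, hu, hst⟩ | ⟨h3, a, ha, hak, hlk⟩ | ⟨hk3, hPa⟩⟩ := hσ
  · obtain ⟨p1, p2, t, rfl, hO', hp, hfe, hte, hzf, hze, htf, hzt, hfP, heP, -, hee, hor⟩ :=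
      core c (Or.inl hO) hσE hGE hGr he hf hef hz hsub hnew
    simp only [List.length_cons, List.length_nil] at hlen
    have hs2 : s = 2 := by omega
    subst hs2
    refine ⟨m, hm1, hm2, ?_, Or.inl hO⟩
    have n01 := l_ne hl (i := 0) (j := 1) (by omega) (by omega) (by omega)
    have m0 := hin (i := 0) (by omega)
    have m1 := hin (i := 1) (by omega)
    have hperm2 : [l.getD 0 ∅, l.getD 1 ∅].Perm [p1, p2] := by
      simp only [List.mem_cons, List.not_mem_nil, or_false] at m0 m1
      rcases m0 with h0 | h0 <;> rcases m1 with h1 | h1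
      · exact absurd (h0.trans h1.symm) n01
      · rw [h0, h1]
      · rw [h0, h1]; exact List.Perm.swap _ _ _
      · exact absurd (h0.trans h1.symm) n01
    rw [vset_pair] at hfP heP
    have hal : Allowed [l.getD 0 ∅, l.getD 1 ∅, l.getD (m - 1) ∅, l.getD m ∅] := by
      apply allowed_of
      · simp
        exact ⟨⟨n01, l_ne hl (by omega) (by omega) (by omega),
          l_ne hl (by omega) (by omega) (by omega)⟩,
          ⟨l_ne hl (by omega) (by omega) (by omega), l_ne hl (by omega) (by omega) (by omega)⟩,
          l_ne hl (by omega) (by omega) (by omega)⟩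
      · have old : ∀ v ∈ p1 ∪ p2, v ∈ l.getD 0 ∅ ∨ v ∈ l.getD 1 ∅ := by
          intro v hvv
          rw [← vset_pair, ← hv] at hvv
          obtain ⟨i, h1, h2, h3⟩ := mem_vset_take.1 hvv
          interval_cases i
          · exact Or.inl h3
          · exact Or.inr h3
        have hzP : z ∈ p1 ∪ p2 := Finset.mem_of_mem_inter_right (hfP ▸ Finset.mem_singleton_self z)
        have htP : t ∈ p1 ∪ p2 := Finset.mem_of_mem_inter_right (heP ▸ Finset.mem_singleton_self t)
        intro i h0 hi
        simp only [List.length_cons, List.length_nil] at hi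
        interval_cases i
        · have hne : (p1 ∩ p2).Nonempty := Finset.card_pos.1 (by omega)
          obtain ⟨v, hvv⟩ := hne
          rw [Finset.mem_inter] at hvv
          refine ⟨0, by omega, v, ?_⟩
          change v ∈ l.getD 1 ∅ ∧ v ∈ l.getD 0 ∅
          simp only [List.mem_cons, List.not_mem_nil, or_false] at m0 m1
          rcases m0 with h0 | h0 <;> rcases m1 with h1 | h1 <;> rw [h0, h1] <;> tauto
        · rcases old z hzP with h | h
          · exact ⟨0, by omega, z, hzf, h⟩
          · exact ⟨1, by omega, z, hzf, h⟩
        · rcases old t htP with h | h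
          · exact ⟨0, by omega, t, hte, h⟩
          · exact ⟨1, by omega, t, hte, h⟩
    have cp1 := c.unif p1 (hσE _ (by simp))
    have cp2 := c.unif p2 (hσE _ (by simp))
    rcases hor with ⟨h1, h2, h3, h4⟩ | ⟨h1, h2, h3, h4⟩
    · refine star_of hk cp1 cp2 hp hzt hfP heP hee h1 h2 h3 h4 _ hal ?_
      refine List.Perm.trans ?_ (hperm2.symm.append_right [l.getD (m - 1) ∅, l.getD m ∅])
      exact List.Perm.cons _ (List.Perm.swap _ _ _)
    · refine star_of hk cp2 cp1 (by rwa [Finset.inter_comm]) hzt (by rwa [Finset.union_comm])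
        (by rwa [Finset.union_comm]) hee h1 h2 h3 h4 _ hal ?_
      refine List.Perm.trans ?_ (hperm2.symm.append_right [l.getD (m - 1) ∅, l.getD m ∅])
      refine List.Perm.trans ?_ (List.Perm.swap _ _ _)
      exact List.Perm.cons _ (List.Perm.swap _ _ _)
  · exact (long σ hC hσE rfl).elim
  · exfalso
    obtain ⟨-, c1, c2, a1, b1, a2, b2, hS, hp⟩ := star_u2 c hσE (by omega) hst
    have mm : ∀ g, g ∈ σ ↔ g = a1 ∨ g = b1 ∨ g = a2 ∨ g = b2 := fun g => by
      rw [← hp.mem_iff]; simp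
    have ea1 := hσE a1 ((mm _).2 (by simp))
    have eb1 := hσE b1 ((mm _).2 (by simp))
    have ea2 := hσE a2 ((mm _).2 (by simp))
    have eb2 := hσE b2 ((mm _).2 (by simp))
    have hvv : vset σ = vset [a1, a2] ∪ b1 := by
      rw [vset_pair]
      ext v
      constructor
      · intro hh
        obtain ⟨g, hg, hvg⟩ := mem_vset.1 hh
        simp only [Finset.mem_union]
        rcases (mm g).1 hg with rfl | rfl | rfl | rfl
        · tauto
        · tauto
        · tauto
        · by_cases hv2 : v = c2
          · left; right; rw [hv2]; exact hS.ma2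
          · right
            exact (hS.swapAB.mem_iff (fun h => hS.nb2 (h ▸ hvg)) hv2).2 hvg
      · intro hh
        simp only [Finset.mem_union] at hh
        rcases hh with (hh | hh) | hh
        · exact mem_vset.2 ⟨a1, (mm _).2 (by simp), hh⟩
        · exact mem_vset.2 ⟨a2, (mm _).2 (by simp), hh⟩
        · exact mem_vset.2 ⟨b1, (mm _).2 (by simp), hh⟩
    have hvF : vset [a1, a2] ∪ vset (b1 :: G) = vset σ ∪ vset G := by
      rw [hvv, Finset.union_assoc, vset_cons' b1 G]
    have hb1P : b1 ∩ vset [a1, a2] = {c1} := by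
      rw [vset_pair, Finset.inter_union_distrib_left, Finset.inter_comm, hS.i1, hS.swapAB.disj,
        Finset.union_empty]
    obtain ⟨p1, p2, t, hpp, hO', hp, hfe, hte, hzf, hze, htf, hzt, hfP, heP, heW, hee, hor⟩ :=
      core c (P := [a1, a2]) (F := b1 :: G) (Or.inl (hS.op_a c ea1 ea2)) (mem_pair_E ea1 ea2)
        (by
          intro g hg
          rcases List.mem_cons.1 hg with rfl | hg
          · exact eb1
          · exact hGE g hg)
        ⟨by rw [hb1P]; simp, by rwa [← hvv]⟩ he hf hef (by rwa [hvF]) (by rwa [hvF])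
        (by rwa [hvF])
    simp only [List.cons.injEq, and_true] at hpp
    obtain ⟨rfl, rfl⟩ := hpp
    have sing : ∀ {x : V} {g h : Finset V}, g ∩ (vset σ ∪ vset G) = {x} → x ∈ h → h ∈ σ →
        g ∩ h = {x} := by
      intro x g h h1 h2 h3
      ext v
      rw [Finset.mem_inter, Finset.mem_singleton]
      constructor
      · rintro ⟨ha, hb⟩
        rw [← Finset.mem_singleton, ← h1]
        exact Finset.mem_inter.2 ⟨ha, Finset.mem_union_left _ (subset_vset h3 hb)⟩
      · rintro rfl
        have : v ∈ g ∩ (vset σ ∪ vset G) := by rw [h1]; simp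
        exact ⟨Finset.mem_of_mem_inter_left this, h2⟩
    have c2W : c2 ∈ vset σ ∪ vset G :=
      Finset.mem_union_left _ (subset_vset ((mm a2).2 (by simp)) hS.ma2)
    have only : ∀ v, v ∈ a1 → v ∉ a2 → v = c1 := by
      intro v h1 h2
      by_contra hn
      exact h2 ((hS.mem_iff hn (fun h => hS.na1 (h ▸ h1))).1 h1)
    rw [hvF] at heW
    rcases hor with ⟨h1, h2, h3, h4⟩ | ⟨h1, h2, h3, h4⟩
    · have := only z h1 h2
      subst this
      refine hS.third c ea1 ea2 eb1 hf ?_ (sing hz hS.ma1 ((mm _).2 (by simp)))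
        (sing hz hS.mb1 ((mm _).2 (by simp)))
      intro hh
      have : c2 ∈ ({z} : Finset V) := by rw [← hz]; exact Finset.mem_inter.2 ⟨hh, c2W⟩
      exact hS.hc (Finset.mem_singleton.1 this).symm
    · have := only t h3 h4
      subst this
      refine hS.third c ea1 ea2 eb1 he ?_ (sing heW hS.ma1 ((mm _).2 (by simp)))
        (sing heW hS.mb1 ((mm _).2 (by simp)))
      intro hh
      have : c2 ∈ ({t} : Finset V) := by rw [← heW]; exact Finset.mem_inter.2 ⟨hh, c2W⟩
      exact hS.hc (Finset.mem_singleton.1 this).symm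
  · exfalso
    have m0 := hin (i := 0) (by omega)
    have m1 := hin (i := 1) (by omega)
    have m2 := hin (i := 2) (by omega)
    have n01 := l_ne hl (i := 0) (j := 1) (by omega) (by omega) (by omega)
    have n02 := l_ne hl (i := 0) (j := 2) (by omega) (by omega) (by omega)
    have n12 := l_ne hl (i := 1) (j := 2) (by omega) (by omega) (by omega)
    obtain ⟨o1, u1⟩ := link_op c h3 ha hak hlk hσE m0 m1 n01
    obtain ⟨-, u2⟩ := link_op c h3 ha hak hlk hσE m0 m2 n02
    obtain ⟨-, u3⟩ := link_op c h3 ha hak hlk hσE m1 m2 n12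
    have hP : vset [l.getD 0 ∅, l.getD 1 ∅] = vset σ := by rw [vset_pair, u1]
    obtain ⟨p1, p2, t, hpp, hO', hp, hfe, hte, hzf, hze, htf, hzt, hfP, heP, heW, hee, hor⟩ :=
      core c (P := [l.getD 0 ∅, l.getD 1 ∅]) (Or.inl o1) (mem_pair_E (hσE _ m0) (hσE _ m1))
        hGE (by rwa [hP]) he hf hef (by rwa [hP]) (by rwa [hP]) (by rwa [hP])
    simp only [List.cons.injEq, and_true] at hpp
    have hin2 : ∀ v ∈ vset σ, v ∉ l.getD 0 ∅ ∨ v ∉ l.getD 1 ∅ → v ∈ l.getD 2 ∅ := by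
      intro v hvσ hh
      rcases hh with hh | hh
      · rw [← u2, Finset.mem_union] at hvσ; tauto
      · rw [← u3, Finset.mem_union] at hvσ; tauto
    rw [hP] at hfP heP
    have hzσ : z ∈ vset σ := Finset.mem_of_mem_inter_right (hfP ▸ Finset.mem_singleton_self z)
    have htσ : t ∈ vset σ := Finset.mem_of_mem_inter_right (heP ▸ Finset.mem_singleton_self t)
    refine link_third c he hf (hσE _ m2) hef.symm hfe hzf hte hzt hfP heP (subset_vset m2)
      (hin2 z hzσ ?_) (hin2 t htσ ?_)
    · rw [hpp.1, hpp.2]; tauto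
    · rw [hpp.1, hpp.2]; tauto
  · exfalso
    obtain ⟨a, b, d, g, rfl, hlc, -, hv', -⟩ := pasch_data hPa
    exact long _ hlc (mem_triple_E (hσE _ (by simp)) (hσE _ (by simp)) (hσE _ (by simp))) hv'

end

section
variable {k s : ℕ} {E : Finset (Finset V)} {σ l : List (Finset V)}

theorem star_link_false (c : Ctx k E) {c1 c2 : V} {a1 b1 a2 b2 x y g : Finset V}
    (hS : Star4 c1 c2 a1 b1 a2 b2) (ea1 : a1 ∈ E) (ea2 : a2 ∈ E) (eb1 : b1 ∈ E) (eb2 : b2 ∈ E)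
    (E2 : g ∈ E) (n01 : x ≠ y) (hov : 2 ≤ (x ∩ y).card)
    (q0 : x = a1 ∨ x = b1 ∨ x = a2 ∨ x = b2) (q1 : y = a1 ∨ y = b1 ∨ y = a2 ∨ y = b2)
    (hg2 : g ⊆ x ∪ y) (u02 : x ∪ g = x ∪ y) (u12 : y ∪ g = x ∪ y) : False := by
  have only0 : ∀ v, v ∈ x → v ∉ y → v ∈ g := by
    intro v hx hy
    have : v ∈ y ∪ g := by rw [u12]; exact Finset.mem_union_left _ hx
    rw [Finset.mem_union] at this; tauto
  have only1 : ∀ v, v ∈ y → v ∉ x → v ∈ g := by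
    intro v hx hy
    have : v ∈ x ∪ g := by rw [u02]; exact Finset.mem_union_right _ hx
    rw [Finset.mem_union] at this; tauto
  have fin : ∀ {c1 c2 : V} {b1 b2 : Finset V}, Star4 c1 c2 x b1 y b2 → b1 ∈ E → b2 ∈ E →
      False := fun h hb1 hb2 =>
    h.no_both c hb1 hb2 E2 (only0 _ h.ma1 h.na2) (only1 _ h.ma2 h.na1) hg2
  have d1 := hS.disj
  have d2 := hS.swapAB.disj
  rcases q0 with rfl | rfl | rfl | rfl <;> rcases q1 with rfl | rfl | rfl | rfl
  · exact n01 rfl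
  · rw [hS.i1] at hov; simp at hov
  · exact fin hS eb1 eb2
  · rw [d1] at hov; simp at hov
  · rw [Finset.inter_comm, hS.i1] at hov; simp at hov
  · exact n01 rfl
  · rw [d2] at hov; simp at hov
  · exact fin hS.swapAB ea1 ea2
  · exact fin hS.swap12 eb2 eb1
  · rw [Finset.inter_comm, d2] at hov; simp at hov
  · exact n01 rfl
  · rw [hS.i2] at hov; simp at hov
  · rw [Finset.inter_comm, d1] at hov; simp at hov
  · exact fin hS.swapAB.swap12 ea2 ea1
  · rw [Finset.inter_comm, hS.i2] at hov; simp at hov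
  · exact n01 rfl

theorem not_12 (c : Ctx k E) (hσ : SConfig k s σ) (hlE : l.toFinset = E)
    (hstart : (l.take s).toFinset = σ.toFinset) (hs : s < l.length)
    (h1 : Alt1 k s σ l) (h2 : Alt2 k s σ l) : False := by
  have hmem := take_mem hstart
  have hσE : ∀ g ∈ σ, g ∈ E := fun g hg => by
    rw [← hlE]; exact List.mem_toFinset.2 (List.mem_of_mem_take ((hmem g).2 hg))
  have hin := fun {i : ℕ} (hi : i < s) => l_in_σ hstart (by omega) hi
  have hk := c.hk
  have hlen := hσ.1
  have opl : OverlapPair k σ → s = 2 := by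
    rintro ⟨p, q, rfl, -⟩
    simp at hlen
    omega
  obtain ⟨j, hj1, hj2, hst, ho⟩ := h1
  obtain ⟨hlk, ho'⟩ := h2
  by_cases hO : OverlapPair k σ
  · have hs2 := opl hO
    obtain ⟨p, q, rfl, hpq, h2, hk1⟩ := hO
    subst hs2
    have E0 := l_in_E hlE (i := 0) (by omega)
    have E1 := l_in_E hlE (i := 1) (by omega)
    have E2 := l_in_E hlE (i := 2) (by omega)
    have nd := hlk.1.1
    simp only [List.nodup_cons, List.mem_cons, List.not_mem_nil, or_false, not_or] at nd
    obtain ⟨⟨n01, n02⟩, n12, -⟩ := nd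
    have hov : 2 ≤ (l.getD 0 ∅ ∩ l.getD 1 ∅).card := by
      have m0 := hin (i := 0) (by omega)
      have m1 := hin (i := 1) (by omega)
      simp only [List.mem_cons, List.not_mem_nil, or_false] at m0 m1
      rcases m0 with h0 | h0 <;> rcases m1 with h1 | h1
      · exact absurd (h0.trans h1.symm) n01
      · rw [h0, h1]; exact h2
      · rw [h0, h1, Finset.inter_comm]; exact h2
      · exact absurd (h0.trans h1.symm) n01
    obtain ⟨-, c1, c2, a1, b1, a2, b2, hS, hp⟩ := star_u2 c (by
      intro g hg
      simp only [List.mem_cons, List.not_mem_nil, or_false] at hg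
      rcases hg with rfl | rfl | rfl | rfl
      · exact E0
      · exact E1
      · exact l_in_E hlE (by omega)
      · exact l_in_E hlE (by omega)) le_rfl hst
    have mm : ∀ g, (g = a1 ∨ g = b1 ∨ g = a2 ∨ g = b2) ↔
        g ∈ [l.getD 0 ∅, l.getD 1 ∅, l.getD (j - 1) ∅, l.getD j ∅] := fun g => by
      rw [← hp.mem_iff]; simp
    have mE : ∀ g, (g = a1 ∨ g = b1 ∨ g = a2 ∨ g = b2) → g ∈ E := by
      intro g hg
      have := (mm g).1 hg
      simp only [List.mem_cons, List.not_mem_nil, or_false] at this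
      rcases this with rfl | rfl | rfl | rfl
      · exact E0
      · exact E1
      · exact l_in_E hlE (by omega)
      · exact l_in_E hlE (by omega)
    have ea1 := mE a1 (by simp)
    have eb1 := mE b1 (by simp)
    have ea2 := mE a2 (by simp)
    have eb2 := mE b2 (by simp)
    have q0 := (mm (l.getD 0 ∅)).2 (by simp)
    have q1 := (mm (l.getD 1 ∅)).2 (by simp)
    obtain ⟨-, u01⟩ := link_pair hlk (x := l.getD 0 ∅) (y := l.getD 1 ∅) (by simp) (by simp) n01
    obtain ⟨-, u02⟩ := link_pair hlk (x := l.getD 0 ∅) (y := l.getD 2 ∅) (by simp) (by simp) n02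
    obtain ⟨-, u12⟩ := link_pair hlk (x := l.getD 1 ∅) (y := l.getD 2 ∅) (by simp) (by simp) n12
    have hg2 : l.getD 2 ∅ ⊆ l.getD 0 ∅ ∪ l.getD 1 ∅ := by
      rw [u01]; exact subset_vset (by simp)
    rw [← u01] at u02 u12
    exact star_link_false c hS ea1 ea2 eb1 eb2 E2 n01 hov q0 q1 hg2 u02 u12
  · rcases ho with ho | ⟨h4, ⟨u, hu, hsσ⟩, -⟩
    · exact hO ho
    rcases ho' with ho' | ⟨-, hlσ, -⟩
    · exact hO ho'
    obtain ⟨-, c1, c2, a1, b1, a2, b2, hS, hp⟩ := star_u2 c hσE (by omega) hsσ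
    have ma1 : a1 ∈ σ := hp.mem_iff.1 (by simp)
    have mb1 : b1 ∈ σ := hp.mem_iff.1 (by simp)
    have ma2 : a2 ∈ σ := hp.mem_iff.1 (by simp)
    have nd := hp.nodup_iff.2 hsσ.1.1
    simp at nd
    obtain ⟨v1, -⟩ := link_pair hlσ ma1 mb1 nd.1.1
    obtain ⟨v2, -⟩ := link_pair hlσ ma1 ma2 nd.1.2.1
    have w1 := Finset.card_union_add_card_inter a1 b1
    have w2 := Finset.card_union_add_card_inter a1 a2
    rw [hS.i1, Finset.card_singleton] at w1
    rw [hS.card_a (c.unif _ (hσE _ ma1))] at w2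
    have := c.unif _ (hσE _ ma1)
    have := c.unif _ (hσE _ ma2)
    have := c.unif _ (hσE _ mb1)
    omega

theorem not_13 (hσ : SConfig k s σ) (h1 : Alt1 k s σ l) (h3 : Alt3 k s σ l) : False := by
  obtain ⟨j, -, -, -, ho | ho⟩ := h1
  · obtain ⟨p, q, rfl, -⟩ := ho
    have := h3.1.1
    simp at this
  · have := h3.2.1
    omega

theorem not_23 (c : Ctx k E) (hlE : l.toFinset = E) (hs : s < l.length)
    (h2 : Alt2 k s σ l) (h3 : Alt3 k s σ l) : False := by
  obtain ⟨-, ho | ⟨-, -, hlk⟩⟩ := h2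
  · obtain ⟨p, q, rfl, -⟩ := ho
    have := h3.1.1
    simp at this
  · obtain ⟨-, rfl, hk3, hP⟩ := h3
    have h6 := hP.2.2.1
    have h01 := hP.2.2.2.2 0 1 (by omega) (by omega)
    have hu := hlk.2.2.2 0 1 (by omega) (by omega)
    have hv := hlk.2.2.1
    rw [getD_take' (by omega), getD_take' (by omega)] at h01 hu
    have w1 := Finset.card_union_add_card_inter (l.getD 0 ∅) (l.getD 1 ∅)
    have := c.unif _ (l_in_E hlE (i := 0) (by omega))
    have := c.unif _ (l_in_E hlE (i := 1) (by omega))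
    rw [h6] at hv
    omega

end

/-- Claim 3.8 of the paper. Let `J` be connected, `k`-uniform, with no
bicycle, containing a configuration `S` with `s` edges, and let `e_0,…,e_t` be an allowed
edge order of `E(J)` as produced by Claim 3.7 which contains a `k`-bad edge among
`e_s,…,e_t`. Then exactly one of the three listed alternatives holds. -/
theorem kbad_edge_trichotomy {V : Type*} [DecidableEq V] {k s : ℕ} (hk : 3 ≤ k)
    (σ : List (Finset V)) (hσ : SConfig k s σ)
    (E : Finset (Finset V)) (hunif : Uniform k E) (hconn : HyperConnected E)
    (hnob : ¬ ContainsBicycle k E)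
    (l : List (Finset V)) (hl : Allowed l) (hlE : l.toFinset = E)
    (hstart : (l.take s).toFinset = σ.toFinset)
    (i : ℕ) (hi : i < s) (hOP : OPorLC k (l.take (i + 1)))
    (hgk : ∀ j, s ≤ j → j < l.length → GoodAt l j ∨ KBadAt k l j)
    (hkb : ∀ j, s + 1 ≤ j → j < l.length → KBadAt k l j →
      KBadAt k l (j - 1) ∨
        ∃ x ∈ l.getD j ∅, x ∈ l.getD (j - 1) ∅ ∧ x ∉ vset (l.take (j - 1)))
    (hex : ∃ j, s ≤ j ∧ j < l.length ∧ KBadAt k l j) :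
    ∃! c : Fin 3,
      ![(∃ j, s + 1 ≤ j ∧ j < l.length ∧
          StarKU2 k 2 [l.getD 0 ∅, l.getD 1 ∅, l.getD (j - 1) ∅, l.getD j ∅] ∧
          (OverlapPair k σ ∨
            (4 ≤ s ∧ (∃ u, s = 2 * u ∧ StarKU2 k u σ) ∧
              StarKU2 k (s / 2 + 1) (l.take s ++ [l.getD (j - 1) ∅, l.getD j ∅])))),
        (KLink k 3 ((l.getD 0 ∅ \ l.getD 1 ∅).card)
            [l.getD 0 ∅, l.getD 1 ∅, l.getD s ∅] ∧
          (OverlapPair k σ ∨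
            (3 ≤ s ∧ KLink k s ((l.getD 0 ∅ \ l.getD 1 ∅).card) σ ∧
              KLink k (s + 1) ((l.getD 0 ∅ \ l.getD 1 ∅).card) (l.take (s + 1))))),
        (LooseCycle σ ∧ s = 3 ∧ k = 3 ∧ Pasch (l.take 4))] c := by

  have c : Ctx k E := ⟨hk, hunif, hconn, hnob⟩
  have hs : s < l.length := by
    obtain ⟨j, h1, h2, -⟩ := hex
    omega
  have hor : Alt1 k s σ l ∨ Alt2 k s σ l ∨ Alt3 k s σ l := by
    rcases first_kbad c hl hlE hgk hkb hex with ⟨_, _, h3, h4⟩ |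
      ⟨m, hm1, hm2, G, z, g1, g2, g3, g4, g5, g6, g7, g8⟩
    · exact exists_inside c hσ hl hlE hstart hs h4 h3
    · exact Or.inl (exists_outside c hσ hl hlE hstart hm1 hm2 g1 g2 g3 g4 g5 g6 g7 g8)
  have n12 : Alt1 k s σ l → Alt2 k s σ l → False := not_12 c hσ hlE hstart hs
  have n13 : Alt1 k s σ l → Alt3 k s σ l → False := not_13 hσ
  have n23 : Alt2 k s σ l → Alt3 k s σ l → False := not_23 c hlE hs
  change ∃! d : Fin 3, ![Alt1 k s σ l, Alt2 k s σ l, Alt3 k s σ l] d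
  rcases hor with h | h | h
  · refine ⟨0, h, ?_⟩
    intro d hd
    fin_cases d
    · rfl
    · exact (n12 h hd).elim
    · exact (n13 h hd).elim
  · refine ⟨1, h, ?_⟩
    intro d hd
    fin_cases d
    · exact (n12 hd h).elim
    · rfl
    · exact (n23 h hd).elim
  · refine ⟨2, h, ?_⟩
    intro d hd
    fin_cases d
    · exact (n13 hd h).elim
    · exact (n23 hd h).elim
    · rfl
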